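/- Let n ≥ 2, let A be a constant positive definite n×n real matrix, and let u be a smooth, not identically zero solution of div(A∇u) = 0 on all of ℝⁿ. Then the following are equivalent: (i) there exist constants K > 0 and r₀ > 0 such that ℋ^{n-1}(Z(u) ∩ B(0,r)) ≤ K r^{n-1} for all r > r₀; (ii) u is a polynomial function. -/

import Mathlib

open MeasureTheory Metric

noncomputable section

/-- Partial derivative in the `i`-th coordinate direction. -/
def pd {n : ℕ} (i : Fin n) (u : EuclideanSpace ℝ (Fin n) → ℝ) :
    EuclideanSpace ℝ (Fin n) → ℝ :=
  fun x => fderiv ℝ u x (EuclideanSpace.single i 1)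

namespace NodalLiouville

section

/-- Smooth solutions of `div (A ∇u) = 0` on `ℝⁿ`, for a constant matrix `A`. -/
structure Sol {n : ℕ} (A : Matrix (Fin n) (Fin n) ℝ) (u : EuclideanSpace ℝ (Fin n) → ℝ) :
    Prop where
  smooth : ContDiff ℝ (⊤ : ℕ∞) u
  pde : ∀ x, ∑ i, ∑ j, A i j * pd i (pd j u) x = 0

/-- Directional derivative. -/
def dd {n : ℕ} (v : EuclideanSpace ℝ (Fin n)) (u : EuclideanSpace ℝ (Fin n) → ℝ) :
    EuclideanSpace ℝ (Fin n) → ℝ :=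
  fun x => fderiv ℝ u x v

variable {n : ℕ} {A : Matrix (Fin n) (Fin n) ℝ} {u : EuclideanSpace ℝ (Fin n) → ℝ}

theorem pd_eq_dd (i : Fin n) : pd i u = dd (EuclideanSpace.single i 1) u := rfl

theorem contDiff_dd (hu : ContDiff ℝ (⊤ : ℕ∞) u) (v : EuclideanSpace ℝ (Fin n)) :
    ContDiff ℝ (⊤ : ℕ∞) (dd v u) := by
  unfold dd
  exact (hu.fderiv_right (m := (⊤ : ℕ∞)) (by simp)).clm_apply contDiff_const

theorem dd_comm (hu : ContDiff ℝ (⊤ : ℕ∞) u) (v w : EuclideanSpace ℝ (Fin n)) :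
    dd v (dd w u) = dd w (dd v u) := by
  have key : ∀ v w x, dd v (dd w u) x = fderiv ℝ (fderiv ℝ u) x v w := by
    intro v w x
    have hd : DifferentiableAt ℝ (fderiv ℝ u) x :=
      ((hu.fderiv_right (m := (⊤ : ℕ∞)) (by simp)).differentiable (by simp)) x
    have := (hd.hasFDerivAt.clm_apply (hasFDerivAt_const w x)).fderiv
    unfold dd
    rw [this]
    simp
  ext x
  rw [key, key]
  have : IsSymmSndFDerivAt ℝ u x := (hu.contDiffAt).isSymmSndFDerivAt (by
    simp only [minSmoothness_of_isRCLikeNormedField]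
    exact WithTop.coe_le_coe.2 (le_top : (2 : ℕ∞) ≤ ⊤))
  exact this v w

theorem dd_eq_sum (v x : EuclideanSpace ℝ (Fin n)) :
    dd v u x = ∑ i, v i * pd i u x := by
  have hv : v = ∑ i, v i • EuclideanSpace.single i (1 : ℝ) := by
    ext j
    simp [Finset.sum_apply, Pi.single_apply]
  unfold dd
  conv_lhs => rw [hv]
  simp [pd]

theorem dd_finset_sum {ι : Type*} (s : Finset ι) (f : ι → EuclideanSpace ℝ (Fin n) → ℝ)
    (hf : ∀ i ∈ s, ContDiff ℝ (⊤ : ℕ∞) (f i)) (v : EuclideanSpace ℝ (Fin n)) :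
    dd v (fun x => ∑ i ∈ s, f i x) = fun x => ∑ i ∈ s, dd v (f i) x := by
  ext x
  unfold dd
  rw [fderiv_fun_sum (fun i hi => ((hf i hi).differentiable (by simp)) x)]
  simp

theorem dd_const_mul (c : ℝ) (hu : ContDiff ℝ (⊤ : ℕ∞) u) (v : EuclideanSpace ℝ (Fin n)) :
    dd v (fun x => c * u x) = fun x => c * dd v u x := by
  ext x
  unfold dd
  rw [fderiv_const_mul ((hu.differentiable (by simp)) x)]
  simp

theorem Sol.dirDeriv (h : Sol A u) (v : EuclideanSpace ℝ (Fin n)) : Sol A (dd v u) := by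
  refine ⟨contDiff_dd h.smooth v, fun x => ?_⟩
  have h1 : ∀ i j, pd i (pd j (dd v u)) = dd v (pd i (pd j u)) := by
    intro i j
    rw [pd_eq_dd, pd_eq_dd, pd_eq_dd, pd_eq_dd, dd_comm h.smooth,
      dd_comm (contDiff_dd h.smooth _)]
  have h0 : (fun x => ∑ i, ∑ j, A i j * pd i (pd j u) x) = fun _ => 0 := funext h.pde
  have h2 := congrArg (dd v) h0
  have hs : ∀ i j, ContDiff ℝ (⊤ : ℕ∞) (pd i (pd j u)) := fun i j =>
    contDiff_dd (contDiff_dd h.smooth _) _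
  rw [dd_finset_sum _ (fun i x => ∑ j, A i j * pd i (pd j u) x)
    (fun i _ => ContDiff.sum fun j _ => contDiff_const.mul (hs i j))] at h2
  have h3 := congrFun h2 x
  simp only [h1]
  have hz : dd v (fun _ : EuclideanSpace ℝ (Fin n) => (0 : ℝ)) x = 0 := by
    simp [dd]
  rw [hz] at h3
  rw [← h3]
  refine Finset.sum_congr rfl fun i _ => ?_
  rw [dd_finset_sum _ (fun j x => A i j * pd i (pd j u) x) (fun j _ => contDiff_const.mul (hs i j))]
  refine Finset.sum_congr rfl fun j _ => ?_
  rw [dd_const_mul _ (hs i j)]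

theorem pd_affine (hu : ContDiff ℝ (⊤ : ℕ∞) u) (x₀ : EuclideanSpace ℝ (Fin n)) (ρ : ℝ)
    (i : Fin n) : pd i (fun y => u (x₀ + ρ • y)) = fun y => ρ * pd i u (x₀ + ρ • y) := by
  ext y
  have h1 : HasFDerivAt (fun y : EuclideanSpace ℝ (Fin n) => x₀ + ρ • y)
      (ρ • ContinuousLinearMap.id ℝ _) y :=
    ((hasFDerivAt_id y).const_smul ρ).const_add x₀
  have h2 := (((hu.differentiable (by simp)) (x₀ + ρ • y)).hasFDerivAt.comp y h1).fderiv
  have h3 : (u ∘ fun y : EuclideanSpace ℝ (Fin n) => x₀ + ρ • y) =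
    fun y => u (x₀ + ρ • y) := rfl
  rw [h3] at h2
  unfold pd
  rw [h2]
  simp

theorem Sol.affine (h : Sol A u) (x₀ : EuclideanSpace ℝ (Fin n)) (ρ : ℝ) :
    Sol A (fun y => u (x₀ + ρ • y)) := by
  refine ⟨h.smooth.comp (contDiff_const.add (contDiff_id.const_smul ρ)), fun y => ?_⟩
  have : ∀ i j, pd i (pd j (fun y => u (x₀ + ρ • y))) y
      = ρ ^ 2 * pd i (pd j u) (x₀ + ρ • y) := by
    intro i j
    rw [pd_affine h.smooth, pd_eq_dd, dd_const_mul, ← pd_eq_dd, pd_affine]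
    · ring
    · exact contDiff_dd h.smooth _
    · exact (contDiff_dd h.smooth _).comp
        (contDiff_const.add (contDiff_id.const_smul ρ))
  simp only [this]
  have h1 := h.pde (x₀ + ρ • y)
  calc _ = ρ ^ 2 * ∑ i, ∑ j, A i j * pd i (pd j u) (x₀ + ρ • y) := by
        simp only [Finset.mul_sum]
        exact Finset.sum_congr rfl fun i _ => Finset.sum_congr rfl fun j _ => by ring
    _ = 0 := by rw [h1, mul_zero]

theorem Sol.mul_add (h : Sol A u) (a b : ℝ) : Sol A (fun y => a * u y + b) := by
  refine ⟨(contDiff_const.mul h.smooth).add contDiff_const, fun y => ?_⟩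
  have h0 : ∀ j, pd j (fun y => a * u y + b) = fun y => a * pd j u y := by
    intro j
    rw [pd_eq_dd, pd_eq_dd, ← dd_const_mul _ h.smooth]
    ext x
    simp [dd]
  have : ∀ i j, pd i (pd j (fun y => a * u y + b)) y = a * pd i (pd j u) y := by
    intro i j
    rw [h0, pd_eq_dd, dd_const_mul _ (u := pd j u) (contDiff_dd h.smooth _)]
    rfl
  simp only [this]
  have h1 := h.pde y
  calc _ = a * ∑ i, ∑ j, A i j * pd i (pd j u) y := by
        simp only [Finset.mul_sum]
        exact Finset.sum_congr rfl fun i _ => Finset.sum_congr rfl fun j _ => by ring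
    _ = 0 := by rw [h1, mul_zero]

theorem Sol.linear (v : EuclideanSpace ℝ (Fin n) →L[ℝ] ℝ) : Sol A (fun y => v y) := by
  refine ⟨v.contDiff, fun y => ?_⟩
  have h0 : ∀ j, pd j (fun y => v y) = fun _ => v (EuclideanSpace.single j 1) := by
    intro j
    ext x
    simp [pd]
  simp [h0, pd]

end

section

open scoped Matrix

variable {n : ℕ} {A : Matrix (Fin n) (Fin n) ℝ} {u : EuclideanSpace ℝ (Fin n) → ℝ}

theorem exists_quadratic_form (hn : 2 ≤ n) (hA : A.PosDef) :
    ∃ (T : EuclideanSpace ℝ (Fin n) →L[ℝ] EuclideanSpace ℝ (Fin n)) (Λ : ℝ), 0 < Λ ∧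
      (∀ x y, inner ℝ (T x) y = inner ℝ x (T y)) ∧
      (∀ y, ‖y‖ ^ 2 ≤ inner ℝ (T y) y) ∧
      (∀ y j, ∑ i, A i j * T y i = Λ * y j) := by
  set S : EuclideanSpace ℝ (Fin n) →L[ℝ] EuclideanSpace ℝ (Fin n) :=
    Matrix.toEuclideanCLM (𝕜 := ℝ) A⁻¹ with hS
  have hSi : ∀ y i, S y i = (A⁻¹ *ᵥ y.ofLp) i := fun y i => rfl
  have hB : (A⁻¹).PosDef := hA.inv
  have hBt : (A⁻¹).transpose = A⁻¹ := by
    have := hB.isHermitian.eq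
    rwa [Matrix.conjTranspose_eq_transpose_of_trivial] at this
  have hAt : A.transpose = A := by
    have := hA.isHermitian.eq
    rwa [Matrix.conjTranspose_eq_transpose_of_trivial] at this
  have hsymm : ∀ x y, inner ℝ (S x) y = inner ℝ x (S y) := by
    intro x y
    simp only [EuclideanSpace.inner_eq_star_dotProduct, star_trivial]
    have h1 : (S x).ofLp = A⁻¹ *ᵥ x.ofLp := rfl
    have h2 : (S y).ofLp = A⁻¹ *ᵥ y.ofLp := rfl
    rw [h1, h2, Matrix.dotProduct_mulVec, ← Matrix.mulVec_transpose, hBt]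
  have hpos : ∀ y, y ≠ 0 → 0 < inner ℝ (S y) y := by
    intro y hy
    simp only [EuclideanSpace.inner_eq_star_dotProduct, star_trivial]
    have h1 : (S y).ofLp = A⁻¹ *ᵥ y.ofLp := rfl
    rw [h1]
    have hy' : y.ofLp ≠ 0 := fun h => hy (by ext i; simp [h])
    simpa using hB.dotProduct_mulVec_pos hy'
  have : Nontrivial (EuclideanSpace ℝ (Fin n)) := by
    have : Nonempty (Fin n) := ⟨⟨0, by omega⟩⟩
    infer_instance
  obtain ⟨z, hz, hmin⟩ := (isCompact_sphere (0 : EuclideanSpace ℝ (Fin n)) 1).exists_isMinOn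
    (NormedSpace.sphere_nonempty.2 zero_le_one)
    (f := fun y => inner ℝ (S y) y) (by fun_prop)
  have hz0 : z ≠ 0 := by
    rintro rfl
    simp at hz
  set m := inner ℝ (S z) z with hm
  have hm0 : 0 < m := hpos z hz0
  have hlow : ∀ y, m * ‖y‖ ^ 2 ≤ inner ℝ (S y) y := by
    intro y
    rcases eq_or_ne y 0 with rfl | hy
    · simp
    have hny : ‖y‖ ≠ 0 := norm_ne_zero_iff.2 hy
    have h1 := hmin (show ‖y‖⁻¹ • y ∈ sphere (0 : EuclideanSpace ℝ (Fin n)) 1 by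
      simp [norm_smul, hny])
    change m ≤ inner ℝ (S (‖y‖⁻¹ • y)) (‖y‖⁻¹ • y) at h1
    rw [map_smul, inner_smul_left, inner_smul_right] at h1
    have h2 : inner ℝ (S y) y = ‖y‖ ^ 2 * (‖y‖⁻¹ * (‖y‖⁻¹ * inner ℝ (S y) y)) := by
      field_simp
    rw [h2, mul_comm m]
    exact mul_le_mul_of_nonneg_left (by simpa using h1) (by positivity)
  refine ⟨m⁻¹ • S, m⁻¹, inv_pos.2 hm0, ?_, ?_, ?_⟩
  · intro x y
    simp [inner_smul_left, inner_smul_right, hsymm]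
  · intro y
    have := hlow y
    simp only [_root_.smul_apply, inner_smul_left]
    rw [show (starRingEnd ℝ) m⁻¹ = m⁻¹ from rfl, ← div_eq_inv_mul, le_div_iff₀ hm0, mul_comm]
    exact this
  · intro y j
    have h1 : (A *ᵥ (A⁻¹ *ᵥ y.ofLp)) j = y j := by
      rw [Matrix.mulVec_mulVec, Matrix.mul_nonsing_inv _ hA.det_pos.ne'.isUnit, Matrix.one_mulVec]
    have h2 : ∑ i, A i j * S y i = y j := by
      rw [← h1]
      simp only [Matrix.mulVec, dotProduct]
      refine Finset.sum_congr rfl fun i _ => ?_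
      have : A j i = A i j := by conv_lhs => rw [← hAt]; simp [Matrix.transpose]
      rw [this]; rfl
    rw [← h2, Finset.mul_sum]
    refine Finset.sum_congr rfl fun i _ => ?_
    simp
    ring

theorem hasDerivAt_max_zero_sq (t : ℝ) :
    HasDerivAt (fun t : ℝ => (max 0 t) ^ 2) (2 * max 0 t) t := by
  rcases lt_trichotomy t 0 with h | rfl | h
  · rw [max_eq_left h.le, mul_zero]
    refine (hasDerivAt_const t (0 : ℝ)).congr_of_eventuallyEq ?_
    filter_upwards [gt_mem_nhds h] with s hs
    rw [max_eq_left (le_of_lt hs)]; ring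
  · rw [hasDerivAt_iff_isLittleO]
    simp only [sub_zero, max_self, mul_zero, smul_zero, ne_eq, OfNat.ofNat_ne_zero,
      not_false_eq_true, zero_pow]
    have : (fun x : ℝ => max 0 x ^ 2) =O[nhds 0] fun x => x ^ 2 := by
      refine Asymptotics.isBigO_of_le _ fun x => ?_
      rw [Real.norm_of_nonneg (by positivity), Real.norm_of_nonneg (by positivity)]
      rcases le_total 0 x with h | h
      · rw [max_eq_right h]
      · rw [max_eq_left h]; nlinarith [sq_nonneg x]
    exact this.trans_isLittleO (Asymptotics.isLittleO_pow_id (by norm_num))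
  · rw [max_eq_right h.le]
    have h1 : HasDerivAt (fun t : ℝ => t ^ 2) (2 * t) t := by simpa using hasDerivAt_pow 2 t
    refine h1.congr_of_eventuallyEq ?_
    filter_upwards [lt_mem_nhds h] with s hs
    rw [max_eq_right (le_of_lt hs)]

theorem integral_sum_sum {ι α : Type*} [Fintype ι] [MeasurableSpace α] {μ : Measure α}
    (c : ι → ι → ℝ) (f : ι → ι → α → ℝ) (hf : ∀ i j, Integrable (f i j) μ) :
    ∫ y, ∑ i, ∑ j, c i j * f i j y ∂μ = ∑ i, ∑ j, c i j * ∫ y, f i j y ∂μ := by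
  rw [integral_finsetSum _ (fun i _ => integrable_finsetSum _ fun j _ =>
    (hf i j).const_mul (c i j))]
  refine Finset.sum_congr rfl fun i _ => ?_
  rw [integral_finsetSum _ (fun j _ => (hf i j).const_mul _)]
  simp only [integral_const_mul]

/-- The mean value kernel attached to a quadratic form. -/
def ker (T : EuclideanSpace ℝ (Fin n) →L[ℝ] EuclideanSpace ℝ (Fin n))
    (y : EuclideanSpace ℝ (Fin n)) : ℝ := max 0 (1 - inner ℝ (T y) y)

variable {T : EuclideanSpace ℝ (Fin n) →L[ℝ] EuclideanSpace ℝ (Fin n)} {Λ : ℝ}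

theorem ker_nonneg (y : EuclideanSpace ℝ (Fin n)) : 0 ≤ ker T y := le_max_left _ _

theorem continuous_ker : Continuous (ker T) := by
  unfold ker
  fun_prop

theorem ker_eq_zero (hT : ∀ y, ‖y‖ ^ 2 ≤ inner ℝ (T y) y) {y : EuclideanSpace ℝ (Fin n)}
    (hy : 1 ≤ ‖y‖) : ker T y = 0 :=
  max_eq_left (by nlinarith [hT y])

theorem hasCompactSupport_ker (hT : ∀ y, ‖y‖ ^ 2 ≤ inner ℝ (T y) y) :
    HasCompactSupport (ker T) :=
  HasCompactSupport.intro (isCompact_closedBall 0 1) fun y hy =>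
    ker_eq_zero hT (by simp at hy; exact hy.le)

theorem fderiv_ker_sq (hs : ∀ x y, inner ℝ (T x) y = inner ℝ x (T y))
    (y : EuclideanSpace ℝ (Fin n)) :
    DifferentiableAt ℝ (fun y => ker T y ^ 2) y ∧
    ∀ v, fderiv ℝ (fun y => ker T y ^ 2) y v = -4 * ker T y * inner ℝ (T y) v := by
  have h1 : HasFDerivAt (fun y => 1 - inner ℝ (T y) y)
      (-((fderivInnerCLM ℝ (T y, y)).comp (T.prod (ContinuousLinearMap.id ℝ _)))) y :=
    (HasFDerivAt.inner ℝ T.hasFDerivAt (hasFDerivAt_id y)).const_sub 1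
  have h2 := (hasDerivAt_max_zero_sq (1 - inner ℝ (T y) y)).comp_hasFDerivAt y h1
  refine ⟨h2.differentiableAt, fun v => ?_⟩
  have h3 : (fun t : ℝ => max 0 t ^ 2) ∘ (fun y => 1 - inner ℝ (T y) y) =
    fun y => ker T y ^ 2 := rfl
  rw [h3] at h2
  rw [h2.fderiv]
  simp only [_root_.smul_apply, _root_.neg_apply, ContinuousLinearMap.comp_apply,
    ContinuousLinearMap.prod_apply, fderivInnerCLM_apply, smul_eq_mul, ker]
  rw [hs v y, real_inner_comm (T y) v]
  simp
  ring

theorem integral_ker_mul_fderiv_eq_zero (hs : ∀ x y, inner ℝ (T x) y = inner ℝ x (T y))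
    (hT : ∀ y, ‖y‖ ^ 2 ≤ inner ℝ (T y) y) (hΛ : 0 < Λ)
    (hAT : ∀ y j, ∑ i, A i j * T y i = Λ * y j) (hu : Sol A u) :
    ∫ y, ker T y * fderiv ℝ u y y = 0 := by
  have hψc : HasCompactSupport (fun y => ker T y ^ 2) :=
    (hasCompactSupport_ker hT).comp_left (g := fun t : ℝ => t ^ 2) (by simp)
  have hcont : Continuous (fun y => ker T y ^ 2) := continuous_ker.pow 2
  have hfd : ∀ i y, fderiv ℝ (fun y => ker T y ^ 2) y (EuclideanSpace.single i 1)
      = -4 * ker T y * T y i := by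
    intro i y
    rw [(fderiv_ker_sq hs y).2, EuclideanSpace.inner_single_right]
    simp
  have hpc : ∀ i j, Continuous (pd i (pd j u)) := fun i j =>
    (contDiff_dd (contDiff_dd hu.smooth _) _).continuous
  have hpc1 : ∀ j, Continuous (pd j u) := fun j => (contDiff_dd hu.smooth _).continuous
  have hTi : ∀ i, Continuous (fun y => T y i) := fun i => by fun_prop
  have hI1 : ∀ i j, Integrable (fun y => -4 * ker T y * T y i * pd j u y) := by
    intro i j
    refine Continuous.integrable_of_hasCompactSupport
      (((continuous_const.mul continuous_ker).mul (hTi i)).mul (hpc1 j)) ?_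
    exact ((hasCompactSupport_ker hT).mul_left (f := fun _ => (-4 : ℝ))).mul_right.mul_right
  have hI2 : ∀ i j, Integrable (fun y => ker T y ^ 2 * pd i (pd j u) y) := fun i j =>
    Continuous.integrable_of_hasCompactSupport (hcont.mul (hpc i j)) hψc.mul_right
  have hparts : ∀ i j, ∫ y, ker T y ^ 2 * pd i (pd j u) y
      = - ∫ y, -4 * ker T y * T y i * pd j u y := by
    intro i j
    have := integral_mul_fderiv_eq_neg_fderiv_mul_of_integrable (μ := volume)
      (f := fun y => ker T y ^ 2) (g := pd j u) (v := EuclideanSpace.single i 1)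
      (by simpa only [hfd] using hI1 i j) (hI2 i j)
      (Continuous.integrable_of_hasCompactSupport (hcont.mul (hpc1 j)) hψc.mul_right)
      (fun y _ => (fderiv_ker_sq hs y).1)
      (fun y _ => ((contDiff_dd hu.smooth _).differentiable (by simp)) y)
    simp only [hfd] at this
    exact this
  have hsum : ∑ i, ∑ j, A i j * ∫ y, ker T y ^ 2 * pd i (pd j u) y = 0 := by
    have : ∫ y, ∑ i, ∑ j, A i j * (ker T y ^ 2 * pd i (pd j u) y) = 0 := by
      have h0 : ∀ y, ∑ i, ∑ j, A i j * (ker T y ^ 2 * pd i (pd j u) y) = 0 := by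
        intro y
        have := hu.pde y
        calc _ = ker T y ^ 2 * ∑ i, ∑ j, A i j * pd i (pd j u) y := by
              simp only [Finset.mul_sum]
              exact Finset.sum_congr rfl fun i _ => Finset.sum_congr rfl fun j _ => by ring
          _ = 0 := by rw [this, mul_zero]
      simp [h0]
    exact (integral_sum_sum (fun i j => A i j) _ hI2).symm.trans this
  have hpt : ∀ y, ∑ i, ∑ j, A i j * (-4 * ker T y * T y i * pd j u y)
      = -(4 * Λ) * (ker T y * fderiv ℝ u y y) := by
    intro y
    rw [Finset.sum_comm]
    have h1 : fderiv ℝ u y y = ∑ j, y j * pd j u y := dd_eq_sum y y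
    rw [h1, Finset.mul_sum, Finset.mul_sum]
    refine Finset.sum_congr rfl fun j _ => ?_
    calc _ = -4 * ker T y * pd j u y * ∑ i, A i j * T y i := by
          rw [Finset.mul_sum]
          exact Finset.sum_congr rfl fun i _ => by ring
      _ = _ := by rw [hAT]; ring
  have h2 : ∫ y, -(4 * Λ) * (ker T y * fderiv ℝ u y y) = 0 := by
    simp only [← hpt]
    simp only [hparts, mul_neg, Finset.sum_neg_distrib, neg_eq_zero] at hsum
    exact (integral_sum_sum (fun i j => A i j) _ hI1).trans hsum
  rw [integral_const_mul] at h2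
  exact (mul_eq_zero.1 h2).resolve_left (by simp [hΛ.ne.symm])

/-- Mean value property with respect to the kernel `ker T`. -/
theorem mean_value (hs : ∀ x y, inner ℝ (T x) y = inner ℝ x (T y))
    (hT : ∀ y, ‖y‖ ^ 2 ≤ inner ℝ (T y) y) (hΛ : 0 < Λ)
    (hAT : ∀ y j, ∑ i, A i j * T y i = Λ * y j) (hu : Sol A u)
    (x : EuclideanSpace ℝ (Fin n)) (r : ℝ) :
    ∫ y, ker T y * u (x + r • y) = (∫ y, ker T y) * u x := by
  have hder : ∀ r : ℝ, HasDerivAt (fun r : ℝ => ∫ y, ker T y * u (x + r • y))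
      (∫ y, ker T y * fderiv ℝ u (x + r • y) y) r := by
    intro r₀
    have hc : Continuous (fderiv ℝ u) := hu.smooth.continuous_fderiv (by simp)
    obtain ⟨C, hC⟩ := (isCompact_closedBall x (|r₀| + 1)).exists_bound_of_continuousOn
      hc.continuousOn
    have hC0 : 0 ≤ C := (norm_nonneg _).trans (hC x (mem_closedBall_self (by positivity)))
    have hcu := hu.smooth.continuous
    refine (hasDerivAt_integral_of_dominated_loc_of_deriv_le (𝕜 := ℝ) (s := ball r₀ 1)
      (F := fun r y => ker T y * u (x + r • y))
      (F' := fun r y => ker T y * fderiv ℝ u (x + r • y) y)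
      (bound := fun y => C * ker T y) (ball_mem_nhds r₀ one_pos) ?_ ?_ ?_ ?_ ?_ ?_).2
    · exact Filter.Eventually.of_forall fun r => Continuous.aestronglyMeasurable
        (continuous_ker.mul (hcu.comp (by fun_prop)))
    · exact Continuous.integrable_of_hasCompactSupport
        (continuous_ker.mul (hcu.comp (by fun_prop))) (hasCompactSupport_ker hT).mul_right
    · exact Continuous.aestronglyMeasurable
        (continuous_ker.mul ((hc.comp (g := fderiv ℝ u) (f := fun y => x + r₀ • y)
          (by fun_prop)).clm_apply continuous_id))
    · refine Filter.Eventually.of_forall fun y r hr => ?_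
      rw [norm_mul, Real.norm_of_nonneg (ker_nonneg y), mul_comm]
      rcases le_total 1 ‖y‖ with hy | hy
      · simp [ker_eq_zero hT hy]
      refine mul_le_mul_of_nonneg_right ?_ (ker_nonneg y)
      refine (ContinuousLinearMap.le_opNorm _ _).trans ?_
      have : ‖fderiv ℝ u (x + r • y)‖ ≤ C := by
        refine hC _ ?_
        rw [mem_closedBall, dist_eq_norm, add_sub_cancel_left, norm_smul, Real.norm_eq_abs]
        rw [mem_ball, Real.dist_eq] at hr
        have h1 : |r| ≤ |r₀| + 1 := by
          have := abs_sub_abs_le_abs_sub r r₀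
          linarith
        nlinarith [abs_nonneg r, norm_nonneg y]
      nlinarith [norm_nonneg y]
    · exact (Continuous.integrable_of_hasCompactSupport continuous_ker
        (hasCompactSupport_ker hT)).const_mul C
    · refine Filter.Eventually.of_forall fun y r _ => ?_
      have h1 : HasDerivAt (fun r : ℝ => x + r • y) y r := by
        simpa using ((hasDerivAt_id r).smul_const y).const_add x
      exact (((hu.smooth.differentiable (by simp)) _).hasFDerivAt.comp_hasDerivAt r h1).const_mul _
  have hzero : ∀ r : ℝ, ∫ y, ker T y * fderiv ℝ u (x + r • y) y = 0 := by
    intro r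
    rcases eq_or_ne r 0 with rfl | hr
    · have := integral_ker_mul_fderiv_eq_zero hs hT hΛ hAT (Sol.linear (A := A) (fderiv ℝ u x))
      simpa using this
    · have := integral_ker_mul_fderiv_eq_zero hs hT hΛ hAT (hu.affine x r)
      have h2 : ∀ y, fderiv ℝ (fun y => u (x + r • y)) y y = r * fderiv ℝ u (x + r • y) y := by
        intro y
        have h1 : HasFDerivAt (fun y : EuclideanSpace ℝ (Fin n) => x + r • y)
            (r • ContinuousLinearMap.id ℝ _) y :=
          ((hasFDerivAt_id y).const_smul r).const_add x
        have h2 := (((hu.smooth.differentiable (by simp)) (x + r • y)).hasFDerivAt.comp y h1).fderiv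
        have h3 : (u ∘ fun y : EuclideanSpace ℝ (Fin n) => x + r • y) =
          fun y => u (x + r • y) := rfl
        rw [h3] at h2
        rw [h2]
        simp
      simp only [h2, mul_left_comm _ r] at this
      rw [integral_const_mul] at this
      exact (mul_eq_zero.1 this).resolve_left hr
  have hconst := is_const_of_deriv_eq_zero (fun r => (hder r).differentiableAt)
    (fun r => by rw [(hder r).deriv, hzero]) r 0
  simp only [zero_smul, add_zero] at hconst
  rw [hconst, integral_mul_const]

end

section

variable {n : ℕ} {A : Matrix (Fin n) (Fin n) ℝ} {u : EuclideanSpace ℝ (Fin n) → ℝ}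
variable {T : EuclideanSpace ℝ (Fin n) →L[ℝ] EuclideanSpace ℝ (Fin n)} {Λ : ℝ}

theorem abs_ker_sub_le (hT : ∀ y, ‖y‖ ^ 2 ≤ inner ℝ (T y) y)
    {w : EuclideanSpace ℝ (Fin n)} (hw : ‖w‖ ≤ 1) (z : EuclideanSpace ℝ (Fin n)) :
    |ker T (z - w) - ker T z| ≤
      (closedBall (0 : EuclideanSpace ℝ (Fin n)) 2).indicator (fun _ => 5 * ‖T‖ * ‖w‖) z := by
  by_cases hz : z ∈ closedBall (0 : EuclideanSpace ℝ (Fin n)) 2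
  · rw [Set.indicator_of_mem hz]
    rw [mem_closedBall_zero_iff] at hz
    have h1 : |ker T (z - w) - ker T z| ≤
        |(1 - inner ℝ (T (z - w)) (z - w)) - (1 - inner ℝ (T z) z)| := by
      unfold ker
      rw [max_comm 0, max_comm 0]
      exact abs_max_sub_max_le_abs _ _ _
    refine h1.trans ?_
    have h2 : (1 - inner ℝ (T (z - w)) (z - w)) - (1 - inner ℝ (T z) z)
        = inner ℝ (T w) (z - w) + inner ℝ (T z) w := by
      rw [map_sub, inner_sub_left, inner_sub_right (T z)]
      ring
    rw [h2]
    have h3 : |inner ℝ (T w) (z - w)| ≤ ‖T‖ * ‖w‖ * 3 := by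
      refine (abs_real_inner_le_norm _ _).trans ?_
      refine mul_le_mul (T.le_opNorm w) ?_ (norm_nonneg _) (by positivity)
      linarith [norm_sub_le z w]
    have h4 : |inner ℝ (T z) w| ≤ ‖T‖ * 2 * ‖w‖ := by
      refine (abs_real_inner_le_norm _ _).trans ?_
      refine mul_le_mul_of_nonneg_right ((T.le_opNorm z).trans ?_) (norm_nonneg _)
      exact mul_le_mul_of_nonneg_left hz (norm_nonneg _)
    linarith [abs_add_le (inner ℝ (T w) (z - w)) (inner ℝ (T z) w)]
  · rw [Set.indicator_of_notMem hz]
    have hz' : 2 < ‖z‖ := by simpa using hz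
    rw [ker_eq_zero hT (show 1 ≤ ‖z‖ by linarith),
      ker_eq_zero hT (show 1 ≤ ‖z - w‖ by linarith [norm_sub_norm_le z w])]
    simp

/-- Oscillation bound by the mean of the absolute value. -/
theorem oscillation_le_integral (hs : ∀ x y, inner ℝ (T x) y = inner ℝ x (T y))
    (hT : ∀ y, ‖y‖ ^ 2 ≤ inner ℝ (T y) y) (hΛ : 0 < Λ)
    (hAT : ∀ y j, ∑ i, A i j * T y i = Λ * y j) (hu : Sol A u) {ρ : ℝ} (hρ : 0 < ρ)
    {y : EuclideanSpace ℝ (Fin n)} (hy : ‖y‖ ≤ ρ) :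
    (∫ z, ker T z) * |u y - u 0| ≤ 5 * ‖T‖ * (‖y‖ / ρ) *
      ∫ z in closedBall (0 : EuclideanSpace ℝ (Fin n)) 2, |u (ρ • z)| := by
  set w := ρ⁻¹ • y with hw
  have hwn : ‖w‖ = ‖y‖ / ρ := by rw [hw, norm_smul, norm_inv, Real.norm_of_nonneg hρ.le]; ring
  have hw1 : ‖w‖ ≤ 1 := by rw [hwn, div_le_one hρ]; exact hy
  have hI0 : 0 ≤ ∫ z, ker T z := integral_nonneg fun _ => ker_nonneg _
  have h1 := mean_value hs hT hΛ hAT hu y ρ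
  have h2 := mean_value hs hT hΛ hAT hu 0 ρ
  have hcu := hu.smooth.continuous
  have h3 : ∫ z, ker T z * u (y + ρ • z) = ∫ z, ker T (z - w) * u (ρ • z) := by
    rw [← integral_sub_right_eq_self (fun z => ker T z * u (y + ρ • z)) w]
    congr 1
    ext z
    congr 2
    rw [hw, smul_sub, smul_smul, mul_inv_cancel₀ hρ.ne', one_smul]
    abel
  rw [h3] at h1
  simp only [zero_add] at h2
  have hint1 : Integrable (fun z => ker T (z - w) * u (ρ • z)) := by
    refine Continuous.integrable_of_hasCompactSupport
      ((continuous_ker.comp (by fun_prop)).mul (hcu.comp (by fun_prop))) ?_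
    refine HasCompactSupport.mul_right ?_
    exact (hasCompactSupport_ker hT).comp_homeomorph (Homeomorph.subRight w)
  have hint2 : Integrable (fun z => ker T z * u (ρ • z)) :=
    Continuous.integrable_of_hasCompactSupport
      (continuous_ker.mul (hcu.comp (by fun_prop))) (hasCompactSupport_ker hT).mul_right
  have h4 : (∫ z, ker T z) * |u y - u 0| = |∫ z, (ker T (z - w) - ker T z) * u (ρ • z)| := by
    rw [← abs_of_nonneg hI0, ← abs_mul, mul_sub, ← h1, ← h2,
      ← integral_sub hint1 hint2]
    congr 2
    ext z
    ring
  rw [h4]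
  refine (abs_integral_le_integral_abs).trans ?_
  rw [← integral_const_mul, ← integral_indicator measurableSet_closedBall]
  have hcont : Continuous fun z : EuclideanSpace ℝ (Fin n) => |u (ρ • z)| :=
    (hcu.comp (by fun_prop)).abs
  refine integral_mono_of_nonneg (Filter.Eventually.of_forall fun z => abs_nonneg _) ?_
    (Filter.Eventually.of_forall fun z => ?_)
  · exact ((continuous_const.mul hcont).continuousOn.integrableOn_compact
      (isCompact_closedBall _ _)).integrable_indicator measurableSet_closedBall
  · simp only [abs_mul]
    refine (mul_le_mul_of_nonneg_right (abs_ker_sub_le hT hw1 z) (abs_nonneg _)).trans ?_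
    by_cases hz : z ∈ closedBall (0 : EuclideanSpace ℝ (Fin n)) 2
    · rw [Set.indicator_of_mem hz, Set.indicator_of_mem hz, hwn]
    · rw [Set.indicator_of_notMem hz, Set.indicator_of_notMem hz, zero_mul]

theorem exists_normalized_estimates (hn : 2 ≤ n) (hA : A.PosDef) :
    ∃ ρ C : ℝ, 0 < ρ ∧ ρ ≤ 1 ∧ 0 < C ∧ ∀ u, Sol A u →
      (∀ M, (∀ y, ‖y‖ ≤ 1 → |u y| ≤ M) → ∀ y, ‖y‖ ≤ ρ → |u y - u 0| ≤ C * ‖y‖ * M) ∧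
      ((∀ y, ‖y‖ ≤ 1 → 0 ≤ u y) → ∀ y, ‖y‖ ≤ ρ → |u y - u 0| ≤ C * ‖y‖ * u 0) := by
  obtain ⟨T, Λ, hΛ, hs, hT, hAT⟩ := exists_quadratic_form hn hA
  set I := ∫ z, ker T z with hI
  set ρ₀ : ℝ := min 1 (1 / (2 * (‖T‖ + 1))) with hρ₀
  have hTn := norm_nonneg T
  have hρ₀0 : 0 < ρ₀ := by positivity
  have hρ₀1 : ρ₀ ≤ 1 := min_le_left _ _
  have hker : ∀ y, ‖y‖ ≤ ρ₀ → 1 / 2 ≤ ker T y := by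
    intro y hy
    refine le_trans ?_ (le_max_right _ _)
    have h1 : inner ℝ (T y) y ≤ ‖T‖ * ‖y‖ * ‖y‖ :=
      (real_inner_le_norm _ _).trans
        (mul_le_mul_of_nonneg_right (T.le_opNorm y) (norm_nonneg _))
    have h2 : ‖T‖ * ‖y‖ * ‖y‖ ≤ ‖T‖ * ρ₀ * 1 := by
      gcongr
      exact hy.trans hρ₀1
    have h3 : ‖T‖ * ρ₀ ≤ ‖T‖ * (1 / (2 * (‖T‖ + 1))) :=
      mul_le_mul_of_nonneg_left (min_le_right _ _) hTn
    have h4 : ‖T‖ * (1 / (2 * (‖T‖ + 1))) ≤ 1 / 2 := by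
      rw [mul_one_div, div_le_div_iff₀ (by positivity) (by positivity)]
      linarith
    linarith
  have hInt : Integrable (ker T) :=
    Continuous.integrable_of_hasCompactSupport continuous_ker (hasCompactSupport_ker hT)
  have hI0 : 0 < I := by
    rw [hI, integral_pos_iff_support_of_nonneg (fun _ => ker_nonneg _) hInt]
    refine lt_of_lt_of_le (measure_closedBall_pos volume 0 hρ₀0) (measure_mono fun y hy => ?_)
    have := hker y (by simpa using hy)
    rw [Function.mem_support]
    linarith
  set ρ := ρ₀ / 2 with hρ
  have hρ0 : 0 < ρ := by positivity
  set V := (volume (closedBall (0 : EuclideanSpace ℝ (Fin n)) 2)).toReal with hV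
  set C₁ := 5 * ‖T‖ / ρ * V / I with hC₁
  set C₂ := 5 * ‖T‖ / ρ * ((ρ ^ n)⁻¹ * 2) with hC₂
  have hV0 : 0 ≤ V := ENNReal.toReal_nonneg
  refine ⟨ρ, C₁ + C₂ + 1, hρ0, by linarith, by positivity, fun u hu => ⟨?_, ?_⟩⟩
  · intro M hM y hy
    have hM0 : 0 ≤ M := (abs_nonneg _).trans (hM 0 (by simp))
    have h1 := oscillation_le_integral hs hT hΛ hAT hu hρ0 hy
    have h2 : ∫ z in closedBall (0 : EuclideanSpace ℝ (Fin n)) 2, |u (ρ • z)| ≤ M * V := by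
      have := norm_setIntegral_le_of_norm_le_const (μ := volume)
        (s := closedBall (0 : EuclideanSpace ℝ (Fin n)) 2) (f := fun z => |u (ρ • z)|) (C := M)
        measure_closedBall_lt_top (fun z hz => by
          rw [Real.norm_eq_abs, abs_abs]
          apply hM
          rw [norm_smul, Real.norm_of_nonneg hρ0.le]
          rw [mem_closedBall_zero_iff] at hz
          nlinarith)
      exact (le_abs_self _).trans this
    have h3 : I * |u y - u 0| ≤ I * (C₁ * ‖y‖ * M) := by
      refine h1.trans ((mul_le_mul_of_nonneg_left h2 (by positivity)).trans (le_of_eq ?_))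
      rw [hC₁]
      field_simp
    have h4 := le_of_mul_le_mul_left h3 hI0
    refine h4.trans ?_
    have : C₁ ≤ C₁ + C₂ + 1 := by
      have : 0 ≤ C₂ := by positivity
      linarith
    gcongr
  · intro hpos y hy
    have h0 : 0 ≤ u 0 := hpos 0 (by simp)
    have h1 := oscillation_le_integral hs hT hΛ hAT hu hρ0 hy
    have hcu := hu.smooth.continuous
    have h2 : ∫ z in closedBall (0 : EuclideanSpace ℝ (Fin n)) 2, |u (ρ • z)|
        = (ρ ^ n)⁻¹ * ∫ z in closedBall (0 : EuclideanSpace ℝ (Fin n)) ρ₀, |u z| := by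
      rw [Measure.setIntegral_comp_smul_of_pos volume (fun z => |u z|) _ hρ0,
        _root_.smul_closedBall _ _ (by norm_num), smul_zero, Real.norm_of_nonneg hρ0.le,
        finrank_euclideanSpace_fin, hρ, div_mul_cancel₀ _ (by norm_num : (2 : ℝ) ≠ 0), smul_eq_mul]
    have h3 : ∫ z in closedBall (0 : EuclideanSpace ℝ (Fin n)) ρ₀, |u z| ≤ 2 * (I * u 0) := by
      have hm := mean_value hs hT hΛ hAT hu 0 1
      simp only [zero_add, one_smul] at hm
      rw [hI, ← hm, ← integral_const_mul, ← integral_indicator measurableSet_closedBall]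
      refine integral_mono_of_nonneg (Filter.Eventually.of_forall fun z => ?_) ?_
        (Filter.Eventually.of_forall fun z => ?_)
      · exact Set.indicator_nonneg (fun _ _ => abs_nonneg _) _
      · exact (Continuous.integrable_of_hasCompactSupport (continuous_ker.mul hcu)
          (hasCompactSupport_ker hT).mul_right).const_mul 2
      · simp only
        by_cases hz : z ∈ closedBall (0 : EuclideanSpace ℝ (Fin n)) ρ₀
        · rw [Set.indicator_of_mem hz]
          rw [mem_closedBall_zero_iff] at hz
          have := hker z hz
          have hp := hpos z (hz.trans hρ₀1)
          rw [abs_of_nonneg hp]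
          nlinarith
        · rw [Set.indicator_of_notMem hz]
          rcases le_total 1 ‖z‖ with h | h
          · simp [ker_eq_zero hT h]
          · have := ker_nonneg (T := T) z
            have := hpos z h
            positivity
    have h4 : I * |u y - u 0| ≤ I * (C₂ * ‖y‖ * u 0) := by
      rw [h2] at h1
      refine h1.trans ((mul_le_mul_of_nonneg_left
        (mul_le_mul_of_nonneg_left h3 (by positivity)) (by positivity)).trans (le_of_eq ?_))
      rw [hC₂]
      field_simp
    have h5 := le_of_mul_le_mul_left h4 hI0
    refine h5.trans ?_
    have : C₂ ≤ C₁ + C₂ + 1 := by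
      have : 0 ≤ C₁ := by positivity
      linarith
    gcongr

/-- Gradient estimate and Harnack-type estimate for solutions. -/
theorem exists_gradient_estimates (hn : 2 ≤ n) (hA : A.PosDef) :
    ∃ C : ℝ, 1 ≤ C ∧ ∀ u, Sol A u → ∀ x s, 0 < s →
      (∀ M, (∀ y ∈ closedBall x s, |u y| ≤ M) →
        ∀ y ∈ closedBall x s, |u y - u x| ≤ C * (‖y - x‖ / s) * M) ∧
      ((∀ y ∈ closedBall x s, 0 ≤ u y) →
        ∀ y, ‖y - x‖ ≤ s / C → |u y - u x| ≤ C * (‖y - x‖ / s) * u x) := by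
  obtain ⟨ρ, C, hρ0, hρ1, hC, h⟩ := exists_normalized_estimates hn hA
  have hρi : 1 ≤ ρ⁻¹ := (one_le_inv₀ hρ0).2 hρ1
  refine ⟨C + 2 * ρ⁻¹, by linarith, fun u hu x s hs => ?_⟩
  obtain ⟨h1, h2⟩ := h _ (hu.affine x s)
  have hmem : ∀ y : EuclideanSpace ℝ (Fin n), ‖y‖ ≤ 1 → x + s • y ∈ closedBall x s := by
    intro y hy
    rw [mem_closedBall, dist_eq_norm, add_sub_cancel_left, norm_smul, Real.norm_of_nonneg hs.le]
    nlinarith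
  have hy' : ∀ y, x + s • (s⁻¹ • (y - x)) = y := by
    intro y
    rw [smul_smul, mul_inv_cancel₀ hs.ne', one_smul]
    abel
  have hyn : ∀ y, ‖s⁻¹ • (y - x)‖ = ‖y - x‖ / s := by
    intro y
    rw [norm_smul, norm_inv, Real.norm_of_nonneg hs.le]
    ring
  simp only [smul_zero, add_zero] at h1 h2
  constructor
  · intro M hM y hy
    have hM0 : 0 ≤ M := (abs_nonneg _).trans (hM x (mem_closedBall_self hs.le))
    rcases le_total (‖y - x‖ / s) ρ with hle | hle
    · have := h1 M (fun z hz => hM _ (hmem z hz)) (s⁻¹ • (y - x)) (by rw [hyn]; exact hle)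
      rw [hy', hyn] at this
      refine this.trans ?_
      gcongr
      linarith [inv_pos.2 hρ0]
    · have h3 : |u y - u x| ≤ 2 * M := by
        have := hM y hy
        have := hM x (mem_closedBall_self hs.le)
        have := abs_sub (u y) (u x)
        linarith
      have h4 : 2 ≤ 2 * ρ⁻¹ * (‖y - x‖ / s) := by
        rw [mul_assoc, inv_mul_eq_div]
        have := (one_le_div hρ0).2 hle
        linarith
      have h5 : 2 ≤ (C + 2 * ρ⁻¹) * (‖y - x‖ / s) := by
        have : 0 ≤ C * (‖y - x‖ / s) := by positivity
        linarith
      exact h3.trans (mul_le_mul_of_nonneg_right h5 hM0)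
  · intro hpos y hy
    have h0 : 0 ≤ u x := hpos x (mem_closedBall_self hs.le)
    have hle : ‖y - x‖ / s ≤ ρ := by
      rw [div_le_iff₀ hs]
      refine hy.trans ?_
      rw [div_le_iff₀ (by positivity)]
      have : 1 ≤ ρ * (C + 2 * ρ⁻¹) := by
        have : ρ * ρ⁻¹ = 1 := mul_inv_cancel₀ hρ0.ne'
        nlinarith
      nlinarith
    have := h2 (fun z hz => hpos _ (hmem z hz)) (s⁻¹ • (y - x)) (by rw [hyn]; exact hle)
    rw [hy', hyn] at this
    refine this.trans ?_
    gcongr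
    linarith [inv_pos.2 hρ0]

end

section

/-- One-dimensional Taylor bound for a sequence of successive derivatives, to the right of `0`. -/
theorem taylor_bound_right {T B : ℝ} (d : ℕ) (f : ℕ → ℝ → ℝ)
    (hf : ∀ k t, HasDerivAt (f k) (f (k + 1) t) t)
    (hB : ∀ t, 0 ≤ t → t ≤ T → |f (d + 1) t| ≤ B) :
    ∀ t, 0 ≤ t → t ≤ T →
      |f 0 t - ∑ k ∈ Finset.range (d + 1), f k 0 * t ^ k / k.factorial|
        ≤ B * t ^ (d + 1) / (d + 1).factorial := by
  have main : ∀ (d : ℕ) (f : ℕ → ℝ → ℝ), (∀ k t, HasDerivAt (f k) (f (k + 1) t) t) →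
      (∀ t, 0 ≤ t → t ≤ T → |f d t| ≤ B) → ∀ t, 0 ≤ t → t ≤ T →
      |f 0 t - ∑ k ∈ Finset.range d, f k 0 * t ^ k / k.factorial| ≤ B * t ^ d / d.factorial := by
    intro d
    induction d with
    | zero =>
      intro f _ hB t h0 hT
      simpa using hB t h0 hT
    | succ d ih =>
      intro f hf hB t h0 hT
      have hpoly : ∀ (c : ℕ → ℝ) (m : ℕ) (x : ℝ),
          HasDerivAt (fun t : ℝ => ∑ k ∈ Finset.range (m + 1), c k * t ^ k / k.factorial)
          (∑ k ∈ Finset.range m, c (k + 1) * x ^ k / k.factorial) x := by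
        intro c m x
        have h1 : HasDerivAt (fun t : ℝ => ∑ k ∈ Finset.range (m + 1), c k * t ^ k / k.factorial)
            (∑ k ∈ Finset.range (m + 1), c k * (k * x ^ (k - 1)) / k.factorial) x := by
          refine HasDerivAt.fun_sum fun k _ => ?_
          exact ((hasDerivAt_pow k x).const_mul (c k)).div_const _
        refine h1.congr_deriv ?_
        rw [Finset.sum_range_succ']
        simp only [Nat.factorial_succ, Nat.cast_mul, Nat.add_sub_cancel, Nat.cast_zero, zero_mul,
          mul_zero, zero_div, add_zero]
        refine Finset.sum_congr rfl fun k _ => ?_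
        have h2 : ((k + 1 : ℕ) : ℝ) ≠ 0 := by positivity
        have h3 : (k.factorial : ℝ) ≠ 0 := by positivity
        field_simp
      have hd := fun x => (hf 0 x).sub (hpoly (fun k => f k 0) d x)
      have key := image_norm_le_of_norm_deriv_right_le_deriv_boundary (a := 0) (b := T)
        (f := fun t => f 0 t - ∑ k ∈ Finset.range (d + 1), f k 0 * t ^ k / k.factorial)
        (f' := fun t => f 1 t - ∑ k ∈ Finset.range d, f (k + 1) 0 * t ^ k / k.factorial)
        (B := fun t => B * t ^ (d + 1) / (d + 1).factorial)
        (B' := fun t => B * t ^ d / d.factorial)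
        (fun x _ => (hd x).continuousAt.continuousWithinAt)
        (fun x _ => (hd x).hasDerivWithinAt)
        (by rw [Finset.sum_range_succ']; simp)
        (fun x => by
          have h1 := (((hasDerivAt_pow (d + 1) x).const_mul B).div_const
            ((d + 1).factorial : ℝ))
          refine h1.congr_deriv ?_
          have h2 : ((d + 1 : ℕ) : ℝ) ≠ 0 := by positivity
          have h3 : (d.factorial : ℝ) ≠ 0 := by positivity
          rw [Nat.factorial_succ, Nat.cast_mul]
          field_simp
          simp)
        (fun x hx => ih (fun k => f (k + 1)) (fun k t => hf (k + 1) t) hB x hx.1 hx.2.le)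
      exact key ⟨h0, hT⟩
  exact main (d + 1) f hf hB

theorem taylor_bound {T B : ℝ} (d : ℕ) (f : ℕ → ℝ → ℝ)
    (hf : ∀ k t, HasDerivAt (f k) (f (k + 1) t) t)
    (hB : ∀ t, |t| ≤ T → |f (d + 1) t| ≤ B) (t : ℝ) (ht : |t| ≤ T) :
    |f 0 t - ∑ k ∈ Finset.range (d + 1), f k 0 * t ^ k / k.factorial|
        ≤ B * |t| ^ (d + 1) / (d + 1).factorial := by
  rcases le_total 0 t with h | h
  · have := taylor_bound_right (T := T) (B := B) d f hf
      (fun s h0 hs => hB s (by rwa [abs_of_nonneg h0])) t h ((le_abs_self t).trans ht)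
    rwa [abs_of_nonneg h]
  · have := taylor_bound_right (T := T) (B := B) d (fun k s => (-1) ^ k * f k (-s))
      (fun k s => by
        have h1 := ((hf k (-s)).comp s (hasDerivAt_neg s)).const_mul ((-1 : ℝ) ^ k)
        refine h1.congr_deriv ?_
        ring)
      (fun s h0 hs => by
        rw [abs_mul, abs_pow, abs_neg, abs_one, one_pow, one_mul]
        exact hB _ (by rwa [abs_neg, abs_of_nonneg h0])) (-t) (by linarith)
      ((neg_le_abs t).trans ht)
    rw [abs_of_nonpos h]
    convert this using 3
    · simp
    · refine Finset.sum_congr rfl fun k _ => ?_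
      rw [neg_zero]
      congr 1
      rw [neg_eq_neg_one_mul t, mul_pow]
      have : ((-1 : ℝ) ^ k) * (-1) ^ k = 1 := by rw [← mul_pow]; simp
      linear_combination (- f k 0 * t ^ k) * this

variable {n : ℕ} {A : Matrix (Fin n) (Fin n) ℝ} {u : EuclideanSpace ℝ (Fin n) → ℝ}

theorem contDiff_iterate_dd (hu : ContDiff ℝ (⊤ : ℕ∞) u) (v : EuclideanSpace ℝ (Fin n)) (k : ℕ) :
    ContDiff ℝ (⊤ : ℕ∞) ((dd v)^[k] u) := by
  induction k generalizing u with
  | zero => exact hu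
  | succ k ih => exact ih (contDiff_dd hu v)

theorem Sol.iterate (h : Sol A u) (v : EuclideanSpace ℝ (Fin n)) (k : ℕ) :
    Sol A ((dd v)^[k] u) := by
  induction k generalizing u with
  | zero => exact h
  | succ k ih => exact ih (h.dirDeriv v)

theorem hasDerivAt_line (hu : ContDiff ℝ (⊤ : ℕ∞) u) (v : EuclideanSpace ℝ (Fin n)) (t : ℝ) :
    HasDerivAt (fun t : ℝ => u (t • v)) (dd v u (t • v)) t := by
  have h1 : HasDerivAt (fun r : ℝ => r • v) v t := by
    simpa using (hasDerivAt_id t).smul_const v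
  exact ((hu.differentiable (by simp)) _).hasFDerivAt.comp_hasDerivAt t h1

theorem abs_dd_le {C : ℝ} (hu : ContDiff ℝ (⊤ : ℕ∞) u)
    {x : EuclideanSpace ℝ (Fin n)} {s M : ℝ} (hs : 0 < s)
    (h : ∀ y ∈ closedBall x s, |u y - u x| ≤ C * (‖y - x‖ / s) * M)
    (v : EuclideanSpace ℝ (Fin n)) : |dd v u x| ≤ C * (‖v‖ / s) * M := by
  have h1 : HasDerivAt (fun t : ℝ => u (x + t • v)) (dd v u x) 0 := by
    have h2 : HasDerivAt (fun r : ℝ => x + r • v) v 0 := by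
      simpa using ((hasDerivAt_id (0 : ℝ)).smul_const v).const_add x
    have h3 := ((hu.differentiable (by simp)) (x + (0 : ℝ) • v)).hasFDerivAt.comp_hasDerivAt 0 h2
    rw [zero_smul, add_zero] at h3
    exact h3
  have h2 := h1.hasDerivWithinAt (s := Set.Ioi 0)
  rw [hasDerivWithinAt_iff_tendsto_slope' (by simp)] at h2
  refine le_of_tendsto h2.abs ?_
  have hev : ∀ᶠ t : ℝ in nhdsWithin 0 (Set.Ioi 0), t * ‖v‖ < s := by
    have : Filter.Tendsto (fun t : ℝ => t * ‖v‖) (nhdsWithin 0 (Set.Ioi 0)) (nhds (0 * ‖v‖)) :=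
      (Filter.tendsto_id.mono_left nhdsWithin_le_nhds).mul_const _
    rw [zero_mul] at this
    exact this.eventually (gt_mem_nhds hs)
  filter_upwards [hev, self_mem_nhdsWithin] with t ht ht0
  have ht0' : (0 : ℝ) < t := ht0
  have hn : ‖x + t • v - x‖ = t * ‖v‖ := by
    rw [add_sub_cancel_left, norm_smul, Real.norm_of_nonneg ht0'.le]
  have h3 := h (x + t • v) (by rw [mem_closedBall, dist_eq_norm, hn]; exact ht.le)
  rw [slope_def_field, abs_div, sub_zero, abs_of_pos ht0', div_le_iff₀ ht0', zero_smul, add_zero]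
  rw [hn] at h3
  refine h3.trans (le_of_eq ?_)
  ring

/-- Bounds for iterated directional derivatives of solutions. -/
theorem exists_iterate_bound (hn : 2 ≤ n) (hA : A.PosDef) :
    ∃ C : ℝ, 1 ≤ C ∧ ∀ u, Sol A u → ∀ x s, 0 < s → ∀ M, (∀ y ∈ closedBall x s, |u y| ≤ M) →
      ∀ v k, |(dd v)^[k] u x| ≤ M * k.factorial * (C * ‖v‖ / s) ^ k := by
  obtain ⟨C, hC, h⟩ := exists_gradient_estimates hn hA
  have he : 1 ≤ Real.exp 1 := Real.one_le_exp zero_le_one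
  refine ⟨C * Real.exp 1, by nlinarith, fun u hu x s hs M hM v k => ?_⟩
  have hM0 : 0 ≤ M := (abs_nonneg _).trans (hM x (mem_closedBall_self hs.le))
  rcases Nat.eq_zero_or_pos k with rfl | hk
  · simpa using hM x (mem_closedBall_self hs.le)
  have hk' : (0 : ℝ) < k := by exact_mod_cast hk
  have step : ∀ j : ℕ, j ≤ k → ∀ y ∈ closedBall x (s * (1 - j / k)),
      |(dd v)^[j] u y| ≤ (C * (‖v‖ / (s / k))) ^ j * M := by
    intro j
    induction j with
    | zero => intro _ y hy; simpa using hM y (by simpa using hy)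
    | succ j ih =>
      intro hj y hy
      rw [Function.iterate_succ_apply']
      have hsk : 0 < s / k := by positivity
      have hb : ∀ z ∈ closedBall y (s / k), |(dd v)^[j] u z| ≤ (C * (‖v‖ / (s / k))) ^ j * M := by
        intro z hz
        refine ih (by omega) z ?_
        rw [mem_closedBall] at *
        have h1 := dist_triangle z y x
        have h2 : s * (1 - ((j + 1 : ℕ) : ℝ) / k) = s * (1 - j / k) - s / k := by
          push_cast
          field_simp
          ring
        linarith
      have h1 := abs_dd_le (hu.iterate v j).smooth hsk
        ((h _ (hu.iterate v j) y (s / k) hsk).1 _ hb) v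
      refine h1.trans (le_of_eq ?_)
      ring
  have h1 := step k le_rfl x (by simp [hk'.ne'])
  refine h1.trans ?_
  have h2 : (k : ℝ) ^ k ≤ k.factorial * Real.exp 1 ^ k := by
    have := Real.pow_div_factorial_le_exp (k : ℝ) hk'.le k
    rw [div_le_iff₀ (by positivity)] at this
    rw [← Real.exp_nat_mul, mul_one, mul_comm]
    exact this
  calc (C * (‖v‖ / (s / k))) ^ k * M = M * (C * ‖v‖ / s) ^ k * (k : ℝ) ^ k := by
        rw [show C * (‖v‖ / (s / k)) = (C * ‖v‖ / s) * k by field_simp, mul_pow]; ring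
    _ ≤ M * (C * ‖v‖ / s) ^ k * (k.factorial * Real.exp 1 ^ k) := by gcongr
    _ = _ := by
        rw [show C * Real.exp 1 * ‖v‖ / s = (C * ‖v‖ / s) * Real.exp 1 by ring, mul_pow]; ring

/-- The homogeneous Taylor polynomials at the origin, multiplied by `k!`. -/
def taylorHom : ℕ → (EuclideanSpace ℝ (Fin n) → ℝ) → MvPolynomial (Fin n) ℝ
  | 0, u => MvPolynomial.C (u 0)
  | k + 1, u => ∑ i, MvPolynomial.X i * taylorHom k (pd i u)

theorem totalDegree_taylorHom_le (k : ℕ) (u : EuclideanSpace ℝ (Fin n) → ℝ) :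
    (taylorHom k u).totalDegree ≤ k := by
  induction k generalizing u with
  | zero => simp [taylorHom]
  | succ k ih =>
    rw [taylorHom]
    refine MvPolynomial.totalDegree_finsetSum_le fun i _ => ?_
    refine (MvPolynomial.totalDegree_mul _ _).trans ?_
    have := ih (pd i u)
    rw [MvPolynomial.totalDegree_X]
    omega

theorem iterate_dd_sum {ι : Type*} (s : Finset ι) (c : ι → ℝ)
    (f : ι → EuclideanSpace ℝ (Fin n) → ℝ)
    (hf : ∀ i, ContDiff ℝ (⊤ : ℕ∞) (f i)) (v : EuclideanSpace ℝ (Fin n)) (k : ℕ) :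
    (dd v)^[k] (fun x => ∑ i ∈ s, c i * f i x) = fun x => ∑ i ∈ s, c i * (dd v)^[k] (f i) x := by
  induction k generalizing f with
  | zero => rfl
  | succ k ih =>
    simp only [Function.iterate_succ_apply]
    rw [dd_finset_sum s (fun i x => c i * f i x) (fun i _ => contDiff_const.mul (hf i))]
    simp only [dd_const_mul _ (hf _)]
    exact ih (fun i => dd v (f i)) (fun i => contDiff_dd (hf i) v)

theorem eval_taylorHom (hu : ContDiff ℝ (⊤ : ℕ∞) u) (v : EuclideanSpace ℝ (Fin n)) (k : ℕ) :
    MvPolynomial.eval (fun i => v i) (taylorHom k u) = (dd v)^[k] u 0 := by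
  induction k generalizing u with
  | zero => simp [taylorHom]
  | succ k ih =>
    have h1 : dd v u = fun x => ∑ i, v i * pd i u x := funext fun x => dd_eq_sum v x
    rw [Function.iterate_succ_apply, h1,
      iterate_dd_sum _ _ (fun i => pd i u) (fun i => contDiff_dd hu _), taylorHom]
    simp only [map_sum, map_mul, MvPolynomial.eval_X]
    exact Finset.sum_congr rfl fun i _ => by rw [ih (u := pd i u) (contDiff_dd hu _)]

theorem iterate_dd_smul (hu : ContDiff ℝ (⊤ : ℕ∞) u) (v : EuclideanSpace ℝ (Fin n)) (t : ℝ)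
    (k : ℕ) : (dd (t • v))^[k] u = fun x => t ^ k * (dd v)^[k] u x := by
  induction k generalizing u with
  | zero => simp
  | succ k ih =>
    have h1 : dd (t • v) u = fun x => t * dd v u x := by
      ext x
      simp [dd]
    have h2 := iterate_dd_sum (n := n) {()} (fun _ => t) (fun _ => dd v u)
      (fun _ => contDiff_dd hu v) v k
    simp only [Finset.sum_singleton] at h2
    rw [Function.iterate_succ_apply, h1, ih (contDiff_const.mul (contDiff_dd hu v)), h2]
    ext x
    rw [Function.iterate_succ_apply]
    ring

/-- Taylor polynomial of degree `d` at the origin. -/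
def taylorMv (d : ℕ) (u : EuclideanSpace ℝ (Fin n) → ℝ) : MvPolynomial (Fin n) ℝ :=
  ∑ k ∈ Finset.range (d + 1), MvPolynomial.C ((k.factorial : ℝ)⁻¹) * taylorHom k u

/-- Taylor polynomial of degree `d` at the origin along the line directed by `v`. -/
def taylorLine (d : ℕ) (u : EuclideanSpace ℝ (Fin n) → ℝ) (v : EuclideanSpace ℝ (Fin n)) :
    Polynomial ℝ :=
  ∑ k ∈ Finset.range (d + 1),
    Polynomial.C ((dd v)^[k] u 0 / k.factorial) * Polynomial.X ^ k

theorem totalDegree_taylorMv_le (d : ℕ) (u : EuclideanSpace ℝ (Fin n) → ℝ) :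
    (taylorMv d u).totalDegree ≤ d := by
  refine MvPolynomial.totalDegree_finsetSum_le fun k hk => ?_
  refine (MvPolynomial.totalDegree_mul _ _).trans ?_
  have := totalDegree_taylorHom_le k u
  rw [Finset.mem_range] at hk
  rw [MvPolynomial.totalDegree_C]
  omega

theorem natDegree_taylorLine_le (d : ℕ) (u : EuclideanSpace ℝ (Fin n) → ℝ)
    (v : EuclideanSpace ℝ (Fin n)) : (taylorLine d u v).natDegree ≤ d := by
  refine Polynomial.natDegree_sum_le_of_forall_le _ _ fun k hk => ?_
  rw [Finset.mem_range] at hk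
  exact (Polynomial.natDegree_C_mul_X_pow_le _ _).trans (by omega)

theorem eval_taylorMv_smul (hu : ContDiff ℝ (⊤ : ℕ∞) u) (d : ℕ) (v : EuclideanSpace ℝ (Fin n))
    (t : ℝ) : MvPolynomial.eval (fun i => (t • v) i) (taylorMv d u)
      = (taylorLine d u v).eval t := by
  simp only [taylorMv, taylorLine, map_sum, map_mul, MvPolynomial.eval_C, eval_taylorHom hu,
    Polynomial.eval_finsetSum, Polynomial.eval_mul, Polynomial.eval_C, Polynomial.eval_pow,
    Polynomial.eval_X]
  refine Finset.sum_congr rfl fun k _ => ?_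
  rw [iterate_dd_smul hu]
  ring

theorem eval_taylorLine (d : ℕ) (v : EuclideanSpace ℝ (Fin n)) (t : ℝ) :
    (taylorLine d u v).eval t
      = ∑ k ∈ Finset.range (d + 1), (dd v)^[k] u 0 * t ^ k / k.factorial := by
  simp only [taylorLine, Polynomial.eval_finsetSum, Polynomial.eval_mul, Polynomial.eval_C,
    Polynomial.eval_pow, Polynomial.eval_X]
  exact Finset.sum_congr rfl fun k _ => by ring

theorem derivative_taylorLine (d : ℕ) (v : EuclideanSpace ℝ (Fin n)) :
    Polynomial.derivative (taylorLine (d + 1) u v) = taylorLine d (dd v u) v := by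
  simp only [taylorLine, Polynomial.derivative_sum]
  rw [Finset.sum_range_succ']
  simp only [pow_zero, mul_one, Polynomial.derivative_C, add_zero]
  refine Finset.sum_congr rfl fun k _ => ?_
  rw [Polynomial.derivative_C_mul_X_pow, Function.iterate_succ_apply, Nat.add_sub_cancel]
  congr 2
  rw [Nat.factorial_succ]
  push_cast
  field_simp

end

section

variable {n : ℕ} {A : Matrix (Fin n) (Fin n) ℝ} {u : EuclideanSpace ℝ (Fin n) → ℝ}

theorem exists_taylor_estimates (hn : 2 ≤ n) (hA : A.PosDef) :
    ∃ Q : ℝ, 12 ≤ Q ∧ ∀ u, Sol A u → ∀ M, (∀ y ∈ closedBall 0 Q, |u y| ≤ M) →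
      ∀ (d : ℕ) (v : EuclideanSpace ℝ (Fin n)), ‖v‖ ≤ 3 →
      (∀ t : ℝ, |t| ≤ 2 →
        |u (t • v) - (taylorLine (d + 1) u v).eval t| ≤ M * (Real.exp (-1)) ^ (d + 1)) ∧
      (∀ t : ℝ, |t| ≤ 2 → |dd v u (t • v) -
        (Polynomial.derivative (taylorLine (d + 1) u v)).eval t|
          ≤ M * (Real.exp (-1)) ^ (d + 1)) ∧
      (∀ z : ℂ, ‖z‖ ≤ 12 → ‖Polynomial.aeval z (taylorLine (d + 1) u v)‖ ≤ 2 * M) := by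
  obtain ⟨C, hC, h⟩ := exists_iterate_bound hn hA
  refine ⟨144 * C, by linarith, fun u hu M hM d v hv => ?_⟩
  have hM0 : 0 ≤ M := (abs_nonneg _).trans (hM 0 (mem_closedBall_self (by positivity)))
  have hexp : (1 : ℝ) / 6 ≤ Real.exp (-1) := by
    rw [Real.exp_neg, ← one_div]
    exact one_div_le_one_div_of_le (Real.exp_pos 1) (by linarith [Real.exp_one_lt_d9])
  have hb : ∀ t : ℝ, |t| ≤ 2 → ∀ k, |(dd v)^[k] u (t • v)| ≤ M * k.factorial * (1 / 24) ^ k := by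
    intro t ht k
    refine (h u hu (t • v) (72 * C) (by positivity) M (fun y hy => hM y ?_) v k).trans ?_
    · rw [mem_closedBall, dist_eq_norm] at *
      have h1 : ‖t • v‖ ≤ 6 := by
        rw [norm_smul, Real.norm_eq_abs]
        nlinarith [norm_nonneg v, abs_nonneg t]
      have h2 := norm_add_le (y - t • v) (t • v)
      rw [sub_add_cancel] at h2
      rw [sub_zero]
      linarith
    · have : C * ‖v‖ / (72 * C) ≤ 1 / 24 := by
        rw [div_le_div_iff₀ (by positivity) (by positivity)]
        nlinarith
      gcongr
  have hder : ∀ k t, HasDerivAt (fun t : ℝ => (dd v)^[k] u (t • v))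
      ((dd v)^[k + 1] u (t • v)) t := by
    intro k t
    have := hasDerivAt_line (contDiff_iterate_dd hu.smooth v k) v t
    rwa [← Function.iterate_succ_apply' (f := dd v)] at this
  refine ⟨fun t ht => ?_, fun t ht => ?_, fun z hz => ?_⟩
  · have := taylor_bound (T := 2) (d + 1) (fun k t => (dd v)^[k] u (t • v)) hder
      (fun s hs => hb s hs _) t ht
    rw [eval_taylorLine]
    simp only [zero_smul, Function.iterate_zero, id] at this
    refine this.trans ?_
    have h1 : M * ((d + 1 + 1).factorial : ℝ) * (1 / 24) ^ (d + 1 + 1) * |t| ^ (d + 1 + 1)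
        / ((d + 1 + 1).factorial : ℝ) = M * ((1 / 24) * |t|) ^ (d + 1 + 1) := by
      have : ((d + 1 + 1).factorial : ℝ) ≠ 0 := by positivity
      rw [mul_pow]
      field_simp
    rw [h1]
    gcongr
    have h2 : (1 / 24) * |t| ≤ 1 / 6 := by linarith
    have h3 := abs_nonneg t
    calc ((1 / 24) * |t|) ^ (d + 1 + 1) ≤ ((1 / 24) * |t|) ^ (d + 1) :=
          pow_le_pow_of_le_one (by positivity) (by linarith) (by omega)
      _ ≤ _ := pow_le_pow_left₀ (by positivity) (h2.trans hexp) _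
  · have := taylor_bound (T := 2) d (fun k t => (dd v)^[k + 1] u (t • v)) (fun k => hder (k + 1))
      (fun s hs => hb s hs _) t ht
    rw [derivative_taylorLine, eval_taylorLine]
    simp only [zero_smul, Function.iterate_succ_apply, Function.iterate_zero, id] at this
    refine this.trans ?_
    have h1 : M * ((d + 1 + 1).factorial : ℝ) * (1 / 24) ^ (d + 1 + 1) * |t| ^ (d + 1)
        / ((d + 1).factorial : ℝ) = M * (((d + 2 : ℕ) : ℝ) / 24 * ((1 / 24) * |t|) ^ (d + 1)) := by
      have : ((d + 1).factorial : ℝ) ≠ 0 := by positivity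
      rw [mul_pow, Nat.factorial_succ, Nat.cast_mul, pow_succ (1 / 24 : ℝ) (d + 1)]
      field_simp
    rw [h1]
    gcongr
    have h2 : (1 / 24) * |t| ≤ 1 / 12 := by linarith
    have h4 : ((d + 2 : ℕ) : ℝ) ≤ 2 ^ (d + 1) := by
      exact_mod_cast (Nat.lt_two_pow_self : d + 1 < 2 ^ (d + 1))
    calc ((d + 2 : ℕ) : ℝ) / 24 * ((1 / 24) * |t|) ^ (d + 1)
        ≤ 2 ^ (d + 1) * (1 / 12) ^ (d + 1) := by
          refine mul_le_mul (by linarith [show (0:ℝ) < 2 ^ (d+1) by positivity])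
            (pow_le_pow_left₀ (by positivity) h2 _) (by positivity) (by positivity)
      _ = (1 / 6) ^ (d + 1) := by rw [← mul_pow]; norm_num
      _ ≤ _ := pow_le_pow_left₀ (by positivity) hexp _
  · simp only [taylorLine, map_sum, map_mul, Polynomial.aeval_C, map_pow, Polynomial.aeval_X]
    refine (norm_sum_le _ _).trans ?_
    have h1 : ∀ k ∈ Finset.range (d + 1 + 1),
        ‖(algebraMap ℝ ℂ) ((dd v)^[k] u 0 / k.factorial) * z ^ k‖ ≤ M * (1 / 2) ^ k := by
      intro k _
      have h2 := hb 0 (by simp) k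
      rw [zero_smul] at h2
      rw [norm_mul, norm_pow, norm_algebraMap', Real.norm_eq_abs, abs_div,
        Nat.abs_cast]
      have hk : (0 : ℝ) < k.factorial := by positivity
      have h3 : |(dd v)^[k] u 0| / k.factorial ≤ M * (1 / 24) ^ k := by
        rw [div_le_iff₀ hk]
        linarith
      calc _ ≤ M * (1 / 24) ^ k * 12 ^ k := by gcongr
        _ = M * (1 / 2) ^ k := by rw [mul_assoc, ← mul_pow]; norm_num
    refine (Finset.sum_le_sum h1).trans ?_
    rw [← Finset.mul_sum, mul_comm]
    gcongr
    have := sum_geometric_two_le (d + 1 + 1)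
    simpa using this

end

section

variable {n : ℕ} {A : Matrix (Fin n) (Fin n) ℝ} {u : EuclideanSpace ℝ (Fin n) → ℝ}

/-- A continuous function that is positive on one ball and negative on another one has a large
zero set between them. -/
theorem hausdorffMeasure_zeros_ge (hn : 2 ≤ n) {f : EuclideanSpace ℝ (Fin n) → ℝ}
    (hf : Continuous f) {a b x : EuclideanSpace ℝ (Fin n)} {r R : ℝ} (hr : 0 < r)
    (ha : ∀ y ∈ ball a r, 0 < f y) (hb : ∀ y ∈ ball b r, f y < 0)
    (haR : ball a r ⊆ closedBall x R) (hbR : ball b r ⊆ closedBall x R) :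
    ENNReal.ofReal ((r / n) ^ (n - 1)) ≤ μH[(n : ℝ) - 1] ({y | f y = 0} ∩ closedBall x R) := by
  set v := b - a with hv
  have hv0 : v ≠ 0 := by
    intro h
    have : b = a := sub_eq_zero.1 h
    have h1 := ha a (mem_ball_self hr)
    have h2 := hb b (mem_ball_self hr)
    rw [this] at h2; linarith
  obtain ⟨e, he, hev⟩ : ∃ e : Fin (n - 1) → EuclideanSpace ℝ (Fin n), Orthonormal ℝ e ∧
      ∀ i, inner ℝ (e i) v = 0 := by
    have : Fact (Module.finrank ℝ (EuclideanSpace ℝ (Fin n)) = (n - 1) + 1) :=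
      ⟨by simp; omega⟩
    have hfr := Submodule.finrank_orthogonal_span_singleton (𝕜 := ℝ) (n := n - 1) hv0
    let B := (stdOrthonormalBasis ℝ (Submodule.span ℝ {v})ᗮ).reindex (finCongr hfr)
    refine ⟨fun i => (B i : EuclideanSpace ℝ (Fin n)), ?_, ?_⟩
    · exact B.orthonormal.comp_linearIsometry (Submodule.subtypeₗᵢ _)
    · intro i
      have := (B i).2
      rw [Submodule.mem_orthogonal_singleton_iff_inner_left] at this
      exact this
  set T : EuclideanSpace ℝ (Fin n) → (Fin (n - 1) → ℝ) := fun p i => inner ℝ (e i) (p - a) with hT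
  have hTL : LipschitzWith 1 T := by
    refine LipschitzWith.of_dist_le_mul fun p q => ?_
    rw [NNReal.coe_one, one_mul, dist_pi_le_iff dist_nonneg]
    intro i
    rw [Real.dist_eq, hT]
    simp only
    rw [← inner_sub_right, sub_sub_sub_cancel_right, dist_eq_norm]
    refine (abs_real_inner_le_norm _ _).trans ?_
    rw [he.1 i, one_mul]
  set S := {y | f y = 0} ∩ closedBall x R with hS
  have hn0 : (0:ℝ) < n := by positivity
  have himg : Set.pi Set.univ (fun _ : Fin (n - 1) => Set.Ioo (0:ℝ) (r / n)) ⊆ T '' S := by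
    intro y hy
    have hy' : ∀ i, y i ∈ Set.Ioo (0:ℝ) (r / n) := fun i => hy i (Set.mem_univ i)
    set h := ∑ i, y i • e i with hh
    have hhn : ‖h‖ < r := by
      calc ‖h‖ ≤ ∑ i, ‖y i • e i‖ := norm_sum_le _ _
        _ ≤ ∑ _i : Fin (n - 1), r / n := by
          refine Finset.sum_le_sum fun i _ => ?_
          rw [norm_smul, he.1 i, mul_one, Real.norm_eq_abs, abs_of_pos (hy' i).1]
          exact (hy' i).2.le
        _ = ((n - 1 : ℕ) : ℝ) * (r / n) := by simp
        _ < n * (r / n) := by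
          apply mul_lt_mul_of_pos_right _ (by positivity)
          exact_mod_cast (by omega : n - 1 < n)
        _ = r := by field_simp
    have hah : a + h ∈ ball a r := by simpa using hhn
    have hbh : b + h ∈ ball b r := by simpa using hhn
    have hcont : ContinuousOn (fun t : ℝ => f (a + h + t • v)) (Set.Icc 0 1) :=
      (hf.comp (by fun_prop)).continuousOn
    have hiv := intermediate_value_Icc' zero_le_one hcont
    have h1 : a + h + (1:ℝ) • v = b + h := by rw [hv]; module
    have h0 : a + h + (0:ℝ) • v = a + h := by module
    have hz : (0:ℝ) ∈ Set.Icc (f (a + h + (1:ℝ) • v)) (f (a + h + (0:ℝ) • v)) := by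
      rw [h1, h0]; exact ⟨(hb _ hbh).le, (ha _ hah).le⟩
    obtain ⟨t, ht, htz⟩ := hiv hz
    refine ⟨a + h + t • v, ⟨htz, ?_⟩, ?_⟩
    · have hconv := (convex_closedBall x R) (haR hah) (hbR hbh) (sub_nonneg.2 ht.2) ht.1
        (by ring)
      have e1 : (1 - t) • (a + h) + t • (b + h) = a + h + t • v := by rw [hv]; module
      rwa [e1] at hconv
    · ext j
      have e1 : a + h + t • v - a = h + t • v := by abel
      simp only [hT]
      rw [e1, inner_add_right, inner_smul_right, hev j, mul_zero, add_zero, hh,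
        he.inner_right_fintype]
  have hd : (n : ℝ) - 1 = ((n - 1 : ℕ) : ℝ) := by
    rw [Nat.cast_sub (by omega)]; simp
  have h1 := hTL.hausdorffMeasure_image_le (d := (n:ℝ) - 1) (by rw [hd]; positivity) S
  simp only [ENNReal.coe_one, ENNReal.one_rpow, one_mul] at h1
  refine le_trans ?_ h1
  refine le_trans ?_ (measure_mono himg)
  have h2 : (μH[(n:ℝ) - 1] : Measure (Fin (n - 1) → ℝ)) = volume := by
    rw [hd, ← hausdorffMeasure_pi_real]; simp
  rw [h2, Real.volume_pi_Ioo]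
  simp [ENNReal.ofReal_pow (show 0 ≤ r / n by positivity)]

/-- Around a point of positivity there is a nearby ball, of radius controlled by the growth of
the solution, on which the solution remains positive. -/
theorem exists_pos_ball {C : ℝ} (hC : 1 ≤ C)
    (hH : ∀ u : EuclideanSpace ℝ (Fin n) → ℝ, Sol A u → ∀ x s, 0 < s →
      (∀ y ∈ closedBall x s, 0 ≤ u y) →
        ∀ y, ‖y - x‖ ≤ s / C → |u y - u x| ≤ C * (‖y - x‖ / s) * u x)
    (hu : Sol A u) {a : EuclideanSpace ℝ (Fin n)} {δ l : ℝ} (hδ : 0 < δ) (hl : 1 ≤ l)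
    (ha : 0 < u a) (hle : ∀ y ∈ closedBall a (δ / 2), u y ≤ Real.exp l * u a) :
    ∃ a' ∈ closedBall a (δ / 4), ∀ y ∈ ball a' (δ / (8 * C * l)), 0 < u y := by
  have hcu : Continuous u := hu.smooth.continuous
  obtain ⟨a', ha', hmax⟩ := (isCompact_closedBall a (δ / 2)).exists_isMaxOn
    ⟨a, mem_closedBall_self (by positivity)⟩
    (f := fun y => u y * Real.exp (-(4 * l / δ * ‖y - a‖))) (by fun_prop)
  have h1 : u a ≤ u a' * Real.exp (-(4 * l / δ * ‖a' - a‖)) := by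
    have := hmax (mem_closedBall_self (show 0 ≤ δ / 2 by positivity))
    simpa using this
  have hpos : 0 < u a' := by
    by_contra h
    push Not at h
    nlinarith [Real.exp_pos (-(4 * l / δ * ‖a' - a‖))]
  have h2 : Real.exp (4 * l / δ * ‖a' - a‖) ≤ Real.exp l := by
    have h3 := hle a' ha'
    rw [Real.exp_neg, ← div_eq_mul_inv, le_div_iff₀ (Real.exp_pos _)] at h1
    have h4 : u a * Real.exp (4 * l / δ * ‖a' - a‖) ≤ u a * Real.exp l := by linarith
    exact le_of_mul_le_mul_left h4 ha
  have h5 : ‖a' - a‖ ≤ δ / 4 := by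
    rw [Real.exp_le_exp] at h2
    have : 4 * l / δ * ‖a' - a‖ = l * (‖a' - a‖ / (δ / 4)) := by field_simp
    rw [this] at h2
    have h6 : ‖a' - a‖ / (δ / 4) ≤ 1 := by
      by_contra h; push Not at h; nlinarith
    rwa [div_le_one (by positivity)] at h6
  refine ⟨a', by rwa [mem_closedBall, dist_eq_norm], fun y hy => ?_⟩
  set s := δ / (4 * l) with hs
  have hs0 : 0 < s := by positivity
  have hs1 : s ≤ δ / 4 := by
    rw [hs]; gcongr; linarith
  have hW : Sol A (fun y => (-1) * u y + 3 * u a') := hu.mul_add (-1) (3 * u a')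
  have hWpos : ∀ y ∈ closedBall a' s, 0 ≤ (-1) * u y + 3 * u a' := by
    intro y hy
    rw [mem_closedBall, dist_eq_norm] at hy
    have h7 : ‖y - a‖ ≤ ‖a' - a‖ + s := by
      have : y - a = (a' - a) + (y - a') := by abel
      rw [this]; exact (norm_add_le _ _).trans (by linarith)
    have h8 : y ∈ closedBall a (δ / 2) := by
      rw [mem_closedBall, dist_eq_norm]; linarith
    have h9 : u y * Real.exp (-(4 * l / δ * ‖y - a‖)) ≤
      u a' * Real.exp (-(4 * l / δ * ‖a' - a‖)) := hmax h8
    have h10 : u y ≤ u a' * Real.exp (4 * l / δ * (‖y - a‖ - ‖a' - a‖)) := by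
      have e : Real.exp (4 * l / δ * (‖y - a‖ - ‖a' - a‖)) =
        Real.exp (-(4 * l / δ * ‖a' - a‖)) * Real.exp (4 * l / δ * ‖y - a‖) := by
        rw [← Real.exp_add]; congr 1; ring
      rw [e, ← mul_assoc]
      rw [Real.exp_neg, ← div_eq_mul_inv, div_le_iff₀ (Real.exp_pos _)] at h9
      exact h9
    have h11 : 4 * l / δ * (‖y - a‖ - ‖a' - a‖) ≤ 1 := by
      calc _ ≤ 4 * l / δ * s := by gcongr; linarith
        _ = 1 := by rw [hs]; field_simp
    have h12 : Real.exp (4 * l / δ * (‖y - a‖ - ‖a' - a‖)) ≤ 3 :=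
      (Real.exp_le_exp.2 h11).trans (by linarith [Real.exp_one_lt_d9])
    nlinarith
  rw [mem_ball, dist_eq_norm] at hy
  have hC0 : 0 < C := by linarith
  have hy2 : ‖y - a'‖ < s / (2 * C) := by
    have : s / (2 * C) = δ / (8 * C * l) := by rw [hs]; field_simp; norm_num
    rwa [this]
  have hy3 : ‖y - a'‖ ≤ s / C := hy2.le.trans (by gcongr; linarith)
  have hfin := hH _ hW a' s hs0 hWpos y hy3
  have e1 : C * (‖y - a'‖ / s) < 1 / 2 := by
    rw [lt_div_iff₀ (by positivity)] at hy2
    rw [← mul_div_assoc, div_lt_iff₀ hs0]; linarith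
  have e2 := (abs_le.1 hfin).2
  nlinarith

/-- A lower bound for the size of the nodal set near a zero, in terms of the local growth. -/
theorem exists_hausdorffMeasure_zeros_ge (hn : 2 ≤ n) (hA : A.PosDef) :
    ∃ c₁ c₂ : ℝ, 0 < c₁ ∧ 0 < c₂ ∧ c₁ ≤ 1 ∧ ∀ u : EuclideanSpace ℝ (Fin n) → ℝ, Sol A u →
      ∀ (x : EuclideanSpace ℝ (Fin n)) (δ l : ℝ), 0 < δ → 1 ≤ l → u x ≠ 0 →
        (∀ y ∈ closedBall x δ, |u y| ≤ Real.exp l * |u x|) →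
        (∃ z ∈ closedBall x (c₁ * δ), u z = 0) →
        ENNReal.ofReal ((c₂ * δ / l) ^ (n - 1)) ≤
          μH[(n : ℝ) - 1] ({y | u y = 0} ∩ closedBall x δ) := by
  obtain ⟨C, hC, hest⟩ := exists_gradient_estimates hn hA
  have hH := fun u hu x s hs => (hest u hu x s hs).2
  have hC0 : 0 < C := by linarith
  refine ⟨1 / (16 * C), 1 / (8 * C * n), by positivity, by positivity, ?_, ?_⟩
  · rw [div_le_one (by positivity)]; linarith
  have main : ∀ u : EuclideanSpace ℝ (Fin n) → ℝ, Sol A u →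
      ∀ (x : EuclideanSpace ℝ (Fin n)) (δ l : ℝ), 0 < δ → 1 ≤ l → 0 < u x →
        (∀ y ∈ closedBall x δ, |u y| ≤ Real.exp l * u x) →
        (∃ z ∈ closedBall x (1 / (16 * C) * δ), u z = 0) →
        ENNReal.ofReal ((1 / (8 * C * n) * δ / l) ^ (n - 1)) ≤
          μH[(n : ℝ) - 1] ({y | u y = 0} ∩ closedBall x δ) := by
    intro u hu x δ l hδ hl hx hgr ⟨z, hz, huz⟩
    obtain ⟨y, hy, huy⟩ : ∃ y ∈ closedBall x (δ / 4), u y ≤ -u x := by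
      by_contra hcon
      push Not at hcon
      have hW := hu.mul_add 1 (u x)
      have hz' : ‖z - x‖ ≤ 1 / (16 * C) * δ := by rwa [mem_closedBall, dist_eq_norm] at hz
      have := hH _ hW x (δ / 4) (by positivity) (fun y hy => by linarith [hcon y hy]) z
        (hz'.trans (by
          rw [div_div, one_div_mul_eq_div]; gcongr; linarith))
      simp only [huz] at this
      have e1 : C * (‖z - x‖ / (δ / 4)) ≤ 1 / 4 := by
        calc _ ≤ C * ((1 / (16 * C) * δ) / (δ / 4)) := by gcongr
          _ = 1 / 4 := by field_simp; norm_num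
      have e2 := (abs_le.1 this).1
      nlinarith
    have hl0 : 0 < l := by linarith
    set r := δ / (8 * C * l) with hr
    have hr0 : 0 < r := by positivity
    have hr1 : r ≤ δ / 8 := by
      rw [hr]; gcongr; nlinarith
    rw [mem_closedBall, dist_eq_norm] at hy
    obtain ⟨a, ha, hapos⟩ := exists_pos_ball hC hH hu hδ hl hx (fun y hy =>
      (le_abs_self _).trans (hgr y (closedBall_subset_closedBall (by linarith) hy)))
    obtain ⟨b, hb, hbpos⟩ := exists_pos_ball (a := y) hC hH (hu.mul_add (-1) 0) hδ hl
      (by linarith) (fun w hw => by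
        have h1 : w ∈ closedBall x δ := by
          rw [mem_closedBall, dist_eq_norm] at hw ⊢
          have : w - x = (w - y) + (y - x) := by abel
          rw [this]; exact (norm_add_le _ _).trans (by linarith)
        have h2 := (neg_le_abs _).trans (hgr w h1)
        have h3 : Real.exp l * u x ≤ Real.exp l * (-1 * u y + 0) := by
          gcongr; linarith
        linarith)
    rw [mem_closedBall] at ha hb
    have hyx : dist y x ≤ δ / 4 := by rwa [dist_eq_norm]
    have h := hausdorffMeasure_zeros_ge hn hu.smooth.continuous (x := x) (R := δ) hr0 hapos
      (fun w hw => by have := hbpos w hw; linarith)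
      (fun w hw => by
        rw [mem_ball] at hw; rw [mem_closedBall]
        linarith [dist_triangle w a x])
      (fun w hw => by
        rw [mem_ball] at hw; rw [mem_closedBall]
        linarith [dist_triangle w b x, dist_triangle b y x])
    refine le_trans (le_of_eq ?_) h
    congr 2
    rw [hr]; field_simp
  intro u hu x δ l hδ hl hx hgr hz
  rcases lt_or_gt_of_ne hx with h | h
  · have h' : 0 < -1 * u x + 0 := by linarith
    have := main _ (hu.mul_add (-1) 0) x δ l hδ hl h' (fun y hy => by
      have := hgr y hy
      rw [abs_of_neg h] at this
      have e : |-1 * u y + 0| = |u y| := by rw [add_zero, neg_one_mul, abs_neg]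
      rw [e]; linarith) (by
        obtain ⟨z, hz, hz0⟩ := hz
        exact ⟨z, hz, by simp [hz0]⟩)
    simpa using this
  · exact main u hu x δ l hδ hl h (by rwa [abs_of_pos h] at hgr) hz

end

section

variable {n : ℕ} {A : Matrix (Fin n) (Fin n) ℝ} {u : EuclideanSpace ℝ (Fin n) → ℝ}

/-- Without zeros nearby, the logarithmic derivative of a solution is controlled. -/
theorem exists_abs_dd_le_of_ne_zero (hn : 2 ≤ n) (hA : A.PosDef) :
    ∃ C : ℝ, 0 < C ∧ ∀ u : EuclideanSpace ℝ (Fin n) → ℝ, Sol A u →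
      ∀ (x : EuclideanSpace ℝ (Fin n)) (s : ℝ), 0 < s → (∀ z ∈ closedBall x s, u z ≠ 0) →
        ∀ v, |dd v u x| ≤ C * ‖v‖ / s * |u x| := by
  obtain ⟨C, hC, hest⟩ := exists_gradient_estimates hn hA
  have hC0 : 0 < C := by linarith
  have main : ∀ u : EuclideanSpace ℝ (Fin n) → ℝ, Sol A u →
      ∀ (x : EuclideanSpace ℝ (Fin n)) (s : ℝ), 0 < s → (∀ z ∈ closedBall x s, 0 ≤ u z) →
        ∀ v, |dd v u x| ≤ C * ‖v‖ / s * u x := by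
    intro u hu x s hs hpos v
    have h := (hest u hu x s hs).2 hpos
    have := abs_dd_le (C := 1) (M := u x) (s := s / C) hu.smooth (by positivity) (x := x)
      (fun y hy => by
        rw [mem_closedBall, dist_eq_norm] at hy
        refine (h y hy).trans (le_of_eq ?_)
        field_simp) v
    refine this.trans (le_of_eq ?_)
    field_simp
  refine ⟨C, hC0, fun u hu x s hs hne v => ?_⟩
  have hcont : Continuous u := hu.smooth.continuous
  have hx : x ∈ closedBall x s := mem_closedBall_self hs.le
  have hpre := (convex_closedBall x s).isPreconnected
  rcases lt_or_gt_of_ne (hne x hx) with h | h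
  · have hneg : ∀ z ∈ closedBall x s, u z ≤ 0 := by
      intro z hz
      by_contra hc
      push Not at hc
      obtain ⟨w, hw, hw0⟩ := hpre.intermediate_value hx hz hcont.continuousOn
        (show (0:ℝ) ∈ Set.Icc (u x) (u z) from ⟨h.le, hc.le⟩)
      exact hne w hw hw0
    have := main _ (hu.mul_add (-1) 0) x s hs (fun z hz => by linarith [hneg z hz]) v
    have e : dd v (fun y => -1 * u y + 0) x = -dd v u x := by
      have h2 : (fun y => -1 * u y + 0) = fun y => -(u y) := by ext y; ring
      rw [h2, dd, dd, fderiv_fun_neg]; rfl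
    rw [e, abs_neg] at this
    rw [abs_of_neg h]
    refine this.trans (le_of_eq ?_); ring
  · have hpos : ∀ z ∈ closedBall x s, 0 ≤ u z := by
      intro z hz
      by_contra hc
      push Not at hc
      obtain ⟨w, hw, hw0⟩ := hpre.intermediate_value hz hx hcont.continuousOn
        (show (0:ℝ) ∈ Set.Icc (u z) (u x) from ⟨hc.le, h.le⟩)
      exact hne w hw hw0
    rw [abs_of_pos h]
    exact main u hu x s hs hpos v

theorem exists_abs_dd_le_of_doubling (hn : 2 ≤ n) (hA : A.PosDef) :
    ∃ C c : ℝ, 0 < C ∧ 0 < c ∧ ∀ u : EuclideanSpace ℝ (Fin n) → ℝ, Sol A u →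
      ∀ (P : MvPolynomial (Fin n) ℝ) (ε δ l : ℝ) (x : EuclideanSpace ℝ (Fin n)),
        0 < ε → 0 < δ → δ ≤ 1 → 0 ≤ l → ‖x‖ ≤ 5 →
        (∀ z : EuclideanSpace ℝ (Fin n), ‖z‖ ≤ 6 →
          |u z - MvPolynomial.eval (fun i => z i) P| ≤ ε / 2) →
        (∀ y : Fin n → ℝ, (∀ i, |y i| ≤ δ) →
          |MvPolynomial.eval ((fun i => x i) + y) P| + ε ≤
            Real.exp l * (|MvPolynomial.eval (fun i => x i) P| + ε)) →
        ε ≤ |MvPolynomial.eval (fun i => x i) P| →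
        μH[(n : ℝ) - 1] ({y | u y = 0} ∩ closedBall x δ) <
          ENNReal.ofReal ((c * δ / (l + 2)) ^ (n - 1)) →
        ∀ v, |dd v u x| ≤ C * ‖v‖ / δ * |u x| := by
  obtain ⟨C, hC, hder⟩ := exists_abs_dd_le_of_ne_zero hn hA
  obtain ⟨c₁, c₂, hc₁, hc₂, hc₁1, hnod⟩ := exists_hausdorffMeasure_zeros_ge hn hA
  refine ⟨C / c₁, c₂, by positivity, hc₂, ?_⟩
  intro u hu P ε δ l x hε hδ hδ1 hl hx htail hdoub hlow hsmall v
  have hux : |MvPolynomial.eval (fun i => x i) P| / 2 ≤ |u x| := by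
    have h1 := htail x (by linarith)
    have h2 : |MvPolynomial.eval (fun i => x i) P| ≤
        |u x| + |u x - MvPolynomial.eval (fun i => x i) P| := by
      have := abs_sub_le (MvPolynomial.eval (fun i => x i) P) (u x) 0
      rw [sub_zero, sub_zero, abs_sub_comm (MvPolynomial.eval (fun i => x i) P)] at this
      linarith
    linarith
  have hu0 : u x ≠ 0 := by
    intro h; rw [h, abs_zero] at hux; linarith
  have hgrow : ∀ y ∈ closedBall x δ, |u y| ≤ Real.exp (l + 2) * |u x| := by
    intro y hy
    rw [mem_closedBall, dist_eq_norm] at hy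
    have h1 := hdoub (fun i => (y - x) i) (fun i => by
      have := PiLp.norm_apply_le (y - x) i
      rw [Real.norm_eq_abs] at this
      exact this.trans hy)
    have e : ((fun i => x i) + fun i => (y - x) i) = fun i => y i := by
      ext i; simp
    rw [e] at h1
    have h2 := htail y (by
      have : y = (y - x) + x := by abel
      rw [this]; exact (norm_add_le _ _).trans (by linarith))
    have h3 : |u y| ≤ |MvPolynomial.eval (fun i => y i) P| +
        |u y - MvPolynomial.eval (fun i => y i) P| := by
      have := abs_sub_le (u y) (MvPolynomial.eval (fun i => y i) P) 0
      rw [sub_zero, sub_zero] at this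
      linarith
    have h4 : (4:ℝ) ≤ Real.exp 2 := by
      have h5 : (2:ℝ) ≤ Real.exp 1 := by linarith [Real.add_one_le_exp (1:ℝ)]
      have : Real.exp 2 = Real.exp 1 * Real.exp 1 := by rw [← Real.exp_add]; norm_num
      rw [this]; nlinarith
    have h6 : Real.exp l * (|MvPolynomial.eval (fun i => x i) P| + ε) ≤
        Real.exp l * (4 * |u x|) := by
      gcongr; linarith
    rw [Real.exp_add]
    have h7 : Real.exp l * (4 * |u x|) ≤ Real.exp l * (Real.exp 2 * |u x|) := by gcongr
    linarith
  have hne : ∀ z ∈ closedBall x (c₁ * δ), u z ≠ 0 := by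
    intro z hz hz0
    exact absurd (hnod u hu x δ (l + 2) hδ (by linarith) hu0 hgrow ⟨z, hz, hz0⟩)
      (not_le.2 hsmall)
  refine (hder u hu x (c₁ * δ) (by positivity) hne v).trans (le_of_eq ?_)
  field_simp

end

section

lemma lintegral_abs_rpow_lt_top {α : ℝ} (hα : α < 1) :
    ∫⁻ t in Set.Icc (-1 : ℝ) 1, ENNReal.ofReal (|t| ^ (-α)) < ⊤ := by
  have h1 : IntervalIntegrable (fun t : ℝ => |t| ^ (-α)) volume 0 1 := by
    refine (intervalIntegral.intervalIntegrable_rpow' (r := -α) (by linarith)).congr ?_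
    intro t ht
    rw [Set.uIoc_of_le zero_le_one] at ht
    simp [abs_of_pos ht.1]
  have h2 : IntervalIntegrable (fun t : ℝ => |t| ^ (-α)) volume (-1) 0 := by
    have := (IntervalIntegrable.iff_comp_neg (f := fun t : ℝ => |t| ^ (-α))).1 h1
    simpa using this.symm
  have h3 := (h2.trans h1)
  rw [intervalIntegrable_iff_integrableOn_Icc_of_le (by norm_num)] at h3
  have := h3.2
  rw [hasFiniteIntegral_iff_ofReal] at this
  · exact this
  · exact Filter.Eventually.of_forall fun t => by positivity

lemma exists_lintegral_abs_sub_rpow_le {α : ℝ} (hα0 : 0 < α) (hα : α < 1) :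
    ∃ C : ℝ, 0 < C ∧ ∀ x : ℝ,
      ∫⁻ t in Set.Icc (-5 : ℝ) 5, ENNReal.ofReal (|t - x| ^ (-α)) ≤ ENNReal.ofReal C := by
  set I := ∫⁻ t in Set.Icc (-1 : ℝ) 1, ENNReal.ofReal (|t| ^ (-α)) with hI
  have hI' : I ≠ ⊤ := (lintegral_abs_rpow_lt_top hα).ne
  refine ⟨10 + I.toReal, by positivity, fun x => ?_⟩
  set g : ℝ → ENNReal := (Set.Icc (-1 : ℝ) 1).indicator fun t => ENNReal.ofReal (|t| ^ (-α))
    with hg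
  have hgm : Measurable g := by
    refine Measurable.indicator ?_ measurableSet_Icc
    fun_prop
  have hle : ∀ t, ENNReal.ofReal (|t - x| ^ (-α)) ≤ 1 + g (t - x) := by
    intro t
    by_cases h : t - x ∈ Set.Icc (-1 : ℝ) 1
    · rw [hg, Set.indicator_of_mem h]
      exact le_add_self
    · have h1 : 1 < |t - x| := by
        by_contra hc
        exact h (abs_le.1 (not_lt.1 hc))
      have : |t - x| ^ (-α) ≤ 1 := Real.rpow_le_one_of_one_le_of_nonpos h1.le (by linarith)
      calc ENNReal.ofReal (|t - x| ^ (-α)) ≤ ENNReal.ofReal 1 := ENNReal.ofReal_le_ofReal this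
        _ = 1 := by simp
        _ ≤ _ := le_self_add
  calc ∫⁻ t in Set.Icc (-5 : ℝ) 5, ENNReal.ofReal (|t - x| ^ (-α))
      ≤ ∫⁻ t in Set.Icc (-5 : ℝ) 5, (1 + g (t - x)) := lintegral_mono fun t => hle t
    _ = (∫⁻ _t in Set.Icc (-5 : ℝ) 5, 1) + ∫⁻ t in Set.Icc (-5 : ℝ) 5, g (t - x) := by
        rw [lintegral_add_left measurable_const]
    _ ≤ ENNReal.ofReal 10 + ∫⁻ t, g (t - x) := by
        gcongr
        · simp; norm_num
        · exact Measure.restrict_le_self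
    _ = ENNReal.ofReal 10 + I := by
        rw [lintegral_sub_right_eq_self g x, hg, lintegral_indicator measurableSet_Icc]
    _ = ENNReal.ofReal (10 + I.toReal) := by
        rw [ENNReal.ofReal_add (by norm_num) (by positivity), ENNReal.ofReal_toReal hI']

lemma exists_prod_one_sub_div (P : Polynomial ℂ) (hP : P.eval 0 = 1) :
    ∃ a : Fin P.natDegree → ℂ, (∀ i, a i ≠ 0) ∧ ∀ z, P.eval z = ∏ i, (1 - z / a i) := by
  have hP0 : P ≠ 0 := by rintro rfl; simp at hP
  have hsp : P.Splits := IsAlgClosed.splits P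
  have hcard : P.roots.card = P.natDegree := hsp.natDegree_eq_card_roots.symm
  set l := P.roots.toList with hl
  have hlen : l.length = P.natDegree := by rw [hl, Multiset.length_toList, hcard]
  have hne : ∀ i : Fin l.length, l.get i ≠ 0 := by
    intro i h
    have : l.get i ∈ P.roots := Multiset.mem_toList.1 (List.get_mem l i)
    rw [h, Polynomial.mem_roots hP0, Polynomial.IsRoot, hP] at this
    exact one_ne_zero this
  have hev : ∀ z, P.eval z = P.leadingCoeff * ∏ i : Fin l.length, (z - l.get i) := by
    intro z
    have h1 := hsp.eval_eq_prod_roots z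
    rw [h1]
    congr 1
    have : P.roots = (l : Multiset ℂ) := (Multiset.coe_toList _).symm
    rw [this, Multiset.map_coe, Multiset.prod_coe]
    rw [← List.prod_ofFn]
    congr 1
    conv_lhs => rw [← List.ofFn_get l, List.map_ofFn]
    rfl
  have hev0 := hev 0
  rw [hP] at hev0
  refine ⟨fun i => l.get (i.cast hlen.symm), fun i => hne _, fun z => ?_⟩
  have e : ∏ i : Fin P.natDegree, (1 - z / l.get (i.cast hlen.symm))
      = ∏ i : Fin l.length, (1 - z / l.get i) :=
    Fintype.prod_equiv (finCongr hlen.symm) _ _ fun i => rfl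
  rw [e, hev z]
  have h2 : ∏ i : Fin l.length, (z - l.get i)
      = (∏ i : Fin l.length, (0 - l.get i)) * ∏ i : Fin l.length, (1 - z / l.get i) := by
    rw [← Finset.prod_mul_distrib]
    refine Finset.prod_congr rfl fun i _ => ?_
    have := hne i
    field_simp
    ring
  rw [h2, ← mul_assoc, ← hev0, one_mul]

/-- A zero-free product normalised at the origin and bounded by `exp N` on a disc of radius `4`
is bounded below on the disc of half the radius. -/
lemma exp_le_norm_prod {ι : Type*} (S : Finset ι) (a : ι → ℂ) (ha : ∀ i ∈ S, 4 ≤ ‖a i‖) {N : ℝ}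
    (hN : 0 < N) (h : ∀ z : ℂ, ‖z‖ < 4 → ‖∏ i ∈ S, (1 - z / a i)‖ ≤ Real.exp N)
    {z : ℂ} (hz : ‖z‖ ≤ 2) : Real.exp (-(2 * N)) ≤ ‖∏ i ∈ S, (1 - z / a i)‖ := by
  have hslit : ∀ w : ℂ, ‖w‖ < 4 → ∀ i ∈ S, 1 - w / a i ∈ Complex.slitPlane := by
    intro w hw i hi
    have h1 : ‖w / a i‖ < 1 := by
      rw [norm_div, div_lt_one (by linarith [ha i hi])]
      exact hw.trans_le (ha i hi)
    left
    have := (Complex.abs_re_le_norm (w / a i))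
    have := (abs_le.1 this).2
    simp only [Complex.sub_re, Complex.one_re]
    linarith
  set f : ℂ → ℂ := fun w => ∑ i ∈ S, Complex.log (1 - w / a i) with hf
  have hexp : ∀ w : ℂ, ‖w‖ < 4 → Complex.exp (f w) = ∏ i ∈ S, (1 - w / a i) := by
    intro w hw
    rw [hf, Complex.exp_sum]
    exact Finset.prod_congr rfl fun i hi =>
      Complex.exp_log (Complex.slitPlane_ne_zero (hslit w hw i hi))
  have hre : ∀ w : ℂ, ‖w‖ < 4 → Real.exp (f w).re = ‖∏ i ∈ S, (1 - w / a i)‖ := by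
    intro w hw
    rw [← hexp w hw, Complex.norm_exp]
  have hz4 : ‖z‖ < 4 := by linarith
  have hdiff : DifferentiableOn ℂ f (ball 0 4) := by
    intro w hw
    rw [mem_ball_zero_iff] at hw
    apply DifferentiableAt.differentiableWithinAt
    refine DifferentiableAt.fun_sum fun i hi => ?_
    refine DifferentiableAt.clog ?_ (hslit w hw i hi)
    fun_prop
  have hBC := Complex.borelCaratheodory_zero (f := f) hN hdiff (by
    intro w hw
    rw [mem_ball_zero_iff] at hw
    have := h w hw
    rw [← hre w hw] at this
    exact Real.exp_le_exp.1 this) (by norm_num) (z := z) (by simpa using hz4) (by simp [hf])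
  have h2 : ‖f z‖ ≤ 2 * N := by
    refine hBC.trans ?_
    rw [div_le_iff₀ (by linarith)]
    nlinarith [norm_nonneg z]
  rw [← hre z hz4]
  apply Real.exp_le_exp.2
  have := (abs_le.1 (Complex.abs_re_le_norm (f z))).1
  linarith

lemma sum_ge_of_pow_le_prod {ι : Type*} (S : Finset ι) (y : ι → ℝ) (hy : ∀ i ∈ S, 0 ≤ y i)
    {K : ℝ} (hK : 0 < K) (h : K ^ S.card ≤ ∏ i ∈ S, y i) : S.card * K ≤ ∑ i ∈ S, y i := by
  have h1 : ∏ i ∈ S, (y i / K) ≤ Real.exp (∑ i ∈ S, (y i / K - 1)) := by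
    rw [Real.exp_sum]
    refine Finset.prod_le_prod (fun i hi => by have := hy i hi; positivity) fun i hi => ?_
    have := Real.add_one_le_exp (y i / K - 1)
    linarith
  have h2 : 1 ≤ ∏ i ∈ S, (y i / K) := by
    rw [Finset.prod_div_distrib, Finset.prod_const, one_le_div (by positivity)]
    exact h
  have h3 : 0 ≤ ∑ i ∈ S, (y i / K - 1) := by
    have := h2.trans h1
    exact Real.exp_le_exp.1 (by rwa [Real.exp_zero])
  rw [Finset.sum_sub_distrib, ← Finset.sum_div, Finset.sum_const, nsmul_eq_mul, mul_one,
    sub_nonneg, le_div_iff₀ hK] at h3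
  exact h3

end

section

lemma norm_prod_far_le {ι : Type*} [Fintype ι] (a : ι → ℂ) (S T : Finset ι)
    [DecidableEq ι]
    (hST : Disjoint S T) (hun : S ∪ T = Finset.univ) (hS : ∀ i ∈ S, ‖a i‖ ≤ 4)
    (h0 : ∀ i, a i ≠ 0) {M : ℝ} (h : ∀ z : ℂ, ‖z‖ = 12 → ‖∏ i, (1 - z / a i)‖ ≤ M)
    {z : ℂ} (hz : ‖z‖ ≤ 12) : ‖∏ i ∈ T, (1 - z / a i)‖ ≤ M / 2 ^ S.card := by
  have hd : DiffContOnCl ℂ (fun z : ℂ => ∏ i ∈ T, (1 - z / a i)) (ball 0 12) := by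
    apply Differentiable.diffContOnCl
    fun_prop
  refine Complex.norm_le_of_forall_mem_frontier_norm_le isBounded_ball hd (C := M / 2 ^ S.card)
    ?_ (z := z) ?_
  · intro w hw
    rw [frontier_ball _ (by norm_num), mem_sphere_zero_iff_norm] at hw
    have h1 := h w hw
    rw [← hun, Finset.prod_union hST, norm_mul] at h1
    have h2 : (2 : ℝ) ^ S.card ≤ ‖∏ i ∈ S, (1 - w / a i)‖ := by
      rw [norm_prod, ← Finset.prod_const]
      refine Finset.prod_le_prod (fun _ _ => by norm_num) fun i hi => ?_
      have h3 : 3 ≤ ‖w / a i‖ := by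
        rw [norm_div, hw, le_div_iff₀ (norm_pos_iff.2 (h0 i))]
        linarith [hS i hi]
      have := norm_sub_norm_le (w / a i) 1
      rw [norm_one, norm_sub_rev] at this
      linarith
    rw [le_div_iff₀ (by positivity), mul_comm]
    exact (mul_le_mul_of_nonneg_right h2 (norm_nonneg _)).trans h1
  · rw [closure_ball _ (by norm_num)]
    simpa using hz

/-- A Cartan-type estimate for the sublevel sets of a polynomial on an interval. -/
theorem exists_volume_sublevel_le : ∃ C : ℝ, 0 < C ∧ ∀ (q : Polynomial ℝ) (N : ℝ), 0 < N →
    q.eval 0 = 1 → (∀ z : ℂ, ‖z‖ ≤ 12 → ‖Polynomial.aeval z q‖ ≤ Real.exp N) →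
    ∀ s : ℝ, 2 < s → volume {t ∈ Set.Icc (-2 : ℝ) 2 | |q.eval t| < Real.exp (-(s * N))} ≤
      ENNReal.ofReal (C * 2 ^ (-((s - 2) / 2))) := by
  obtain ⟨C, hC, hCx⟩ := exists_lintegral_abs_sub_rpow_le (α := 1 / 2) (by norm_num) (by norm_num)
  refine ⟨2 * C, by positivity, fun q N hN hq0 hq s hs => ?_⟩
  classical
  obtain ⟨a, ha0, ha⟩ := exists_prod_one_sub_div (q.map (algebraMap ℝ ℂ)) (by
    rw [show (0 : ℂ) = algebraMap ℝ ℂ 0 by simp, Polynomial.eval_map_apply, hq0]; simp)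
  have ha' : ∀ z : ℂ, Polynomial.aeval z q = ∏ i, (1 - z / a i) := by
    intro z
    rw [← ha z, Polynomial.aeval_def, Polynomial.eval_map]
  set S := Finset.univ.filter fun i => ‖a i‖ < 4 with hS
  set T := Finset.univ.filter fun i => ¬ ‖a i‖ < 4 with hT
  have hST : Disjoint S T := Finset.disjoint_filter_filter_not _ _ _
  have hun : S ∪ T = Finset.univ := Finset.filter_union_filter_not_eq _ _
  have hSa : ∀ i ∈ S, ‖a i‖ < 4 := fun i hi => (Finset.mem_filter.1 hi).2
  have hTa : ∀ i ∈ T, 4 ≤ ‖a i‖ := fun i hi => not_lt.1 (Finset.mem_filter.1 hi).2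
  have hfar : ∀ z : ℂ, ‖z‖ ≤ 12 → ‖∏ i ∈ T, (1 - z / a i)‖ ≤ Real.exp N / 2 ^ S.card :=
    fun z hz => norm_prod_far_le a S T hST hun (fun i hi => (hSa i hi).le) ha0
      (fun z hz => by rw [← ha']; exact hq z hz.le) hz
  have hm : (2 : ℝ) ^ S.card ≤ Real.exp N := by
    have := hfar 0 (by norm_num)
    rw [le_div_iff₀ (by positivity)] at this
    simpa using this
  have hlow : ∀ z : ℂ, ‖z‖ ≤ 2 → Real.exp (-(2 * N)) ≤ ‖∏ i ∈ T, (1 - z / a i)‖ := by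
    intro z hz
    refine exp_le_norm_prod T a hTa hN (fun w hw => ?_) hz
    exact (hfar w (by linarith)).trans
      (div_le_self (Real.exp_pos _).le (one_le_pow₀ (by norm_num)))
  set F : ℝ → ENNReal := fun t => ∑ i ∈ S, ENNReal.ofReal (2 * |t - (a i).re| ^ (-(1 / 2) : ℝ))
    with hF
  have hFm : Measurable F := by fun_prop
  set R : Set ℝ := Set.range fun i => (a i).re with hR
  have hR0 : volume R = 0 := (Set.finite_range _).measure_zero _
  set K : ℝ := 2 ^ ((s - 2) / 2) with hK
  have hK0 : 0 < K := by positivity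
  -- off the null set the sublevel set lies in a superlevel set of `F`
  have hsub : ∀ t ∈ Set.Icc (-2 : ℝ) 2, |q.eval t| < Real.exp (-(s * N)) → t ∉ R →
      S.card ≠ 0 ∧ ENNReal.ofReal (S.card * K) ≤ F t := by
    intro t ht hqt htR
    have htR' : ∀ i, 0 < |t - (a i).re| := fun i =>
      abs_pos.2 fun h => htR ⟨i, (sub_eq_zero.1 h).symm⟩
    have hq1 : |q.eval t| = ‖∏ i, (1 - (t : ℂ) / a i)‖ := by
      rw [← ha', ← Real.norm_eq_abs, ← Complex.norm_real]
      congr 1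
      exact (Polynomial.aeval_algebraMap_apply_eq_algebraMap_eval (A := ℂ) t q).symm
    have htn : ‖(t : ℂ)‖ ≤ 2 := by
      rw [Complex.norm_real]; exact abs_le.2 ht
    rw [hq1, ← hun, Finset.prod_union hST, norm_mul] at hqt
    have h1 : ‖∏ i ∈ S, (1 - (t : ℂ) / a i)‖ < Real.exp (-((s - 2) * N)) := by
      have h2 := (mul_le_mul_of_nonneg_left (hlow t htn)
        (norm_nonneg (∏ i ∈ S, (1 - (t : ℂ) / a i)))).trans_lt hqt
      rw [← lt_div_iff₀ (Real.exp_pos _), ← Real.exp_sub] at h2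
      rwa [show -(s * N) - -(2 * N) = -((s - 2) * N) by ring] at h2
    have hi : ∀ i ∈ S, |t - (a i).re| / 4 ≤ ‖1 - (t : ℂ) / a i‖ := by
      intro i hiS
      have h2 : 1 - (t : ℂ) / a i = (a i - t) / a i := by
        have := ha0 i
        field_simp
      rw [h2, norm_div]
      have h3 : |t - (a i).re| ≤ ‖a i - t‖ := by
        have := Complex.abs_re_le_norm (a i - t)
        rwa [Complex.sub_re, Complex.ofReal_re, abs_sub_comm] at this
      gcongr
      · exact norm_pos_iff.2 (ha0 i)
      · exact (hSa i hiS).le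
    have h3 : ∏ i ∈ S, (|t - (a i).re| / 4) < Real.exp (-((s - 2) * N)) := by
      refine lt_of_le_of_lt ?_ h1
      rw [norm_prod]
      exact Finset.prod_le_prod (fun _ _ => by positivity) hi
    have h4 : K ^ S.card ≤ ∏ i ∈ S, (2 * |t - (a i).re| ^ (-(1 / 2) : ℝ)) := by
      have e1 : ∏ i ∈ S, (2 * |t - (a i).re| ^ (-(1 / 2) : ℝ))
          = (∏ i ∈ S, (|t - (a i).re| / 4)) ^ (-(1 / 2) : ℝ) := by
        rw [← Real.finsetProd_rpow _ _ fun i _ => by positivity]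
        refine Finset.prod_congr rfl fun i _ => ?_
        rw [Real.div_rpow (by positivity) (by norm_num)]
        have : (4 : ℝ) ^ (-(1 / 2) : ℝ) = 1 / 2 := by
          rw [show (4 : ℝ) = 2 ^ (2 : ℝ) by norm_num, ← Real.rpow_mul (by norm_num)]
          norm_num [Real.rpow_neg_one]
        rw [this]
        ring
      rw [e1]
      have e2 : Real.exp ((s - 2) * N / 2) ≤ (∏ i ∈ S, (|t - (a i).re| / 4)) ^ (-(1 / 2) : ℝ) := by
        have : Real.exp ((s - 2) * N / 2) = (Real.exp (-((s - 2) * N))) ^ (-(1 / 2) : ℝ) := by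
          rw [← Real.exp_mul]; congr 1; ring
        rw [this]
        refine Real.rpow_le_rpow_of_nonpos ?_ h3.le (by norm_num)
        exact Finset.prod_pos fun i _ => by have := htR' i; positivity
      refine le_trans ?_ e2
      have e3 : Real.exp ((s - 2) * N / 2) = (Real.exp N) ^ ((s - 2) / 2) := by
        rw [← Real.exp_mul]; congr 1; ring
      rw [e3, hK, ← Real.rpow_natCast, ← Real.rpow_mul (by norm_num), mul_comm,
        Real.rpow_mul (by norm_num), Real.rpow_natCast]
      exact Real.rpow_le_rpow (by positivity) hm (by linarith)
    constructor
    · intro h5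
      rw [Finset.card_eq_zero] at h5
      rw [h5, Finset.prod_empty] at h3
      have : Real.exp (-((s - 2) * N)) ≤ 1 := Real.exp_le_one_iff.2 (by nlinarith)
      linarith
    · have h5 := sum_ge_of_pow_le_prod S _ (fun i _ => by positivity) hK0 h4
      rw [hF]
      simp only
      rw [← ENNReal.ofReal_sum_of_nonneg fun i _ => by positivity]
      exact ENNReal.ofReal_le_ofReal h5
  by_cases hSc : S.card = 0
  · refine le_trans (measure_mono (t := R) ?_) (by rw [hR0]; exact zero_le)
    rintro t ⟨ht, hqt⟩
    by_contra htR
    exact (hsub t ht hqt htR).1 hSc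
  have hFint : ∫⁻ t in Set.Icc (-5 : ℝ) 5, F t ≤ ENNReal.ofReal (S.card * (2 * C)) := by
    rw [hF, lintegral_finsetSum _ fun i _ => by fun_prop]
    calc ∑ i ∈ S, ∫⁻ t in Set.Icc (-5 : ℝ) 5, ENNReal.ofReal (2 * |t - (a i).re| ^ (-(1 / 2) : ℝ))
        ≤ ∑ i ∈ S, ENNReal.ofReal (2 * C) := by
          refine Finset.sum_le_sum fun i _ => ?_
          simp_rw [ENNReal.ofReal_mul (show (0 : ℝ) ≤ 2 by norm_num)]
          rw [lintegral_const_mul _ (by fun_prop)]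
          exact mul_le_mul_right (hCx _) _
      _ = _ := by
          rw [Finset.sum_const, nsmul_eq_mul, ENNReal.ofReal_mul (p := (S.card : ℝ))
            (by positivity),
            ENNReal.ofReal_natCast]
  have hSpos : (0 : ℝ) < S.card := by exact_mod_cast Nat.pos_of_ne_zero hSc
  calc volume {t ∈ Set.Icc (-2 : ℝ) 2 | |q.eval t| < Real.exp (-(s * N))}
      ≤ volume (R ∪ {t ∈ Set.Icc (-5 : ℝ) 5 | ENNReal.ofReal (S.card * K) ≤ F t}) := by
        refine measure_mono ?_
        rintro t ⟨ht, hqt⟩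
        by_cases htR : t ∈ R
        · exact Or.inl htR
        · exact Or.inr ⟨⟨by linarith [ht.1], by linarith [ht.2]⟩, (hsub t ht hqt htR).2⟩
    _ ≤ volume R + volume {t ∈ Set.Icc (-5 : ℝ) 5 | ENNReal.ofReal (S.card * K) ≤ F t} :=
        measure_union_le _ _
    _ = (volume.restrict (Set.Icc (-5 : ℝ) 5)) {t | ENNReal.ofReal (S.card * K) ≤ F t} := by
        rw [hR0, zero_add, Measure.restrict_apply (measurableSet_le measurable_const hFm),
          Set.inter_comm]
        rfl
    _ ≤ (∫⁻ t in Set.Icc (-5 : ℝ) 5, F t) / ENNReal.ofReal (S.card * K) :=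
        meas_ge_le_lintegral_div hFm.aemeasurable (ENNReal.ofReal_pos.2 (by positivity)).ne'
          ENNReal.ofReal_ne_top
    _ ≤ ENNReal.ofReal (S.card * (2 * C)) / ENNReal.ofReal (S.card * K) := by gcongr
    _ = ENNReal.ofReal (2 * C * 2 ^ (-((s - 2) / 2))) := by
        rw [← ENNReal.ofReal_div_of_pos (by positivity), Real.rpow_neg (by norm_num), ← hK]
        congr 1
        field_simp

end

section

/-- The boundary values of the Möbius map from the disc to the upper half plane. -/
def cotLine (t₀ η θ : ℝ) : ℝ := t₀ - η * (Real.cos (θ / 2) / Real.sin (θ / 2))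

lemma arctan_cotLine {t₀ η θ : ℝ} (hη : 0 < η) (h0 : 0 < θ) (h1 : θ < 2 * Real.pi) :
    Real.pi - 2 * Real.arctan ((t₀ - cotLine t₀ η θ) / η) = θ := by
  have e : (t₀ - cotLine t₀ η θ) / η = Real.tan (Real.pi / 2 - θ / 2) := by
    rw [cotLine, Real.tan_eq_sin_div_cos, Real.sin_pi_div_two_sub, Real.cos_pi_div_two_sub]
    field_simp
    ring
  rw [e, Real.arctan_tan (by linarith) (by linarith)]
  ring

lemma lipschitzWith_arctan_div {t₀ η : ℝ} (hη : 0 < η) :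
    LipschitzWith (Real.toNNReal (2 / η))
      fun x : ℝ => Real.pi - 2 * Real.arctan ((t₀ - x) / η) := by
  refine lipschitzWith_of_nnnorm_deriv_le (𝕜 := ℝ) ?_ ?_
  · intro x
    have := ((((hasDerivAt_id x).const_sub t₀).div_const η).arctan.const_mul 2).const_sub Real.pi
    exact this.differentiableAt
  · intro x
    have := ((((hasDerivAt_id x).const_sub t₀).div_const η).arctan.const_mul 2).const_sub Real.pi
    have h2 := this.deriv
    simp only [id] at h2
    rw [h2, ← NNReal.coe_le_coe, coe_nnnorm, Real.coe_toNNReal _ (by positivity),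
      Real.norm_eq_abs, abs_le]
    have h3 : 1 / (1 + ((t₀ - x) / η) ^ 2) ≤ 1 := by
      rw [div_le_one (by positivity)]
      nlinarith [sq_nonneg ((t₀ - x) / η)]
    have h4 : 0 ≤ 1 / (1 + ((t₀ - x) / η) ^ 2) := by positivity
    have h5 : -(2 * (1 / (1 + ((t₀ - x) / η) ^ 2) * (-1 / η)))
        = (1 / (1 + ((t₀ - x) / η) ^ 2)) * (2 / η) := by ring
    rw [h5]
    have h6 : 0 < 2 / η := by positivity
    constructor <;> nlinarith

lemma volume_cotLine_le {t₀ η μ : ℝ} (ht0 : 0 ≤ t₀) (ht1 : t₀ ≤ 1) (hη : 0 < η) (hμ : 0 ≤ μ)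
    {E : Set ℝ} (hE : volume E ≤ ENNReal.ofReal μ) :
    volume {θ ∈ Set.Ioo 0 (2 * Real.pi) | cotLine t₀ η θ ∈ E ∨ cotLine t₀ η θ ∉ Set.Icc (-1) 2}
      ≤ ENNReal.ofReal (2 * μ / η + 4 * η) := by
  set φ : ℝ → ℝ := fun x : ℝ => Real.pi - 2 * Real.arctan ((t₀ - x) / η) with hφ
  have hφE : volume (φ '' E) ≤ ENNReal.ofReal (2 * μ / η) := by
    have h1 := (lipschitzWith_arctan_div (t₀ := t₀) hη).hausdorffMeasure_image_le zero_le_one E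
    rw [hausdorffMeasure_real] at h1
    refine h1.trans ?_
    rw [ENNReal.rpow_one]
    refine (mul_le_mul_right hE _).trans ?_
    rw [show ((Real.toNNReal (2 / η) : NNReal) : ENNReal) = ENNReal.ofReal (2 / η) from rfl,
      ← ENNReal.ofReal_mul (by positivity)]
    exact ENNReal.ofReal_le_ofReal (le_of_eq (by ring))
  have hsub : {θ ∈ Set.Ioo 0 (2 * Real.pi) | cotLine t₀ η θ ∈ E ∨
      cotLine t₀ η θ ∉ Set.Icc (-1) 2} ⊆ φ '' E ∪ (Set.Icc 0 (2 * η) ∪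
        Set.Icc (2 * Real.pi - 2 * η) (2 * Real.pi)) := by
    rintro θ ⟨⟨h0, h1⟩, h | h⟩
    · exact Or.inl ⟨_, h, arctan_cotLine hη h0 h1⟩
    · right
      have hs : 0 < Real.sin (θ / 2) := Real.sin_pos_of_pos_of_lt_pi (by linarith) (by linarith)
      rw [Set.mem_Icc, not_and_or, not_le, not_le] at h
      have key : ∀ y, 0 < y → y < Real.pi → 0 < Real.sin y → Real.sin y < η * Real.cos y →
          y ≤ η := by
        intro y hy0 hy1 hs hc
        have hcos : 0 < Real.cos y := by
          by_contra hn
          nlinarith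
        have hy2 : y < Real.pi / 2 := by
          by_contra hn
          have := Real.cos_nonpos_of_pi_div_two_le_of_le (not_lt.1 hn) (by linarith)
          linarith
        have h5 := Real.lt_tan hy0 hy2
        rw [Real.tan_eq_sin_div_cos] at h5
        have h6 : Real.sin y / Real.cos y < η := by rwa [div_lt_iff₀ hcos]
        linarith
      rcases h with h | h
      · left
        have h2 : 1 < η * (Real.cos (θ / 2) / Real.sin (θ / 2)) := by
          unfold cotLine at h; linarith
        rw [← mul_div_assoc, one_lt_div hs] at h2
        have := key (θ / 2) (by linarith) (by linarith) hs h2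
        constructor <;> linarith
      · right
        have h2 : 1 < η * (-Real.cos (θ / 2) / Real.sin (θ / 2)) := by
          unfold cotLine at h; rw [neg_div]; linarith
        rw [← mul_div_assoc, one_lt_div hs] at h2
        have := key (Real.pi - θ / 2) (by linarith) (by linarith)
          (by rwa [Real.sin_pi_sub]) (by rwa [Real.sin_pi_sub, Real.cos_pi_sub])
        constructor <;> linarith
  refine (measure_mono hsub).trans ((measure_union_le _ _).trans ?_)
  rw [ENNReal.ofReal_add (by positivity) (by positivity)]
  refine add_le_add hφE ((measure_union_le _ _).trans ?_)
  rw [Real.volume_Icc, Real.volume_Icc, ← ENNReal.ofReal_add (by linarith) (by linarith)]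
  exact ENNReal.ofReal_le_ofReal (by linarith)

/-- A Möbius map of the unit disc onto the upper half plane, with `0 ↦ t₀ + i η`. -/
def discMap (t₀ η : ℝ) (w : ℂ) : ℂ := t₀ + Complex.I * η * ((1 + w) / (1 - w))

lemma discMap_im_pos {t₀ η : ℝ} (hη : 0 < η) {w : ℂ} (hw : ‖w‖ < 1) :
    0 < (discMap t₀ η w).im := by
  have hne : (1 : ℂ) - w ≠ 0 := by
    intro h
    rw [sub_eq_zero] at h
    rw [← h, norm_one] at hw
    exact lt_irrefl _ hw
  have h1 : (discMap t₀ η w).im = η * ((1 + w) / (1 - w)).re := by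
    simp [discMap]
  have h2 : ((1 + w) / (1 - w)).re = (1 - ‖w‖ ^ 2) / Complex.normSq (1 - w) := by
    rw [Complex.div_re, ← add_div, ← Complex.normSq_eq_norm_sq, Complex.normSq_apply w]
    simp only [Complex.add_re, Complex.sub_re, Complex.one_re, Complex.add_im, Complex.sub_im,
      Complex.one_im]
    ring
  rw [h1, h2]
  have := Complex.normSq_pos.2 hne
  have : 0 < 1 - ‖w‖ ^ 2 := by nlinarith [norm_nonneg w]
  positivity

lemma discMap_exp {t₀ η θ : ℝ} (h : Real.sin (θ / 2) ≠ 0) :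
    discMap t₀ η (Complex.exp (θ * Complex.I)) = (cotLine t₀ η θ : ℂ) := by
  have e : Complex.exp (θ * Complex.I)
      = ((Real.cos (θ / 2) : ℂ) + Real.sin (θ / 2) * Complex.I) ^ 2 := by
    rw [Complex.ofReal_cos, Complex.ofReal_sin, ← Complex.exp_mul_I, ← Complex.exp_nat_mul]
    congr 1
    push_cast
    ring
  have hcs : ((Real.cos (θ / 2) : ℂ)) ^ 2 + (Real.sin (θ / 2) : ℂ) ^ 2 = 1 := by
    exact_mod_cast Real.cos_sq_add_sin_sq (θ / 2)
  have hs : (Real.sin (θ / 2) : ℂ) ≠ 0 := by exact_mod_cast h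
  unfold discMap cotLine
  rw [e]
  simp only [Complex.ofReal_sub, Complex.ofReal_mul, Complex.ofReal_div]
  generalize hc' : ((Real.cos (θ / 2) : ℝ) : ℂ) = c at *
  generalize hs' : ((Real.sin (θ / 2) : ℝ) : ℂ) = s at *
  have hI := Complex.I_sq
  have h1 : 1 - (c + s * Complex.I) ^ 2 = (-2 * s * Complex.I) * (c + s * Complex.I) := by
    linear_combination s ^ 2 * hI + (-1 : ℂ) * hcs
  have h2 : 1 + (c + s * Complex.I) ^ 2 = 2 * c * (c + s * Complex.I) := by
    linear_combination s ^ 2 * hI - hcs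
  have h3 : c + s * Complex.I ≠ 0 := by
    intro h0
    have : (c + s * Complex.I) * (c - s * Complex.I) = 1 := by
      linear_combination hcs - s ^ 2 * hI
    rw [h0, zero_mul] at this
    exact zero_ne_one this
  rw [h1, h2, mul_div_mul_right _ _ h3]
  have := Complex.I_ne_zero
  field_simp
  ring

end

section

lemma abs_arg_le_pi_div_two_of_re_pos {z : ℂ} (hz : 0 < z.re) : |Complex.arg z| ≤ Real.pi / 2 :=
  Complex.abs_arg_le_pi_div_two_iff.2 hz.le

lemma integral_arg_discMap {H : ℂ → ℂ} (hd : ∀ z : ℂ, 0 < z.im → DifferentiableAt ℂ H z)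
    (hre : ∀ z : ℂ, 0 ≤ z.im → 0 < (H z).re) {t₀ η : ℝ} (hη : 0 < η) {r : ℝ} (hr0 : 0 < r)
    (hr1 : r < 1) :
    (ContinuousOn (fun θ : ℝ => Complex.arg (H (discMap t₀ η (r * Complex.exp (θ * Complex.I)))))
      Set.univ) ∧
    ∫ θ in (0 : ℝ)..2 * Real.pi,
      Complex.arg (H (discMap t₀ η (r * Complex.exp (θ * Complex.I))))
      = 2 * Real.pi * Complex.arg (H (t₀ + η * Complex.I)) := by
  set G : ℂ → ℂ := fun w => Complex.log (H (discMap t₀ η w)) with hG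
  have hGd : ∀ w : ℂ, ‖w‖ < 1 → DifferentiableAt ℂ G w := by
    intro w hw
    have him := discMap_im_pos (t₀ := t₀) hη hw
    have hne : (1 : ℂ) - w ≠ 0 := by
      intro h
      rw [sub_eq_zero] at h
      rw [← h, norm_one] at hw
      exact lt_irrefl _ hw
    have h1 : DifferentiableAt ℂ (discMap t₀ η) w := by
      unfold discMap
      fun_prop (disch := exact hne)
    have h2 : DifferentiableAt ℂ (fun w => H (discMap t₀ η w)) w := (hd _ him).comp w h1
    exact h2.clog (Or.inl (hre _ him.le))
  have hav : Real.circleAverage G 0 r = G 0 := by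
    refine DiffContOnCl.circleAverage (DifferentiableOn.diffContOnCl ?_)
    intro w hw
    rw [abs_of_pos hr0, closure_ball _ hr0.ne', mem_closedBall_zero_iff] at hw
    exact (hGd w (by linarith)).differentiableWithinAt
  have hnorm : ∀ θ : ℝ, ‖(r : ℂ) * Complex.exp (θ * Complex.I)‖ < 1 := by
    intro θ
    rw [norm_mul, Complex.norm_exp_ofReal_mul_I, mul_one, Complex.norm_real, Real.norm_eq_abs,
      abs_of_pos hr0]
    exact hr1
  have hcont : Continuous fun θ : ℝ => G (r * Complex.exp (θ * Complex.I)) := by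
    rw [continuous_iff_continuousAt]
    intro θ
    refine ContinuousAt.comp (f := fun θ : ℝ => (r : ℂ) * Complex.exp (θ * Complex.I))
      (hGd _ (hnorm θ)).continuousAt ?_
    fun_prop
  have himc : Continuous fun θ : ℝ => (G (r * Complex.exp (θ * Complex.I))).im :=
    Complex.continuous_im.comp hcont
  refine ⟨?_, ?_⟩
  · simp only [hG, Complex.log_im] at himc
    exact himc.continuousOn
  · rw [Real.circleAverage_def] at hav
    have h3 := congrArg Complex.im hav
    have h4 := Complex.imCLM.intervalIntegral_comp_comm
      (hcont.intervalIntegrable (μ := volume) 0 (2 * Real.pi))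
    simp only [Complex.imCLM_apply] at h4
    have h5 : ∀ θ : ℝ, circleMap 0 r θ = r * Complex.exp (θ * Complex.I) := by
      intro θ; simp [circleMap]
    simp only [h5] at h3
    rw [Complex.smul_im, ← h4, smul_eq_mul] at h3
    have h6 : (G 0).im = Complex.arg (H (t₀ + η * Complex.I)) := by
      simp only [hG, Complex.log_im]
      congr 2
      simp [discMap, mul_comm]
    rw [h6] at h3
    have hpi := Real.pi_pos
    simp only [hG, Complex.log_im] at h3
    rw [← h3, ← mul_assoc, mul_inv_cancel₀ (by positivity), one_mul]

/-- A Poisson-type bound for the argument of a function with positive real part on the upper half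
plane. -/
lemma abs_arg_le {H : ℂ → ℂ} (hd : ∀ z : ℂ, 0 < z.im → DifferentiableAt ℂ H z)
    (hre : ∀ z : ℂ, 0 ≤ z.im → 0 < (H z).re) {R : Set ℝ} (hR : R.Finite)
    (hc : ∀ x : ℝ, x ∉ R → ContinuousAt H x) {E : Set ℝ} (hEm : MeasurableSet E) {ε μ : ℝ}
    (hε : 0 ≤ ε) (hμ : 0 ≤ μ) (hEμ : volume E ≤ ENNReal.ofReal μ)
    (hE : ∀ x ∈ Set.Icc (-1 : ℝ) 2, x ∉ E → x ∉ R → |Complex.arg (H x)| ≤ ε) {t₀ η : ℝ}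
    (ht0 : 0 ≤ t₀) (ht1 : t₀ ≤ 1) (hη : 0 < η) :
    |Complex.arg (H (t₀ + η * Complex.I))| ≤ ε + μ / (2 * η) + η := by
  have hpi := Real.pi_pos
  set f : ℝ → ℝ → ℝ := fun r θ =>
    Complex.arg (H (discMap t₀ η (r * Complex.exp (θ * Complex.I)))) with hf
  set B : Set ℝ := {θ ∈ Set.Ioo 0 (2 * Real.pi) |
    cotLine t₀ η θ ∈ E ∨ cotLine t₀ η θ ∉ Set.Icc (-1) 2} with hB
  have hBm : MeasurableSet B := by
    have hm : Measurable (cotLine t₀ η) := by unfold cotLine; fun_prop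
    exact measurableSet_Ioo.inter ((hm hEm).union (hm measurableSet_Icc).compl)
  have hBμ : volume B ≤ ENNReal.ofReal (2 * μ / η + 4 * η) :=
    volume_cotLine_le ht0 ht1 hη hμ hEμ
  set Z : Set ℝ := (fun x : ℝ => Real.pi - 2 * Real.arctan ((t₀ - x) / η)) '' R ∪ {2 * Real.pi}
    with hZ
  have hZ0 : volume Z = 0 := ((hR.image _).union (Set.finite_singleton _)).measure_zero _
  have hZae : ∀ᵐ θ : ℝ, θ ∉ Z := measure_eq_zero_iff_ae_notMem.1 hZ0
  -- boundary convergence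
  have hsin : ∀ θ ∈ Set.Ioo 0 (2 * Real.pi), Real.sin (θ / 2) ≠ 0 := fun θ h =>
    (Real.sin_pos_of_pos_of_lt_pi (by linarith [h.1]) (by linarith [h.2])).ne'
  have hlim : ∀ θ ∈ Set.Ioo 0 (2 * Real.pi), θ ∉ Z →
      Filter.Tendsto (fun r => f r θ) (nhdsWithin 1 (Set.Iio 1))
        (nhds (Complex.arg (H (cotLine t₀ η θ)))) := by
    intro θ hθ hθZ
    have hxR : cotLine t₀ η θ ∉ R := fun h =>
      hθZ (Or.inl ⟨_, h, arctan_cotLine hη hθ.1 hθ.2⟩)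
    have hne : (1 : ℂ) - (1 : ℝ) * Complex.exp (θ * Complex.I) ≠ 0 := by
      rw [Complex.ofReal_one, one_mul]
      intro h0
      have h1 : Complex.exp (θ * Complex.I) = 1 := (sub_eq_zero.1 h0).symm
      have h2 := congrArg Complex.re h1
      rw [Complex.exp_ofReal_mul_I_re, Complex.one_re] at h2
      have h3 := Real.cos_sq' (θ / 2)
      have h4 := Real.cos_two_mul (θ / 2)
      rw [show 2 * (θ / 2) = θ by ring] at h4
      have : Real.sin (θ / 2) ^ 2 = 0 := by linarith
      exact hsin θ hθ (pow_eq_zero_iff two_ne_zero |>.1 this)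
    have h1 : ContinuousAt (fun r : ℝ => discMap t₀ η (r * Complex.exp (θ * Complex.I))) 1 := by
      unfold discMap
      fun_prop (disch := exact hne)
    have h2 : discMap t₀ η ((1 : ℝ) * Complex.exp (θ * Complex.I)) = (cotLine t₀ η θ : ℂ) := by
      rw [Complex.ofReal_one, one_mul, discMap_exp (hsin θ hθ)]
    have h3 : ContinuousAt (fun r : ℝ => f r θ) 1 := by
      have h4 :
          ContinuousAt (fun r : ℝ => H (discMap t₀ η (r * Complex.exp (θ * Complex.I)))) 1 := by
        refine ContinuousAt.comp (f := fun r : ℝ =>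
          discMap t₀ η (r * Complex.exp (θ * Complex.I))) ?_ h1
        rw [h2]
        exact hc _ hxR
      refine ContinuousAt.comp (f := fun r : ℝ =>
        H (discMap t₀ η (r * Complex.exp (θ * Complex.I)))) (Complex.continuousAt_arg ?_) h4
      rw [h2]
      exact Or.inl (hre _ (by simp))
    have h5 := h3.tendsto.mono_left (nhdsWithin_le_nhds (s := Set.Iio 1))
    simp only [hf] at h5 ⊢
    rwa [h2] at h5
  have hev : ∀ᶠ r : ℝ in nhdsWithin 1 (Set.Iio 1), 0 < r ∧ r < 1 := by
    filter_upwards [self_mem_nhdsWithin, nhdsWithin_le_nhds (Ioi_mem_nhds zero_lt_one)] with r h1 h2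
    exact ⟨h2, h1⟩
  have hioc : ∀ θ : ℝ, θ ∉ Z → θ ∈ Set.uIoc 0 (2 * Real.pi) → θ ∈ Set.Ioo 0 (2 * Real.pi) := by
    intro θ h1 h2
    rw [Set.uIoc_of_le (by positivity)] at h2
    exact ⟨h2.1, lt_of_le_of_ne h2.2 fun h => h1 (Or.inr h)⟩
  have hDCT := intervalIntegral.tendsto_integral_filter_of_dominated_convergence (μ := volume)
    (a := 0) (b := 2 * Real.pi) (l := nhdsWithin 1 (Set.Iio 1)) (F := f)
    (f := fun θ => Complex.arg (H (cotLine t₀ η θ))) (fun _ => Real.pi)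
    (by
      filter_upwards [hev] with r hr
      exact (continuousOn_univ.1 (integral_arg_discMap hd hre hη hr.1 hr.2).1).aestronglyMeasurable)
    (Filter.Eventually.of_forall fun r => Filter.Eventually.of_forall fun θ _ =>
      Complex.abs_arg_le_pi _)
    (by simp)
    (by
      filter_upwards [hZae] with θ hθ hθ'
      exact hlim θ (hioc θ hθ hθ') hθ)
  have hconst : Filter.Tendsto (fun r => ∫ θ in (0 : ℝ)..2 * Real.pi, f r θ)
      (nhdsWithin 1 (Set.Iio 1)) (nhds (2 * Real.pi * Complex.arg (H (t₀ + η * Complex.I)))) := by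
    refine Filter.Tendsto.congr' ?_ tendsto_const_nhds
    filter_upwards [hev] with r hr
    exact (integral_arg_discMap hd hre hη hr.1 hr.2).2.symm
  have heq := tendsto_nhds_unique hDCT hconst
  have hbound : ‖∫ θ in (0 : ℝ)..2 * Real.pi, Complex.arg (H (cotLine t₀ η θ))‖
      ≤ ∫ θ in (0 : ℝ)..2 * Real.pi, (ε + B.indicator (fun _ => Real.pi / 2) θ) := by
    refine intervalIntegral.norm_integral_le_of_norm_le (by positivity) ?_ ?_
    · filter_upwards [hZae] with θ hθ hθ'
      have hI := hioc θ hθ (by rwa [Set.uIoc_of_le (by positivity)])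
      have hxR : cotLine t₀ η θ ∉ R := fun h =>
        hθ (Or.inl ⟨_, h, arctan_cotLine hη hI.1 hI.2⟩)
      rw [Real.norm_eq_abs]
      by_cases hθB : θ ∈ B
      · rw [Set.indicator_of_mem hθB]
        have := abs_arg_le_pi_div_two_of_re_pos (hre (cotLine t₀ η θ : ℂ) (by simp))
        linarith
      · rw [Set.indicator_of_notMem hθB, add_zero]
        have h7 : ¬ (cotLine t₀ η θ ∈ E ∨ cotLine t₀ η θ ∉ Set.Icc (-1) 2) := fun h => hθB ⟨hI, h⟩
        push Not at h7
        exact hE _ h7.2 h7.1 hxR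
    · refine IntervalIntegrable.add (by simp) ?_
      rw [intervalIntegrable_iff]
      exact (integrableOn_const measure_Ioc_lt_top.ne).indicator hBm
  have hval : ∫ θ in (0 : ℝ)..2 * Real.pi, (ε + B.indicator (fun _ => Real.pi / 2) θ)
      ≤ 2 * Real.pi * ε + (2 * μ / η + 4 * η) * (Real.pi / 2) := by
    rw [intervalIntegral.integral_add (by simp) (by
      rw [intervalIntegrable_iff]
      exact (integrableOn_const measure_Ioc_lt_top.ne).indicator hBm)]
    refine add_le_add (by simp) ?_
    rw [intervalIntegral.integral_of_le (by positivity), integral_indicator hBm, setIntegral_const,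
      smul_eq_mul]
    refine mul_le_mul_of_nonneg_right ?_ (by positivity)
    rw [measureReal_restrict_apply' measurableSet_Ioc]
    refine ENNReal.toReal_le_of_le_ofReal (by positivity) ?_
    exact (measure_mono Set.inter_subset_left).trans hBμ
  have hfin := hbound.trans hval
  rw [heq, Real.norm_eq_abs, abs_mul, abs_of_pos (by positivity)] at hfin
  have h8 : 2 * Real.pi * ε + (2 * μ / η + 4 * η) * (Real.pi / 2)
      = 2 * Real.pi * (ε + μ / (2 * η) + η) := by
    field_simp
    ring
  rw [h8] at hfin
  exact le_of_mul_le_mul_left hfin (by positivity)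

end

section

lemma abs_arg_le_abs_im_div_re {z : ℂ} (hz : 0 < z.re) : |Complex.arg z| ≤ |z.im| / z.re := by
  have h1 := Complex.tan_arg z
  have h2 : |Complex.arg z| < Real.pi / 2 := Complex.abs_arg_lt_pi_div_two_iff.2 (Or.inl hz)
  have h3 := Real.le_tan (abs_nonneg _) h2
  refine h3.trans ?_
  rcases abs_cases (Complex.arg z) with h | h
  · rw [h.1, h1]
    gcongr
    exact le_abs_self _
  · rw [h.1, Real.tan_neg, h1, ← neg_div]
    gcongr
    exact neg_le_abs _

lemma abs_im_le_of_abs_arg_le {z : ℂ} (hz : 0 < z.re) {κ : ℝ} (hκ : κ ≤ 1 / 2)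
    (h : |Complex.arg z| ≤ κ) : |z.im| ≤ 2 * κ * z.re := by
  have h1 := Complex.tan_arg z
  have hc : 1 / 2 ≤ Real.cos (Complex.arg z) := by
    have h2 := Real.one_sub_sq_div_two_le_cos (x := Complex.arg z)
    have h3 : Complex.arg z ^ 2 ≤ 1 := by
      rw [← sq_abs]
      nlinarith [abs_nonneg (Complex.arg z)]
    linarith
  have hs : |Real.sin (Complex.arg z)| ≤ κ := Real.abs_sin_le_abs.trans h
  rw [Real.tan_eq_sin_div_cos, div_eq_div_iff (by linarith) hz.ne'] at h1
  have h4 : |z.im| * Real.cos (Complex.arg z) = |Real.sin (Complex.arg z)| * z.re := by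
    rw [← abs_of_pos (show 0 < Real.cos (Complex.arg z) by linarith), ← abs_mul, ← h1, abs_mul,
      abs_of_pos hz]
  nlinarith [abs_nonneg z.im]

lemma one_add_le_exp_two_sqrt {y : ℝ} (hy : 0 ≤ y) : 1 + y ≤ Real.exp (2 * √y) := by
  have h1 := Real.add_one_le_exp √y
  have h2 := Real.sq_sqrt hy
  have h3 : Real.exp (2 * √y) = Real.exp √y ^ 2 := by
    rw [← Real.exp_nat_mul]; norm_num
  rw [h3]
  nlinarith [Real.sqrt_nonneg y]

/-- Growth along a line of a product of monic linear factors with zeros in the lower half plane. -/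
lemma norm_prod_ge {m : ℕ} (w : Fin m → ℂ) (hw : ∀ i, (w i).im ≤ 0) {s κ η : ℝ} (hs : 0 ≤ s)
    (hη : 0 < η) (hκ : 0 ≤ κ)
    (h : ∀ t ∈ Set.Icc (0 : ℝ) 1, |(∑ i, ((t + η * Complex.I : ℂ) - w i)⁻¹).re| ≤
      2 * κ * (-(∑ i, ((t + η * Complex.I : ℂ) - w i)⁻¹).im + s)) {t : ℝ}
    (ht : t ∈ Set.Icc (0 : ℝ) 1) :
    (∏ i, ‖w i‖) * Real.exp (-(2 * κ * (4 * m + s))) ≤ ∏ i, ‖(t + η * Complex.I : ℂ) - w i‖ := by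
  set g : ℝ → ℂ := fun t => ∑ i, Complex.log ((t + η * Complex.I : ℂ) - w i) with hg
  have him : ∀ (t : ℝ) i, 0 < ((t + η * Complex.I : ℂ) - w i).im := by
    intro t i
    have := hw i
    simp
    linarith
  have hne : ∀ (t : ℝ) i, ((t + η * Complex.I : ℂ) - w i) ≠ 0 := by
    intro t i h0
    have := him t i
    rw [h0] at this
    simp at this
  have hder : ∀ t : ℝ, HasDerivAt g (∑ i, ((t + η * Complex.I : ℂ) - w i)⁻¹) t := by
    intro t
    refine HasDerivAt.fun_sum fun i _ => ?_
    have h1 : HasDerivAt (fun t : ℝ => (t + η * Complex.I : ℂ) - w i) 1 t := by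
      exact ((Complex.ofRealCLM.hasDerivAt (x := t)).add_const _).sub_const _
    refine (h1.clog_real (Or.inr (him t i).ne')).congr_deriv ?_
    rw [one_div]
  set Φ : ℝ → ℝ := fun t => (g t).re - 2 * κ * (g t).im + 2 * κ * s * t with hΦ
  have hΦd : ∀ t : ℝ, HasDerivAt Φ ((∑ i, ((t + η * Complex.I : ℂ) - w i)⁻¹).re
      - 2 * κ * (∑ i, ((t + η * Complex.I : ℂ) - w i)⁻¹).im + 2 * κ * s) t := by
    intro t
    have h1 := (Complex.reCLM.hasFDerivAt.comp_hasDerivAt t (hder t))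
    have h2 := (Complex.imCLM.hasFDerivAt.comp_hasDerivAt t (hder t))
    have h3 := (h1.sub (h2.const_mul (2 * κ))).add ((hasDerivAt_id t).const_mul (2 * κ * s))
    refine h3.congr_deriv ?_
    simp
  have hmono : MonotoneOn Φ (Set.Icc 0 1) := by
    refine monotoneOn_of_deriv_nonneg (convex_Icc 0 1)
      (fun t _ => (hΦd t).continuousAt.continuousWithinAt)
      (fun t _ => (hΦd t).differentiableAt.differentiableWithinAt) fun t ht => ?_
    rw [interior_Icc] at ht
    rw [(hΦd t).deriv]
    have := (abs_le.1 (h t ⟨ht.1.le, ht.2.le⟩)).1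
    linarith
  have h0 := hmono ⟨le_rfl, zero_le_one⟩ ht ht.1
  have hgim0 : ∀ t, 0 ≤ (g t).im := by
    intro t
    simp only [hg, Complex.im_sum, Complex.log_im]
    exact Finset.sum_nonneg fun i _ => Complex.arg_nonneg_iff.2 (him t i).le
  have hgim1 : (g 0).im ≤ 4 * m := by
    simp only [hg, Complex.im_sum, Complex.log_im]
    calc _ ≤ ∑ _i : Fin m, (4 : ℝ) := Finset.sum_le_sum fun i _ =>
          (Complex.arg_le_pi _).trans Real.pi_le_four
      _ = _ := by simp [mul_comm]
  have hexp : ∀ t, Real.exp (g t).re = ∏ i, ‖(t + η * Complex.I : ℂ) - w i‖ := by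
    intro t
    simp only [hg, Complex.re_sum, Complex.log_re, Real.exp_sum]
    exact Finset.prod_congr rfl fun i _ => Real.exp_log (norm_pos_iff.2 (hne t i))
  have h5 : (g 0).re - 2 * κ * (4 * m + s) ≤ (g t).re := by
    simp only [hΦ] at h0
    have e1 : 0 ≤ 2 * κ * (g t).im := mul_nonneg (by positivity) (hgim0 t)
    have e2 : 2 * κ * (g 0).im ≤ 2 * κ * (4 * m) :=
      mul_le_mul_of_nonneg_left hgim1 (by positivity)
    have e3 : 2 * κ * s * t ≤ 2 * κ * s := mul_le_of_le_one_right (by positivity) ht.2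
    nlinarith
  rw [← hexp t]
  refine le_trans ?_ (Real.exp_le_exp.2 h5)
  rw [sub_eq_add_neg, Real.exp_add, hexp 0]
  refine mul_le_mul_of_nonneg_right ?_ (Real.exp_pos _).le
  refine Finset.prod_le_prod (fun _ _ => norm_nonneg _) fun i _ => ?_
  rw [Complex.norm_def, Complex.norm_def]
  apply Real.sqrt_le_sqrt
  rw [Complex.normSq_apply, Complex.normSq_apply]
  simp
  nlinarith [hw i]

end

section

lemma re_inv_conj_sub (t : ℝ) (a : ℂ) :
    (((t : ℂ) - (starRingEnd ℂ) a)⁻¹).re = (((t : ℂ) - a)⁻¹).re := by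
  have : (t : ℂ) - (starRingEnd ℂ) a = (starRingEnd ℂ) ((t : ℂ) - a) := by
    simp
  rw [this, ← map_inv₀, Complex.conj_re]

/-- Real polynomials as products over points of the closed lower half plane. -/
lemma exists_lower_roots (q : Polynomial ℝ) (hq : q.eval 0 = 1) :
    ∃ w : Fin q.natDegree → ℂ, (∀ i, (w i).im ≤ 0) ∧ (∀ i, w i ≠ 0) ∧
      (∀ t : ℝ, |q.eval t| * ∏ i, ‖w i‖ = ∏ i, ‖(t : ℂ) - w i‖) ∧
      ∀ t : ℝ, (∀ i, (t : ℂ) - w i ≠ 0) →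
        q.derivative.eval t / q.eval t = (∑ i, ((t : ℂ) - w i)⁻¹).re := by
  have hdeg : (q.map (algebraMap ℝ ℂ)).natDegree = q.natDegree := Polynomial.natDegree_map _
  have hex := exists_prod_one_sub_div (q.map (algebraMap ℝ ℂ)) (by
    rw [show (0 : ℂ) = algebraMap ℝ ℂ 0 by simp, Polynomial.eval_map_apply, hq]; simp)
  rw [hdeg] at hex
  obtain ⟨a, ha0, ha⟩ := hex
  have ha' : ∀ z : ℂ, Polynomial.aeval z q = ∏ i, (1 - z / a i) := by
    intro z
    rw [← ha z, Polynomial.aeval_def, Polynomial.eval_map]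
  have hre : ∀ (p : Polynomial ℝ) (t : ℝ), Polynomial.aeval (t : ℂ) p = ((p.eval t : ℝ) : ℂ) :=
    fun p t => Polynomial.aeval_algebraMap_apply_eq_algebraMap_eval (A := ℂ) t p
  set w : Fin q.natDegree → ℂ := fun i => if (a i).im ≤ 0 then a i else (starRingEnd ℂ) (a i)
    with hw
  have hwc : ∀ i, w i = a i ∨ w i = (starRingEnd ℂ) (a i) := by
    intro i
    simp only [hw]
    split_ifs <;> simp
  have hwn : ∀ i, ‖w i‖ = ‖a i‖ := by
    intro i
    rcases hwc i with h | h <;> rw [h]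
    exact Complex.norm_conj _
  have hwt : ∀ i (t : ℝ), ‖(t : ℂ) - w i‖ = ‖(t : ℂ) - a i‖ := by
    intro i t
    rcases hwc i with h | h <;> rw [h]
    rw [← Complex.norm_conj]
    simp
  refine ⟨w, ?_, ?_, ?_, ?_⟩
  · intro i
    simp only [hw]
    split_ifs with h
    · exact h
    · rw [Complex.conj_im]; linarith
  · intro i
    rw [← norm_pos_iff, hwn]
    exact norm_pos_iff.2 (ha0 i)
  · intro t
    have h1 : |q.eval t| = ‖Polynomial.aeval (t : ℂ) q‖ := by
      rw [hre, Complex.norm_real, Real.norm_eq_abs]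
    rw [h1, ha', norm_prod, ← Finset.prod_mul_distrib]
    refine Finset.prod_congr rfl fun i _ => ?_
    rw [hwn, hwt, ← norm_mul, norm_sub_rev]
    congr 1
    have := ha0 i
    field_simp
  · intro t ht
    have hta : ∀ i, (t : ℂ) - a i ≠ 0 := by
      intro i
      rw [← norm_pos_iff, ← hwt]
      exact norm_pos_iff.2 (ht i)
    have h1 : ∀ i, (1 : ℂ) - t / a i ≠ 0 := by
      intro i h
      apply hta i
      rw [sub_eq_zero, eq_div_iff (ha0 i), one_mul] at h
      rw [h, sub_self]
    have h2 := logDeriv_prod (s := Finset.univ) (f := fun i (z : ℂ) => 1 - z / a i) (x := (t : ℂ))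
      (fun i _ => h1 i) (fun i _ => by fun_prop)
    have h3 : (fun z : ℂ => ∏ i, (1 - z / a i)) = fun z => Polynomial.aeval z q :=
      funext fun z => (ha' z).symm
    rw [h3, logDeriv_apply, (q.hasDerivAt_aeval (t : ℂ)).deriv, hre, hre] at h2
    have h4 : ∀ i, logDeriv (fun z : ℂ => 1 - z / a i) t = ((t : ℂ) - a i)⁻¹ := by
      intro i
      rw [logDeriv_apply]
      have h5 : HasDerivAt (fun z : ℂ => 1 - z / a i) (-(1 / a i)) t :=
        ((hasDerivAt_id (t : ℂ)).div_const (a i)).const_sub 1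
      rw [h5.deriv]
      have := ha0 i
      have := hta i
      have e : (1 : ℂ) - t / a i = -((t - a i) / a i) := by field_simp; ring
      rw [e]
      field_simp
    rw [Finset.sum_congr rfl fun i _ => h4 i] at h2
    have h6 := congrArg Complex.re h2
    rw [← Complex.ofReal_div, Complex.ofReal_re] at h6
    rw [h6, Complex.re_sum, Complex.re_sum]
    refine Finset.sum_congr rfl fun i _ => ?_
    rcases hwc i with h | h <;> rw [h]
    exact (re_inv_conj_sub t (a i)).symm

lemma im_sum_inv_nonpos {m : ℕ} (w : Fin m → ℂ) (hw : ∀ i, (w i).im ≤ 0) {z : ℂ}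
    (hz : 0 ≤ z.im) : (∑ i, (z - w i)⁻¹).im ≤ 0 := by
  rw [Complex.im_sum]
  refine Finset.sum_nonpos fun i _ => ?_
  rw [Complex.inv_im, Complex.sub_im]
  exact div_nonpos_of_nonpos_of_nonneg (by linarith [hw i]) (Complex.normSq_nonneg _)

/-- If the logarithmic derivative of a polynomial is small outside a small set, the polynomial
cannot decay much along the interval. -/
theorem exists_exp_le_abs_eval : ∃ C : ℝ, 0 < C ∧ ∀ (q : Polynomial ℝ) (d σ μ η : ℝ), 0 < d →
    0 < σ → σ ≤ 1 → 0 ≤ μ → 0 < η → q.eval 0 = 1 → q.natDegree ≤ d →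
    volume {t ∈ Set.Icc (-1 : ℝ) 2 | σ * d * |q.eval t| < |q.derivative.eval t|}
      ≤ ENNReal.ofReal μ →
    √σ + μ / (2 * η) + η ≤ 1 / 2 →
    ∃ t ∈ Set.Icc (7 / 8 : ℝ) 1,
      Real.exp (-(C * (√σ + μ / (2 * η) + η + √η) * d)) ≤ |q.eval t| := by
  obtain ⟨C, hC, hCx⟩ := exists_lintegral_abs_sub_rpow_le (α := 1 / 2) (by norm_num) (by norm_num)
  refine ⟨10 + 16 * C, by positivity, fun q d σ μ η hd hσ hσ1 hμ hη hq0 hqd hE hκ => ?_⟩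
  have hex := exists_lower_roots q hq0
  generalize q.natDegree = m at hex hqd
  obtain ⟨w, hwim, hw0, hwq, hwd⟩ := hex
  set κ := √σ + μ / (2 * η) + η with hκdef
  have hκ0 : 0 ≤ κ := by positivity
  set s := √σ * d with hs
  have hs0 : 0 < s := by positivity
  have hsd : s ≤ d := by
    have : √σ ≤ 1 := Real.sqrt_le_one.2 hσ1
    nlinarith
  set H : ℂ → ℂ := fun z => Complex.I * ∑ i, (z - w i)⁻¹ + s with hH
  have hHre : ∀ z, (H z).re = -(∑ i, (z - w i)⁻¹).im + s := by
    intro z; simp [hH]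
  have hHim : ∀ z, (H z).im = (∑ i, (z - w i)⁻¹).re := by
    intro z; simp [hH]
  have hpos : ∀ z : ℂ, 0 ≤ z.im → s ≤ (H z).re := by
    intro z hz
    rw [hHre]
    linarith [im_sum_inv_nonpos w hwim hz]
  set R : Set ℝ := Set.range fun i => (w i).re with hR
  have hRf : R.Finite := Set.finite_range _
  have hRne : ∀ t : ℝ, t ∉ R → ∀ i, (t : ℂ) - w i ≠ 0 := by
    intro t ht i h
    refine ht ⟨i, ?_⟩
    have := congrArg Complex.re h
    simp at this
    linarith
  have harg : ∀ t₀ ∈ Set.Icc (0 : ℝ) 1, |Complex.arg (H (t₀ + η * Complex.I))| ≤ κ := by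
    intro t₀ ht₀
    refine abs_arg_le (H := H) (R := R) ?_ (fun z hz => hs0.trans_le (hpos z hz)) hRf ?_ ?_
      (Real.sqrt_nonneg _) hμ hE ?_ ht₀.1 ht₀.2 hη
    · intro z hz
      have hne : ∀ i, z - w i ≠ 0 := by
        intro i h
        have := congrArg Complex.im h
        simp at this
        linarith [hwim i]
      refine (DifferentiableAt.const_mul (DifferentiableAt.fun_sum fun i _ => ?_) _).add_const _
      exact (differentiableAt_id.sub_const _).inv (hne i)
    · intro x hx
      refine ContinuousAt.add (ContinuousAt.mul continuousAt_const ?_) continuousAt_const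
      refine tendsto_finsetSum _ fun i _ => ?_
      exact ContinuousAt.inv₀ (f := fun z : ℂ => z - w i) (by fun_prop) (hRne x hx i)
    · exact measurableSet_Icc.inter (measurableSet_lt
        (continuous_const.mul q.continuous.abs).measurable q.derivative.continuous.abs.measurable)
    · intro x hx hxE hxR
      have hpx := hpos (x : ℂ) (by simp)
      refine (abs_arg_le_abs_im_div_re (hs0.trans_le hpx)).trans ?_
      rw [div_le_iff₀ (hs0.trans_le hpx), hHim, ← hwd x (hRne x hxR)]
      have hqx : 0 < |q.eval x| := by
        have h1 : 0 < ∏ i, ‖(x : ℂ) - w i‖ :=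
          Finset.prod_pos fun i _ => norm_pos_iff.2 (hRne x hxR i)
        rw [← hwq] at h1
        exact pos_of_mul_pos_left h1 (Finset.prod_nonneg fun i _ => norm_nonneg _)
      have h2 : |q.derivative.eval x| ≤ σ * d * |q.eval x| := by
        by_contra h
        exact hxE ⟨hx, not_le.1 h⟩
      rw [abs_div, div_le_iff₀ hqx]
      refine h2.trans (mul_le_mul_of_nonneg_right ?_ hqx.le)
      calc σ * d = √σ * s := by rw [hs, ← mul_assoc, Real.mul_self_sqrt hσ.le]
        _ ≤ _ := mul_le_mul_of_nonneg_left hpx (Real.sqrt_nonneg _)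
  have hkey : ∀ t ∈ Set.Icc (0 : ℝ) 1, |(∑ i, ((t + η * Complex.I : ℂ) - w i)⁻¹).re| ≤
      2 * κ * (-(∑ i, ((t + η * Complex.I : ℂ) - w i)⁻¹).im + s) := by
    intro t ht
    have hp := hpos (t + η * Complex.I) (by simp [hη.le])
    have := abs_im_le_of_abs_arg_le (hs0.trans_le hp) hκ (harg t ht)
    rwa [hHim, hHre] at this
  -- a good point
  set G : ℝ → ENNReal := fun t => ∑ i, ENNReal.ofReal (|t - (w i).re| ^ (-(1 / 2) : ℝ)) with hG
  have hGm : Measurable G := by fun_prop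
  have hGint : ∫⁻ t in Set.Icc (-5 : ℝ) 5, G t ≤ ENNReal.ofReal (m * C) := by
    rw [hG, lintegral_finsetSum _ fun i _ => by fun_prop]
    calc _ ≤ ∑ _i : Fin m, ENNReal.ofReal C := Finset.sum_le_sum fun i _ => hCx _
      _ = _ := by
        rw [Finset.sum_const, nsmul_eq_mul, ENNReal.ofReal_mul (p := (m : ℝ)) (by positivity),
          ENNReal.ofReal_natCast]
        simp
  set J : Set ℝ := Set.Icc (7 / 8 : ℝ) 1 \ R with hJ
  have hJv : volume J = ENNReal.ofReal (1 / 8) := by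
    rw [hJ, measure_sdiff_null (hRf.measure_zero _), Real.volume_Icc]
    norm_num
  obtain ⟨t, htJ, ht⟩ := exists_le_setLAverage (μ := volume) (s := J) (f := G)
    (by rw [hJv]; simp) (by rw [hJv]; simp) hGm.aemeasurable
  refine ⟨t, htJ.1, ?_⟩
  have hGt : ∑ i, |t - (w i).re| ^ (-(1 / 2) : ℝ) ≤ 8 * (m * C) := by
    rw [setLAverage_eq, hJv] at ht
    have h1 : G t ≤ ENNReal.ofReal (8 * (m * C)) := by
      refine ht.trans ?_
      calc _ ≤ ENNReal.ofReal (m * C) / ENNReal.ofReal (1 / 8) := by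
            gcongr
            refine le_trans (lintegral_mono_set ?_) hGint
            rintro x ⟨hx, _⟩
            exact ⟨by linarith [hx.1], by linarith [hx.2]⟩
        _ = _ := by
            rw [← ENNReal.ofReal_div_of_pos (by norm_num)]
            congr 1
            ring
    rw [hG] at h1
    simp only at h1
    rw [← ENNReal.ofReal_sum_of_nonneg fun i _ => by positivity] at h1
    exact (ENNReal.ofReal_le_ofReal_iff (by positivity)).1 h1
  have hti : t ∈ Set.Icc (0 : ℝ) 1 := ⟨by linarith [htJ.1.1], htJ.1.2⟩
  have h1 := norm_prod_ge w hwim hs0.le hη hκ0 hkey hti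
  have h2 : ∏ i, ‖(t + η * Complex.I : ℂ) - w i‖
      ≤ (∏ i, ‖(t : ℂ) - w i‖) * Real.exp (2 * √η * (8 * (m * C))) := by
    calc ∏ i, ‖(t + η * Complex.I : ℂ) - w i‖
        ≤ ∏ i, (‖(t : ℂ) - w i‖ * Real.exp (2 * √η * |t - (w i).re| ^ (-(1 / 2) : ℝ))) := by
          refine Finset.prod_le_prod (fun _ _ => norm_nonneg _) fun i _ => ?_
          have hx : 0 < |t - (w i).re| := abs_pos.2 fun h => htJ.2 ⟨i, (sub_eq_zero.1 h).symm⟩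
          have e1 : ‖(t + η * Complex.I : ℂ) - w i‖ ≤ ‖(t : ℂ) - w i‖ + η := by
            calc _ = ‖((t : ℂ) - w i) + η * Complex.I‖ := by congr 1; ring
              _ ≤ _ := norm_add_le _ _
              _ = _ := by simp [abs_of_pos hη]
          have e2 : |t - (w i).re| ≤ ‖(t : ℂ) - w i‖ := by
            have := Complex.abs_re_le_norm ((t : ℂ) - w i)
            rwa [Complex.sub_re, Complex.ofReal_re] at this
          have e3 := one_add_le_exp_two_sqrt (y := η / |t - (w i).re|) (by positivity)
          have e4 : 2 * √(η / |t - (w i).re|) = 2 * √η * |t - (w i).re| ^ (-(1 / 2) : ℝ) := by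
            rw [Real.sqrt_div hη.le, Real.rpow_neg hx.le, ← Real.sqrt_eq_rpow]
            ring
          rw [e4] at e3
          calc _ ≤ ‖(t : ℂ) - w i‖ + η := e1
            _ ≤ ‖(t : ℂ) - w i‖ * (1 + η / |t - (w i).re|) := by
              have : η ≤ ‖(t : ℂ) - w i‖ * (η / |t - (w i).re|) := by
                rw [← mul_div_assoc, le_div_iff₀ hx, mul_comm]
                exact mul_le_mul_of_nonneg_right e2 hη.le
              linarith
            _ ≤ _ := mul_le_mul_of_nonneg_left e3 (norm_nonneg _)
      _ = (∏ i, ‖(t : ℂ) - w i‖) *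
          Real.exp (2 * √η * ∑ i, |t - (w i).re| ^ (-(1 / 2) : ℝ)) := by
          rw [Finset.prod_mul_distrib, ← Real.exp_sum, Finset.mul_sum]
      _ ≤ _ := by gcongr
  have h3 := h1.trans h2
  rw [← hwq t] at h3
  have hW : 0 < ∏ i, ‖w i‖ := Finset.prod_pos fun i _ => norm_pos_iff.2 (hw0 i)
  have h4 : Real.exp (-(2 * κ * (4 * m + s))) ≤
      |q.eval t| * Real.exp (2 * √η * (8 * (m * C))) := by
    refine le_of_mul_le_mul_left ?_ hW
    calc _ ≤ _ := h3
      _ = _ := by ring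
  rw [← div_le_iff₀ (Real.exp_pos _), ← Real.exp_sub] at h4
  refine le_trans (Real.exp_le_exp.2 ?_) h4
  have e1 : κ * (4 * m + s) ≤ κ * (5 * d) := mul_le_mul_of_nonneg_left (by linarith) hκ0
  have e2 : √η * (m * C) ≤ √η * (d * C) := by gcongr
  have e3 : 0 ≤ κ * C * d := by positivity
  have e4 : 0 ≤ √η * d := by positivity
  nlinarith

end

section

open Real in
/-- Regularised logarithm of a complex polynomial: sub-mean value property on circles. -/
theorem posLog_le_circleAverage (p : Polynomial ℂ) {ε K : ℝ} (hε : 0 < ε) (hK : 0 < K)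
    (z₀ : ℂ) (r : ℝ) :
    log⁺ ((‖p.eval z₀‖ + ε) / K) ≤
      circleAverage (fun z => log⁺ ((‖p.eval z‖ + ε) / K)) z₀ r := by
  obtain ⟨c, hc1, hc2⟩ : ∃ c : ℂ, ‖c‖ = 1 ∧ ‖p.eval z₀ + ε * c‖ = ‖p.eval z₀‖ + ε := by
    by_cases h : p.eval z₀ = 0
    · exact ⟨1, by simp, by simp [h, abs_of_pos hε]⟩
    · have hn : (‖p.eval z₀‖ : ℂ) ≠ 0 := by exact_mod_cast norm_ne_zero_iff.2 h
      refine ⟨p.eval z₀ / ‖p.eval z₀‖, by simp [h], ?_⟩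
      have : p.eval z₀ + ε * (p.eval z₀ / ‖p.eval z₀‖) =
          ((‖p.eval z₀‖ + ε : ℝ) : ℂ) * (p.eval z₀ / ‖p.eval z₀‖) := by
        push_cast; field_simp
      rw [this, norm_mul]
      have h2 : 0 < ‖p.eval z₀‖ + ε := by positivity
      rw [Complex.norm_real, Real.norm_eq_abs, abs_of_pos h2]
      simp [h]
  set P : Polynomial ℂ := Polynomial.C ((K : ℂ)⁻¹) *
    (p.comp (Polynomial.C z₀ + Polynomial.C (r : ℂ) * Polynomial.X) +
      Polynomial.C ((ε : ℂ) * c)) with hP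
  have hev : ∀ z, P.eval z = (K : ℂ)⁻¹ * (p.eval (z₀ + r * z) + ε * c) := by
    intro z; simp [hP]
  have h0 : ‖P.coeff 0‖ = (‖p.eval z₀‖ + ε) / K := by
    rw [Polynomial.coeff_zero_eq_eval_zero, hev]
    simp only [mul_zero, add_zero, norm_mul, hc2]
    rw [norm_inv, Complex.norm_real, Real.norm_eq_abs, abs_of_pos hK]; field_simp
  have hpos : 0 < (‖p.eval z₀‖ + ε) / K := by positivity
  have hPne : P ≠ 0 := by
    intro h; rw [h] at h0; simp at h0; linarith [h0 ▸ hpos, h0.symm ▸ hpos]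
  have hle := Polynomial.norm_coeff_le_choose_mul_mahlerMeasure 0 P
  simp only [Nat.choose_zero_right, Nat.cast_one, one_mul, h0] at hle
  have hcont : Continuous fun z : ℂ => log⁺ ((‖p.eval z‖ + ε) / K) := by
    exact continuous_posLog.comp (by fun_prop)
  have hmean0 : 0 ≤ circleAverage (fun z => log⁺ ((‖p.eval z‖ + ε) / K)) z₀ r := by
    rw [circleAverage_def]
    refine smul_nonneg (by positivity) (intervalIntegral.integral_nonneg (by positivity) ?_)
    intro _ _; exact posLog_nonneg
  rw [posLog_apply, max_le_iff]
  refine ⟨hmean0, (Real.log_le_log hpos hle).trans ?_⟩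
  rw [← Polynomial.logMahlerMeasure_eq_log_MahlerMeasure, Polynomial.logMahlerMeasure_def,
    circleAverage_def, circleAverage_def]
  refine smul_le_smul_of_nonneg_left ?_ (by positivity)
  refine intervalIntegral.integral_mono (by positivity)
    P.intervalIntegrable_mahlerMeasure ?_ ?_
  · exact (hcont.comp (continuous_circleMap z₀ r)).intervalIntegrable _ _
  · intro θ
    have e : z₀ + r * circleMap 0 1 θ = circleMap z₀ r θ := by simp [circleMap]
    show Real.log ‖P.eval (circleMap 0 1 θ)‖ ≤ _
    rw [hev, e]
    rcases eq_or_ne (p.eval (circleMap z₀ r θ) + ε * c) 0 with h | h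
    · rw [h]; simp [posLog_nonneg]
    · have h1 : Real.log ‖(K:ℂ)⁻¹ * (p.eval (circleMap z₀ r θ) + ε * c)‖ ≤
          Real.log ((‖p.eval (circleMap z₀ r θ)‖ + ε) / K) := by
        apply Real.log_le_log
        · have hK' : (K:ℂ) ≠ 0 := by exact_mod_cast hK.ne'
          exact norm_pos_iff.2 (mul_ne_zero (inv_ne_zero hK') h)
        · rw [norm_mul, norm_inv, Complex.norm_real, Real.norm_eq_abs, abs_of_pos hK,
            inv_mul_eq_div]
          gcongr
          refine (norm_add_le _ _).trans ?_
          simp [hc1, abs_of_pos hε]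
      exact h1.trans (le_max_right _ _)

open Real in
/-- Area version of the sub-mean value property. -/
theorem posLog_le_lintegral_ball (p : Polynomial ℂ) {ε K : ℝ} (hε : 0 < ε) (hK : 0 < K)
    (z₀ : ℂ) {δ : ℝ} (hδ : 0 < δ) :
    ENNReal.ofReal (log⁺ ((‖p.eval z₀‖ + ε) / K)) * ENNReal.ofReal (π * δ ^ 2) ≤
      ∫⁻ z in ball z₀ δ, ENNReal.ofReal (log⁺ ((‖p.eval z‖ + ε) / K)) := by
  set ψ : ℂ → ℝ := fun z => log⁺ ((‖p.eval z‖ + ε) / K) with hψ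
  have hcont : Continuous ψ := continuous_posLog.comp (by fun_prop)
  have hψ0 : ∀ z, 0 ≤ ψ z := fun z => posLog_nonneg
  have hcirc : ∀ r : ℝ, ENNReal.ofReal (ψ z₀) * ENNReal.ofReal (2 * π) ≤
      ∫⁻ θ in Set.Ioo (-π) π, ENNReal.ofReal (ψ (circleMap z₀ r θ)) := by
    intro r
    have h := posLog_le_circleAverage p hε hK z₀ r
    have hc2 : Continuous fun θ => ψ (circleMap z₀ r θ) :=
      hcont.comp (continuous_circleMap z₀ r)
    have hper : (fun θ => ψ (circleMap z₀ r θ)).Periodic (2 * π) := by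
      intro θ; simp only [(periodic_circleMap z₀ r) θ]
    have e : ∫ θ in (0:ℝ)..2 * π, ψ (circleMap z₀ r θ) =
        ∫ θ in (-π)..π, ψ (circleMap z₀ r θ) := by
      have := hper.intervalIntegral_add_eq 0 (-π)
      rw [zero_add] at this
      rw [this]; congr 1; ring
    rw [circleAverage_def, e, smul_eq_mul, inv_mul_eq_div, le_div_iff₀ (by positivity)] at h
    rw [← ENNReal.ofReal_mul (hψ0 _)]
    refine (ENNReal.ofReal_le_ofReal h).trans ?_
    rw [intervalIntegral.integral_of_le (by linarith [pi_pos]), integral_Ioc_eq_integral_Ioo,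
      ofReal_integral_eq_lintegral_ofReal]
    · exact (hc2.intervalIntegrable (-π) π).1.mono_set Set.Ioo_subset_Ioc_self
    · exact Filter.Eventually.of_forall fun _ => hψ0 _
  set F : ℂ → ENNReal := fun z => (ball (0:ℂ) δ).indicator (fun z => ENNReal.ofReal (ψ (z₀ + z))) z
    with hF
  have hFm : Measurable F := by
    apply Measurable.indicator _ measurableSet_ball
    exact (hcont.comp (by fun_prop)).measurable.ennreal_ofReal
  have e1 : ∫⁻ z in ball z₀ δ, ENNReal.ofReal (ψ z) = ∫⁻ z, F z := by
    rw [← lintegral_indicator measurableSet_ball,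
      ← lintegral_add_left_eq_self _ z₀]
    congr 1; ext z
    simp only [hF, Set.indicator, mem_ball, dist_eq_norm, add_sub_cancel_left, sub_zero]
  rw [e1, ← Complex.lintegral_comp_polarCoord_symm, polarCoord_target,
    Measure.volume_eq_prod, ← Measure.prod_restrict, lintegral_prod]
  · have hin : ∀ r ∈ Set.Ioo 0 δ, ENNReal.ofReal (r) *
        (ENNReal.ofReal (ψ z₀) * ENNReal.ofReal (2 * π)) ≤
        ∫⁻ θ in Set.Ioo (-π) π, ENNReal.ofReal r • F (Complex.polarCoord.symm (r, θ)) := by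
      intro r hr
      simp only [smul_eq_mul]
      rw [lintegral_const_mul' _ _ ENNReal.ofReal_ne_top]
      refine mul_le_mul_right ((hcirc r).trans (le_of_eq ?_)) _
      refine lintegral_congr fun θ => ?_
      have e2 : Complex.polarCoord.symm (r, θ) = circleMap 0 r θ := by
        rw [Complex.polarCoord_symm_apply, circleMap, zero_add, Complex.exp_mul_I]
        simp
      rw [e2, hF]
      have : circleMap 0 r θ ∈ ball (0:ℂ) δ := by
        simp [abs_of_pos hr.1, hr.2]
      simp only [Set.indicator_of_mem this]
      simp [circleMap]
    calc _ = ∫⁻ r in Set.Ioo 0 δ, ENNReal.ofReal (r) *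
        (ENNReal.ofReal (ψ z₀) * ENNReal.ofReal (2 * π)) := by
          rw [lintegral_mul_const' _ _ (ENNReal.mul_ne_top ENNReal.ofReal_ne_top
            ENNReal.ofReal_ne_top), ← ofReal_integral_eq_lintegral_ofReal,
            ← integral_Ioc_eq_integral_Ioo, ← intervalIntegral.integral_of_le hδ.le, integral_id,
            mul_left_comm, ← ENNReal.ofReal_mul' (p := (δ ^ 2 - 0 ^ 2) / 2) (by positivity)]
          · congr 2; ring
          · exact (continuous_id.intervalIntegrable 0 δ).1.mono_set Set.Ioo_subset_Ioc_self
          · exact (ae_restrict_iff' measurableSet_Ioo).2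
              (Filter.Eventually.of_forall fun r hr => hr.1.le)
      _ ≤ ∫⁻ r in Set.Ioo 0 δ, ∫⁻ θ in Set.Ioo (-π) π,
          ENNReal.ofReal r • F (Complex.polarCoord.symm (r, θ)) :=
          setLIntegral_mono' measurableSet_Ioo hin
      _ ≤ _ := lintegral_mono_set Set.Ioo_subset_Ioi_self
  · have h1 : Measurable fun p : ℝ × ℝ => Complex.polarCoord.symm p := by
      simp_rw [Complex.polarCoord_symm_apply]; fun_prop
    simp only [smul_eq_mul]
    exact ((measurable_fst.ennreal_ofReal).mul (hFm.comp h1)).aemeasurable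

end

section

theorem log_one_add_le_rpow_div {s α : ℝ} (hs : 0 ≤ s) (hα : 0 < α) (hα1 : α ≤ 1) :
    Real.log (1 + s) ≤ s ^ α / α := by
  have h1 : (1 + s) ^ α ≤ 1 + s ^ α := by
    have := Real.rpow_add_le_add_rpow zero_le_one hs hα.le hα1
    simpa using this
  rw [le_div_iff₀ hα, mul_comm, ← Real.log_rpow (by linarith)]
  have h2 : 0 < (1 + s) ^ α := by positivity
  have := Real.log_le_sub_one_of_pos (h2.trans_le h1)
  linarith [Real.log_le_log h2 h1]

open Real in
theorem posLog_shift_linear_le {α : ℝ} (hα : 0 < α) (hα1 : α ≤ 1) (z ζ : ℂ) {t : ℝ}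
    (ht : t ≠ z.re) :
    log⁺ (‖(t + ζ - z : ℂ)‖ / ‖(t - z : ℂ)‖) ≤ ‖ζ‖ ^ α / α * |t - z.re| ^ (-α) := by
  have hp : 0 < |t - z.re| := abs_pos.2 (sub_ne_zero.2 ht)
  have hle : |t - z.re| ≤ ‖(t - z : ℂ)‖ := by
    simpa using Complex.abs_re_le_norm (t - z : ℂ)
  have h1 : ‖(t + ζ - z : ℂ)‖ / ‖(t - z : ℂ)‖ ≤ 1 + ‖ζ‖ / |t - z.re| := by
    have h2 : ‖(t + ζ - z : ℂ)‖ ≤ ‖(t - z : ℂ)‖ + ‖ζ‖ := by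
      have : (t + ζ - z : ℂ) = (t - z) + ζ := by ring
      rw [this]; exact norm_add_le _ _
    calc _ ≤ (‖(t - z : ℂ)‖ + ‖ζ‖) / ‖(t - z : ℂ)‖ := by gcongr
      _ = 1 + ‖ζ‖ / ‖(t - z : ℂ)‖ := by
        rw [add_div, div_self (hp.trans_le hle).ne']
      _ ≤ _ := by gcongr
  have h3 : (0:ℝ) ≤ ‖ζ‖ / |t - z.re| := by positivity
  calc _ ≤ log⁺ (1 + ‖ζ‖ / |t - z.re|) := posLog_le_posLog (by positivity) h1
    _ = Real.log (1 + ‖ζ‖ / |t - z.re|) := posLog_eq_log (by rw [abs_of_nonneg] <;> linarith)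
    _ ≤ (‖ζ‖ / |t - z.re|) ^ α / α := log_one_add_le_rpow_div h3 hα hα1
    _ = _ := by
      rw [Real.div_rpow (norm_nonneg _) hp.le, Real.rpow_neg hp.le]; field_simp

open Real in
theorem exists_lintegral_posLog_shift_le {α : ℝ} (hα : 0 < α) (hα1 : α < 1) :
    ∃ C : ℝ, 0 < C ∧ ∀ (ε : ℝ) (q : Polynomial ℂ) (ζ : ℂ) (D : ℕ), 0 < ε → q.natDegree ≤ D →
      ∫⁻ t in Set.Icc (-5 : ℝ) 5,
        ENNReal.ofReal (log⁺ ((‖q.eval (t + ζ)‖ + ε) / (‖q.eval (t:ℂ)‖ + ε))) ≤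
        ENNReal.ofReal (C * D * ‖ζ‖ ^ α) := by
  obtain ⟨C, hC, hCb⟩ := exists_lintegral_abs_sub_rpow_le hα hα1
  have hlin : ∀ z ζ : ℂ, ∫⁻ t in Set.Icc (-5 : ℝ) 5,
      ENNReal.ofReal (log⁺ (‖(t + ζ - z : ℂ)‖ / ‖(t - z : ℂ)‖)) ≤
        ENNReal.ofReal (C / α * ‖ζ‖ ^ α) := by
    intro z ζ
    calc _ ≤ ∫⁻ t in Set.Icc (-5 : ℝ) 5, ENNReal.ofReal (‖ζ‖ ^ α / α) *
          ENNReal.ofReal (|t - z.re| ^ (-α)) := by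
          refine lintegral_mono_ae (ae_restrict_of_ae ?_)
          filter_upwards [(Set.countable_singleton z.re).ae_notMem volume] with t ht
          rw [← ENNReal.ofReal_mul (by positivity)]
          exact ENNReal.ofReal_le_ofReal (posLog_shift_linear_le hα hα1.le z ζ ht)
      _ ≤ ENNReal.ofReal (‖ζ‖ ^ α / α) * ENNReal.ofReal C := by
          rw [lintegral_const_mul' _ _ ENNReal.ofReal_ne_top]
          exact mul_le_mul_right (hCb z.re) _
      _ = _ := by
          rw [← ENNReal.ofReal_mul (by positivity)]; congr 1; ring
  have hpoly : ∀ (ζ : ℂ) (D : ℕ) (q : Polynomial ℂ), q.natDegree = D →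
      ∫⁻ t in Set.Icc (-5 : ℝ) 5,
        ENNReal.ofReal (log⁺ (‖q.eval (t + ζ)‖ / ‖q.eval (t:ℂ)‖)) ≤
        ENNReal.ofReal (C / α * D * ‖ζ‖ ^ α) := by
    intro ζ D
    induction D with
    | zero =>
      intro q hq
      rw [Polynomial.eq_C_of_natDegree_eq_zero hq]
      simp only [Polynomial.eval_C]
      have : ∀ x : ℝ, log⁺ (x / x) = 0 := by
        intro x; rcases eq_or_ne x 0 with h | h <;> simp [h]
      simp [this]
    | succ D ih =>
      intro q hq
      obtain ⟨z, hz⟩ := Complex.exists_root (f := q)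
        (Polynomial.natDegree_pos_iff_degree_pos.1 (by omega))
      obtain ⟨q₁, rfl⟩ := Polynomial.dvd_iff_isRoot.2 hz
      have hq0 : (Polynomial.X - Polynomial.C z) * q₁ ≠ 0 := by
        intro h; rw [h] at hq; simp at hq
      have hd : q₁.natDegree = D := by
        rw [Polynomial.natDegree_mul (left_ne_zero_of_mul hq0) (right_ne_zero_of_mul hq0),
          Polynomial.natDegree_X_sub_C] at hq
        omega
      calc _ ≤ ∫⁻ t in Set.Icc (-5 : ℝ) 5,
            (ENNReal.ofReal (log⁺ (‖(t + ζ - z : ℂ)‖ / ‖(t - z : ℂ)‖)) +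
              ENNReal.ofReal (log⁺ (‖q₁.eval (t + ζ)‖ / ‖q₁.eval (t:ℂ)‖))) := by
            refine lintegral_mono fun t => ?_
            refine (ENNReal.ofReal_le_ofReal ?_).trans ENNReal.ofReal_add_le
            simp only [Polynomial.eval_mul, Polynomial.eval_sub, Polynomial.eval_X,
              Polynomial.eval_C, norm_mul]
            rw [mul_div_mul_comm]
            exact posLog_mul
        _ ≤ ENNReal.ofReal (C / α * ‖ζ‖ ^ α) + ENNReal.ofReal (C / α * D * ‖ζ‖ ^ α) := by
            rw [lintegral_add_left]
            · exact add_le_add (hlin z ζ) (ih q₁ hd)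
            · exact (continuous_posLog.measurable.comp (by fun_prop)).ennreal_ofReal
        _ = _ := by
            rw [← ENNReal.ofReal_add (by positivity) (by positivity)]; congr 1; push_cast; ring
  refine ⟨C / α, by positivity, fun ε q ζ D hε hD => ?_⟩
  rcases eq_or_ne q 0 with rfl | hq
  · simp [hε.ne']
  calc _ ≤ ∫⁻ t in Set.Icc (-5 : ℝ) 5,
        ENNReal.ofReal (log⁺ (‖q.eval (t + ζ)‖ / ‖q.eval (t:ℂ)‖)) := by
        refine lintegral_mono_ae (ae_restrict_of_ae ?_)
        have hfin : {t : ℝ | q.eval (t:ℂ) = 0}.Finite := by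
          refine Set.Finite.of_finite_image (f := fun t : ℝ => (t:ℂ)) ?_
            Complex.ofReal_injective.injOn
          refine (q.roots.toFinset.finite_toSet).subset ?_
          rintro _ ⟨t, ht, rfl⟩
          simp [hq]; exact ht
        filter_upwards [hfin.countable.ae_notMem volume] with t ht
        have hb : 0 < ‖q.eval (t:ℂ)‖ := norm_pos_iff.2 ht
        refine ENNReal.ofReal_le_ofReal ?_
        have ha : 0 ≤ ‖q.eval (t + ζ)‖ := norm_nonneg _
        revert ha hb
        generalize ‖q.eval (t + ζ)‖ = a
        generalize ‖q.eval (t:ℂ)‖ = b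
        intro hb ha
        rw [posLog_eq_log_max_one (by positivity), posLog_eq_log_max_one (by positivity)]
        apply Real.log_le_log (by positivity)
        refine max_le (le_max_left _ _) ?_
        rw [div_le_iff₀ (by positivity)]
        have h1 : a ≤ max 1 (a / b) * b := by
          rw [← div_le_iff₀ hb]; exact le_max_right _ _
        have h2 : ε ≤ max 1 (a / b) * ε := le_mul_of_one_le_left hε.le (le_max_left _ _)
        linarith
    _ ≤ ENNReal.ofReal (C / α * q.natDegree * ‖ζ‖ ^ α) := hpoly ζ _ q rfl
    _ ≤ _ := by
        apply ENNReal.ofReal_le_ofReal; gcongr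

end

section

/-- Restriction of a multivariate polynomial to a coordinate line through `w`. -/
def coordRestrict {n : ℕ} (P : MvPolynomial (Fin n) ℂ) (w : Fin n → ℂ) (i : Fin n) :
    Polynomial ℂ :=
  MvPolynomial.aeval (Function.update (fun j => Polynomial.C (w j)) i Polynomial.X) P

theorem eval_coordRestrict {n : ℕ} (P : MvPolynomial (Fin n) ℂ) (w : Fin n → ℂ) (i : Fin n)
    (z : ℂ) : (coordRestrict P w i).eval z = MvPolynomial.eval (Function.update w i z) P := by
  have h := MvPolynomial.comp_aeval_apply (R := ℂ)
    (f := Function.update (fun j => Polynomial.C (w j)) i Polynomial.X)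
    (φ := Polynomial.aeval (R := ℂ) z) P
  rw [coordRestrict, ← Polynomial.coe_aeval_eq_eval]
  simp only [Polynomial.coe_aeval_eq_eval] at h ⊢
  rw [← Polynomial.coe_aeval_eq_eval]
  refine h.trans ?_
  rw [MvPolynomial.aeval_eq_eval]
  congr 2
  ext j
  by_cases hj : j = i
  · subst hj; simp
  · simp [hj]

theorem natDegree_coordRestrict_le {n : ℕ} {P : MvPolynomial (Fin n) ℂ} {D : ℕ}
    (hD : P.totalDegree ≤ D) (w : Fin n → ℂ) (i : Fin n) :
    (coordRestrict P w i).natDegree ≤ D := by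
  have := MvPolynomial.aeval_natDegree_le (n := 1) P hD
    (Function.update (fun j => Polynomial.C (w j)) i Polynomial.X) (by
      intro j
      by_cases hj : j = i
      · subst hj; simp
      · simp [hj])
  simpa [coordRestrict] using this

/-- Normalised area measure on the disc of radius `2δ`. -/
def discMeasure (δ : ℝ) : Measure ℂ :=
  (Real.toNNReal (Real.pi * δ ^ 2)⁻¹) • volume.restrict (ball (0 : ℂ) (2 * δ))

instance (δ : ℝ) : IsFiniteMeasure (discMeasure δ) := by
  have : IsFiniteMeasure (volume.restrict (ball (0 : ℂ) (2 * δ))) :=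
    ⟨by rw [Measure.restrict_apply_univ]; exact measure_ball_lt_top⟩
  unfold discMeasure; infer_instance

theorem discMeasure_univ {δ : ℝ} (hδ : 0 < δ) : discMeasure δ Set.univ = 4 := by
  rw [discMeasure, Measure.smul_apply, Measure.restrict_apply_univ, Complex.volume_ball,
    ENNReal.smul_def, smul_eq_mul]
  have h4 : (4 : ENNReal) = ENNReal.ofReal 4 := by simp
  have hpi : ((NNReal.pi : NNReal) : ENNReal) = ENNReal.ofReal Real.pi := by
    rw [ENNReal.ofReal, ← NNReal.coe_real_pi, Real.toNNReal_coe]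
  rw [hpi, ← ENNReal.ofReal_pow (by positivity), ← ENNReal.ofReal_mul (by positivity)]
  show ENNReal.ofReal _ * _ = _
  rw [← ENNReal.ofReal_mul (by positivity), h4]
  congr 1
  have := Real.pi_pos
  field_simp; ring

theorem discMeasure_ae {δ : ℝ} : ∀ᵐ z ∂(discMeasure δ), ‖z‖ ≤ 2 * δ := by
  have h : ∀ᵐ z ∂(volume.restrict (ball (0 : ℂ) (2 * δ))), ‖z‖ ≤ 2 * δ := by
    filter_upwards [ae_restrict_mem measurableSet_ball] with z hz
    simpa using (mem_ball_zero_iff.1 hz).le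
  exact Measure.ae_smul_measure h _

open Real in
theorem posLog_le_lintegral_discMeasure (p : Polynomial ℂ) {ε K δ : ℝ} (hε : 0 < ε) (hK : 0 < K)
    (hδ : 0 < δ) {z₀ : ℂ} (hz : ‖z₀‖ ≤ δ) :
    ENNReal.ofReal (log⁺ ((‖p.eval z₀‖ + ε) / K)) ≤
      ∫⁻ z, ENNReal.ofReal (log⁺ ((‖p.eval z‖ + ε) / K)) ∂(discMeasure δ) := by
  have h := posLog_le_lintegral_ball p hε hK z₀ hδ
  have hpos : 0 < π * δ ^ 2 := by positivity
  rw [discMeasure, lintegral_smul_measure, ENNReal.smul_def, smul_eq_mul]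
  have hsub : ball z₀ δ ⊆ ball (0:ℂ) (2 * δ) := by
    intro z hz'
    rw [mem_ball, dist_eq_norm] at hz'
    rw [mem_ball_zero_iff]
    have : ‖z‖ ≤ ‖z - z₀‖ + ‖z₀‖ := by simpa using norm_add_le (z - z₀) z₀
    linarith
  have h2 := h.trans (lintegral_mono_set hsub)
  have hc : ((Real.toNNReal (π * δ ^ 2)⁻¹ : NNReal) : ENNReal) = (ENNReal.ofReal (π * δ ^ 2))⁻¹ :=
    by rw [← ENNReal.ofReal_inv_of_pos hpos]; rfl
  rw [hc, mul_comm, ← div_eq_mul_inv, ENNReal.le_div_iff_mul_le]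
  · exact h2
  · left; simpa using hpos
  · left; exact ENNReal.ofReal_ne_top

open Real in
theorem measurable_posLog_eval {n : ℕ} (P : MvPolynomial (Fin n) ℂ) (ε K : ℝ) :
    Measurable fun w : Fin n → ℂ =>
      ENNReal.ofReal (log⁺ ((‖MvPolynomial.eval w P‖ + ε) / K)) := by
  have : Continuous fun w : Fin n → ℂ => MvPolynomial.eval w P := MvPolynomial.continuous_eval P
  exact (continuous_posLog.comp (by fun_prop)).measurable.ennreal_ofReal

open Real in
theorem posLog_le_lintegral_pi {n : ℕ} (P : MvPolynomial (Fin n) ℂ) {ε K δ : ℝ} (hε : 0 < ε)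
    (hK : 0 < K) (hδ : 0 < δ) {y : Fin n → ℂ} (hy : ∀ i, ‖y i‖ ≤ δ) :
    ENNReal.ofReal (log⁺ ((‖MvPolynomial.eval y P‖ + ε) / K)) ≤
      ∫⁻ w, ENNReal.ofReal (log⁺ ((‖MvPolynomial.eval w P‖ + ε) / K))
        ∂(Measure.pi fun _ => discMeasure δ) := by
  set φ : (Fin n → ℂ) → ENNReal := fun w =>
    ENNReal.ofReal (log⁺ ((‖MvPolynomial.eval w P‖ + ε) / K)) with hφ
  have hm : Measurable φ := measurable_posLog_eval P ε K
  have key : ∀ s : Finset (Fin n), φ y ≤ (∫⋯∫⁻_s, φ ∂fun _ => discMeasure δ) y := by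
    intro s
    induction s using Finset.induction_on with
    | empty => simp
    | insert i s hi ih =>
      rw [lmarginal_insert' _ hm hi]
      refine ih.trans ?_
      unfold lmarginal
      refine lintegral_mono fun z => ?_
      set w := Function.updateFinset y s z with hw
      have hwi : w i = y i := by simp [hw, Function.updateFinset, hi]
      have h := posLog_le_lintegral_discMeasure (coordRestrict P w i) hε hK hδ (hy i)
      simp only [eval_coordRestrict] at h
      rw [← hwi, Function.update_eq_self] at h
      exact h
  have := key Finset.univ
  rwa [lmarginal_univ] at this

end

section

open Real in
theorem exists_lintegral_posLog_shift_coord_le (n : ℕ) {α : ℝ} (hα : 0 < α) (hα1 : α < 1) :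
    ∃ C : ℝ, 0 < C ∧ ∀ (P : MvPolynomial (Fin n) ℂ) (D : ℕ) (ε δ : ℝ) (w : Fin n → ℂ),
      P.totalDegree ≤ D → 0 < ε → 0 ≤ δ → (∀ i, ‖w i‖ ≤ δ) →
      ∫⁻ x in Set.Icc (fun _ => (-5 : ℝ)) (fun _ : Fin n => 5),
        ENNReal.ofReal (log⁺ ((‖MvPolynomial.eval (fun i => (x i : ℂ) + w i) P‖ + ε) /
          (‖MvPolynomial.eval (fun i => (x i : ℂ)) P‖ + ε))) ≤
        ENNReal.ofReal (C * D * δ ^ α) := by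
  obtain ⟨C, hC, hCb⟩ := exists_lintegral_posLog_shift_le hα hα1
  refine ⟨(n + 1) * 10 ^ n * C, by positivity, fun P D ε δ w hP hε hδ hw => ?_⟩
  set μ : Fin n → Measure ℝ := fun _ => volume.restrict (Set.Icc (-5 : ℝ) 5) with hμ
  have hbox : volume.restrict (Set.Icc (fun _ => (-5 : ℝ)) (fun _ : Fin n => 5)) =
      Measure.pi μ := by
    rw [← Set.pi_univ_Icc, volume_pi, Measure.restrict_pi_pi]
  rw [hbox]
  have hcomp : ∀ v : Fin n → ℂ,
      Continuous fun x : Fin n → ℝ => MvPolynomial.eval (fun i => (x i : ℂ) + v i) P :=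
    fun v => (MvPolynomial.continuous_eval P).comp (by fun_prop)
  have hmeas : ∀ v v' : Fin n → ℂ, Measurable fun x : Fin n → ℝ =>
      ENNReal.ofReal (log⁺ ((‖MvPolynomial.eval (fun i => (x i : ℂ) + v i) P‖ + ε) /
          (‖MvPolynomial.eval (fun i => (x i : ℂ) + v' i) P‖ + ε))) := by
    intro v v'
    have h1 := hcomp v
    have h2 := hcomp v'
    have h3 : ∀ x : Fin n → ℝ, ‖MvPolynomial.eval (fun i => (x i : ℂ) + v' i) P‖ + ε ≠ 0 :=
      fun x => by positivity
    exact (continuous_posLog.comp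
      (Continuous.div (by fun_prop) (by fun_prop) h3)).measurable.ennreal_ofReal
  -- a single coordinate shift
  have hone : ∀ (v : Fin n → ℂ) (i : Fin n), v i = 0 →
      ∫⁻ x, ENNReal.ofReal (log⁺
        ((‖MvPolynomial.eval (fun j => (x j : ℂ) + Function.update v i (w i) j) P‖ + ε) /
          (‖MvPolynomial.eval (fun j => (x j : ℂ) + v j) P‖ + ε))) ∂(Measure.pi μ) ≤
        ENNReal.ofReal (10 ^ n * C * D * δ ^ α) := by
    intro v i hvi
    rw [lintegral_eq_lmarginal_univ (0 : Fin n → ℝ),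
      lmarginal_erase' _ (hmeas _ _) (Finset.mem_univ i)]
    have hb : ∀ x : Fin n → ℝ, ∫⁻ t, ENNReal.ofReal (log⁺
        ((‖MvPolynomial.eval (fun j => ((Function.update x i t) j : ℂ) +
            Function.update v i (w i) j) P‖ + ε) /
          (‖MvPolynomial.eval (fun j => ((Function.update x i t) j : ℂ) + v j) P‖ + ε))) ∂(μ i) ≤
        ENNReal.ofReal (C * D * δ ^ α) := by
      intro x
      refine le_trans (le_of_eq ?_)
        ((hCb ε (coordRestrict P (fun j => (x j : ℂ) + v j) i) (w i) D hε
        (natDegree_coordRestrict_le hP _ _)).trans ?_)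
      · refine lintegral_congr fun t => ?_
        simp only [eval_coordRestrict]
        have e1 : (fun j => ((Function.update x i t) j : ℂ) + Function.update v i (w i) j) =
            Function.update (fun j => (x j : ℂ) + v j) i (t + w i) := by
          ext j
          by_cases hj : j = i
          · subst hj; simp
          · simp [hj]
        have e2 : (fun j => ((Function.update x i t) j : ℂ) + v j) =
            Function.update (fun j => (x j : ℂ) + v j) i t := by
          ext j
          by_cases hj : j = i
          · subst hj; simp [hvi]
          · simp [hj]
        rw [e1, e2]
      · apply ENNReal.ofReal_le_ofReal
        have := hw i
        gcongr
    refine (lmarginal_mono (fun x => hb x) _).trans ?_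
    unfold lmarginal
    rw [lintegral_const, Measure.pi_univ]
    simp only [hμ, Measure.restrict_apply_univ, Real.volume_Icc, Finset.prod_const]
    have h10 : ENNReal.ofReal (5 - -5) = 10 := by norm_num
    rw [h10]
    calc _ ≤ ENNReal.ofReal (C * D * δ ^ α) * 10 ^ n := by
          refine mul_le_mul_right (pow_le_pow_right₀ (by norm_num) ?_) _
          simp
      _ = _ := by
          rw [← h10, ← ENNReal.ofReal_pow (by norm_num), ← ENNReal.ofReal_mul (by positivity)]
          congr 1; norm_num; ring
  -- telescoping over the coordinates
  have key : ∀ s : Finset (Fin n),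
      ∫⁻ x, ENNReal.ofReal (log⁺
        ((‖MvPolynomial.eval (fun j => (x j : ℂ) + if j ∈ s then w j else 0) P‖ + ε) /
          (‖MvPolynomial.eval (fun j => (x j : ℂ) + 0) P‖ + ε))) ∂(Measure.pi μ) ≤
        s.card * ENNReal.ofReal (10 ^ n * C * D * δ ^ α) := by
    intro s
    induction s using Finset.induction_on with
    | empty =>
      have : ∀ x : Fin n → ℝ, ‖MvPolynomial.eval (fun j => (x j : ℂ)) P‖ + ε ≠ 0 :=
        fun x => by positivity
      simp [this]
    | insert i s hi ih =>
      set v : Fin n → ℂ := fun j => if j ∈ s then w j else 0 with hv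
      have e1 : (fun j => if j ∈ insert i s then w j else 0) = Function.update v i (w i) := by
        ext j
        by_cases hj : j = i
        · subst hj; simp
        · simp [hj, hv]
      have e1' : ∀ j, (if j ∈ insert i s then w j else 0) = Function.update v i (w i) j :=
        fun j => congrFun e1 j
      simp only [e1']
      have hvi : v i = 0 := by simp [hv, hi]
      rw [Finset.card_insert_of_notMem hi]
      push_cast
      rw [add_mul, one_mul]
      refine le_trans ?_ (add_le_add ih (hone v i hvi))
      rw [← lintegral_add_left (hmeas v (fun _ => 0))]
      refine lintegral_mono fun x => ?_
      refine (ENNReal.ofReal_le_ofReal ?_).trans ENNReal.ofReal_add_le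
      have hb1 : 0 < ‖MvPolynomial.eval (fun j => (x j : ℂ) + v j) P‖ + ε := by positivity
      refine le_trans (le_of_eq ?_) posLog_mul
      congr 1
      field_simp
  have h := key Finset.univ
  simp only [Finset.mem_univ, if_true, add_zero, Finset.card_univ, Fintype.card_fin] at h
  refine h.trans ?_
  rw [← ENNReal.ofReal_natCast, ← ENNReal.ofReal_mul (by positivity)]
  apply ENNReal.ofReal_le_ofReal
  have h0 : 0 ≤ 10 ^ n * C * D * δ ^ α := by positivity
  nlinarith

open Real in
/-- Outside a small exceptional set, a polynomial satisfies a doubling estimate at scale `δ`. -/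
theorem exists_doubling_estimate (n : ℕ) {α : ℝ} (hα : 0 < α) (hα1 : α < 1) :
    ∃ C : ℝ, 0 < C ∧ ∀ (P : MvPolynomial (Fin n) ℝ) (D : ℕ) (ε δ l : ℝ),
      P.totalDegree ≤ D → 0 < ε → 0 < δ → 0 < l →
      ∃ B : Set (Fin n → ℝ), MeasurableSet B ∧
        volume (B ∩ Set.Icc (fun _ => (-5 : ℝ)) (fun _ : Fin n => 5)) ≤
          ENNReal.ofReal (C * D * δ ^ α / l) ∧
        ∀ x ∉ B, ∀ y : Fin n → ℝ, (∀ i, |y i| ≤ δ) →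
          |MvPolynomial.eval (x + y) P| + ε ≤ exp l * (|MvPolynomial.eval x P| + ε) := by
  obtain ⟨C, hC, hCb⟩ := exists_lintegral_posLog_shift_coord_le n hα hα1
  refine ⟨4 ^ n * C * 2 ^ α, by positivity, fun P D ε δ l hP hε hδ hl => ?_⟩
  set Pc : MvPolynomial (Fin n) ℂ := MvPolynomial.map (algebraMap ℝ ℂ) P with hPc
  have hPcd : Pc.totalDegree ≤ D := (Finset.sup_mono (MvPolynomial.support_map_subset _ _)).trans hP
  have hreal : ∀ x : Fin n → ℝ, ‖MvPolynomial.eval (fun i => (x i : ℂ)) Pc‖ =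
      |MvPolynomial.eval x P| := by
    intro x
    rw [hPc, MvPolynomial.eval_map]
    have h := MvPolynomial.eval₂_comp (algebraMap ℝ ℂ) x P
    have h2 : (algebraMap ℝ ℂ ∘ x) = fun i => (x i : ℂ) := rfl
    rw [h2] at h
    rw [← h]
    simp only [Complex.coe_algebraMap, Complex.norm_real, Real.norm_eq_abs]
  set ν : Measure (Fin n → ℂ) := Measure.pi fun _ => discMeasure δ with hν
  set φ : (Fin n → ℝ) × (Fin n → ℂ) → ENNReal := fun p =>
    ENNReal.ofReal (log⁺ ((‖MvPolynomial.eval (fun i => (p.1 i : ℂ) + p.2 i) Pc‖ + ε) /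
      (‖MvPolynomial.eval (fun i => (p.1 i : ℂ)) Pc‖ + ε))) with hφ
  have hφm : Measurable φ := by
    have h1 : Continuous fun p : (Fin n → ℝ) × (Fin n → ℂ) =>
        MvPolynomial.eval (fun i => (p.1 i : ℂ) + p.2 i) Pc :=
      (MvPolynomial.continuous_eval Pc).comp (by fun_prop)
    have h2 : Continuous fun p : (Fin n → ℝ) × (Fin n → ℂ) =>
        MvPolynomial.eval (fun i => (p.1 i : ℂ)) Pc :=
      (MvPolynomial.continuous_eval Pc).comp (by fun_prop)
    have h3 : ∀ p : (Fin n → ℝ) × (Fin n → ℂ),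
        ‖MvPolynomial.eval (fun i => (p.1 i : ℂ)) Pc‖ + ε ≠ 0 := fun x => by positivity
    exact (continuous_posLog.comp
      (Continuous.div (by fun_prop) (by fun_prop) h3)).measurable.ennreal_ofReal
  set G : (Fin n → ℝ) → ENNReal := fun x => ∫⁻ w, φ (x, w) ∂ν with hG
  have hGm : Measurable G := hφm.lintegral_prod_right'
  refine ⟨{x | ENNReal.ofReal l ≤ G x}, measurableSet_le measurable_const hGm, ?_, ?_⟩
  · have hwae : ∀ᵐ w ∂ν, ∀ i, ‖w i‖ ≤ 2 * δ := by
      rw [Filter.eventually_all]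
      intro i
      exact (Measure.tendsto_eval_ae_ae (μ := fun _ : Fin n => discMeasure δ) (i := i)).eventually
        (discMeasure_ae (δ := δ))
    have h_lint : ∫⁻ x in Set.Icc (fun _ => (-5 : ℝ)) (fun _ : Fin n => 5), G x ≤
        ENNReal.ofReal (4 ^ n * C * 2 ^ α * D * δ ^ α) := by
      simp only [hG]
      rw [lintegral_lintegral_swap hφm.aemeasurable]
      calc _ ≤ ∫⁻ w, ENNReal.ofReal (C * D * (2 * δ) ^ α) ∂ν := by
            refine lintegral_mono_ae ?_
            filter_upwards [hwae] with w hw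
            exact hCb Pc D ε (2 * δ) w hPcd hε (by positivity) hw
        _ = _ := by
            rw [lintegral_const, hν, Measure.pi_univ]
            simp only [discMeasure_univ hδ, Finset.prod_const, Finset.card_univ, Fintype.card_fin]
            have h4 : (4 : ENNReal) = ENNReal.ofReal 4 := by simp
            rw [h4, ← ENNReal.ofReal_pow (by positivity), ← ENNReal.ofReal_mul (by positivity),
              Real.mul_rpow (by positivity) hδ.le]
            congr 1; ring
    rw [← Measure.restrict_apply (measurableSet_le measurable_const hGm)]
    have hl' : ENNReal.ofReal l ≠ 0 := by simpa using hl
    refine (meas_ge_le_lintegral_div hGm.aemeasurable hl' ENNReal.ofReal_ne_top).trans ?_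
    rw [ENNReal.ofReal_div_of_pos hl]
    exact ENNReal.div_le_div_right h_lint _
  · intro x hx y hy
    rw [Set.mem_ofPred_eq, not_le] at hx
    set Px : MvPolynomial (Fin n) ℂ :=
      MvPolynomial.bind₁ (fun i => MvPolynomial.C (x i : ℂ) + MvPolynomial.X i) Pc with hPx
    have hev : ∀ w : Fin n → ℂ, MvPolynomial.eval w Px =
        MvPolynomial.eval (fun i => (x i : ℂ) + w i) Pc := by
      intro w
      rw [hPx, ← MvPolynomial.coe_aeval_eq_eval, RingHom.coe_coe, MvPolynomial.aeval_bind₁]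
      rw [← MvPolynomial.aeval_eq_eval]; simp
    have hK : 0 < ‖MvPolynomial.eval (fun i => (x i : ℂ)) Pc‖ + ε := by positivity
    have h := posLog_le_lintegral_pi Px hε hK hδ (y := fun i => (y i : ℂ)) (by simpa using hy)
    simp only [hev] at h
    have h2 := h.trans_lt hx
    have h3 := (ENNReal.ofReal_lt_ofReal_iff hl).1 h2
    have e : (fun i => (x i : ℂ) + (y i : ℂ)) = fun i => (((x + y) i : ℝ) : ℂ) := by
      ext i; simp
    rw [e, hreal, hreal] at h3
    rw [hreal] at hK
    have h4 : 0 < |MvPolynomial.eval (x + y) P| + ε := by positivity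
    have h5 := (le_max_right 0 (Real.log _)).trans_lt h3
    rw [Real.log_lt_iff_lt_exp (by positivity), div_lt_iff₀ hK] at h5
    exact h5.le

end

section

variable {n : ℕ}

/-- The set of centres of balls of radius `δ` with large `ν`-measure is small. -/
theorem exists_set_measure_closedBall_lt (ν : Measure (EuclideanSpace ℝ (Fin n)))
    [IsFiniteMeasure ν] (δ : ℝ) {β : ENNReal} (hβ : β ≠ 0) (hβ' : β ≠ ⊤) :
    ∃ B : Set (EuclideanSpace ℝ (Fin n)), MeasurableSet B ∧
      volume B ≤ volume (closedBall (0 : EuclideanSpace ℝ (Fin n)) δ) * ν Set.univ / β ∧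
      ∀ x ∉ B, ν (closedBall x δ) < β := by
  have hS : MeasurableSet {p : EuclideanSpace ℝ (Fin n) × EuclideanSpace ℝ (Fin n) |
      dist p.2 p.1 ≤ δ} := measurableSet_le (by fun_prop) measurable_const
  have hm : Measurable fun x : EuclideanSpace ℝ (Fin n) => ν (closedBall x δ) :=
    measurable_measure_prodMk_left hS
  refine ⟨{x | β ≤ ν (closedBall x δ)}, measurableSet_le measurable_const hm, ?_, ?_⟩
  · refine (meas_ge_le_lintegral_div hm.aemeasurable hβ hβ').trans ?_
    refine ENNReal.div_le_div_right ?_ _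
    have h1 := Measure.prod_apply (μ := volume) (ν := ν) hS
    have h2 := Measure.prod_apply_symm (μ := volume) (ν := ν) hS
    have h3 : ∫⁻ x, ν (closedBall x δ) = ∫⁻ y, volume (closedBall y δ) ∂ν := by
      refine (h1.symm.trans h2).trans ?_
      refine lintegral_congr fun y => ?_
      congr 1; ext x
      simp [dist_comm]
    rw [h3]
    simp [Measure.addHaar_closedBall_center]
  · intro x hx
    rw [Set.mem_ofPred_eq, not_le] at hx
    exact hx

/-- Most lines through the origin meet a small set in a small set. -/
theorem exists_line_volume_le {B : Set (EuclideanSpace ℝ (Fin n))} (hB : MeasurableSet B)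
    {τ : ℝ} (hτ : 0 < τ) (v₀ : EuclideanSpace ℝ (Fin n)) :
    ∃ v ∈ closedBall v₀ (1 / 2),
      volume {t ∈ Set.Icc (-1 : ℝ) 2 | τ ≤ |t| ∧ t • v ∈ B} ≤
        3 * ENNReal.ofReal ((τ ^ n)⁻¹) * volume B / volume (closedBall v₀ (1 / 2)) := by
  set V := closedBall v₀ (1 / 2 : ℝ) with hV
  have hV0 : volume V ≠ 0 := (measure_closedBall_pos volume v₀ (by norm_num)).ne'
  have hVt : volume V ≠ ⊤ := measure_closedBall_lt_top.ne
  set T : Set ℝ := Set.Icc (-1 : ℝ) 2 ∩ {t | τ ≤ |t|} with hT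
  have hTm : MeasurableSet T :=
    measurableSet_Icc.inter (measurableSet_le measurable_const (by fun_prop))
  have hS : MeasurableSet {p : EuclideanSpace ℝ (Fin n) × ℝ | p.2 • p.1 ∈ B} := by
    have : Measurable fun p : EuclideanSpace ℝ (Fin n) × ℝ => p.2 • p.1 := by fun_prop
    exact this hB
  set f : EuclideanSpace ℝ (Fin n) → ENNReal := fun v => (volume.restrict T) {t | t • v ∈ B}
  have hfm : Measurable f := measurable_measure_prodMk_left hS
  obtain ⟨v, hv, hvle⟩ := exists_le_setLAverage hV0 hVt hfm.aemeasurable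
  refine ⟨v, hv, ?_⟩
  have e : {t ∈ Set.Icc (-1 : ℝ) 2 | τ ≤ |t| ∧ t • v ∈ B} = {t | t • v ∈ B} ∩ T := by
    ext t; simp only [hT, Set.mem_inter_iff, Set.mem_ofPred_eq]; tauto
  rw [e, ← Measure.restrict_apply' hTm]
  refine hvle.trans ?_
  rw [setLAverage_eq]
  refine ENNReal.div_le_div_right ?_ _
  have h1 := Measure.prod_apply (μ := volume.restrict V) (ν := volume.restrict T) hS
  have h2 := Measure.prod_apply_symm (μ := volume.restrict V) (ν := volume.restrict T) hS
  calc ∫⁻ v in V, f v = ∫⁻ t in T, (volume.restrict V) {v | t • v ∈ B} := h1.symm.trans h2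
    _ ≤ ∫⁻ t in T, ENNReal.ofReal ((τ ^ n)⁻¹) * volume B := by
        refine setLIntegral_mono' hTm fun t ht => ?_
        refine (Measure.restrict_apply_le _ _).trans ?_
        have ht0 : t ≠ 0 := by
          rintro rfl
          have := ht.2
          simp at this; linarith
        have := Measure.addHaar_preimage_smul (volume : Measure (EuclideanSpace ℝ (Fin n))) ht0 B
        refine (le_of_eq this).trans ?_
        rw [finrank_euclideanSpace_fin]
        refine mul_le_mul_left (ENNReal.ofReal_le_ofReal ?_) _
        rw [abs_inv, abs_pow]
        have := ht.2
        rw [Set.mem_ofPred_eq] at this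
        gcongr
    _ ≤ _ := by
        rw [lintegral_const, Measure.restrict_apply_univ, mul_comm, mul_assoc]
        refine mul_le_mul_left ?_ _
        refine (measure_mono Set.inter_subset_left).trans ?_
        rw [Real.volume_Icc]; norm_num

end

section

variable {n : ℕ}

theorem exists_exceptional_set (hn : 2 ≤ n) {c A₀ S m : ℝ} (hc : 0 < c) (hA₀ : 0 < A₀)
    (hS : 0 < S) (hm : 0 < m) :
    ∀ᶠ N : ℝ in Filter.atTop, 0 < A₀ / N ∧ A₀ / N ≤ 1 ∧ ∀ (P : MvPolynomial (Fin n) ℝ) (ε : ℝ)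
      (ν : Measure (EuclideanSpace ℝ (Fin n))), (P.totalDegree : ℝ) ≤ S * N → 0 < ε →
      ν Set.univ ≤ ENNReal.ofReal (N ^ (1 / 4 : ℝ)) →
      ∃ B : Set (EuclideanSpace ℝ (Fin n)), MeasurableSet B ∧
        volume (B ∩ closedBall 0 5) ≤ ENNReal.ofReal m ∧ ∃ l : ℝ, 0 ≤ l ∧ ∀ x ∉ B,
          ν (closedBall x (A₀ / N)) < ENNReal.ofReal ((c * (A₀ / N) / (l + 2)) ^ (n - 1)) ∧
          ∀ y : Fin n → ℝ, (∀ i, |y i| ≤ A₀ / N) →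
            |MvPolynomial.eval ((fun i => x i) + y) P| + ε ≤
              Real.exp l * (|MvPolynomial.eval (fun i => x i) P| + ε) := by
  have hn0 : (0:ℝ) < n := by positivity
  have hn2 : (2:ℝ) ≤ n := by exact_mod_cast hn
  set θ : ℝ := 1 / (4 * n) with hθ
  have hθ0 : 0 < θ := by positivity
  have hθ1 : θ ≤ 1 / 8 := by
    rw [hθ]; apply one_div_le_one_div_of_le <;> linarith
  have hθn : θ * (n - 1) ≤ 1 / 4 := by
    have : θ * n = 1 / 4 := by rw [hθ]; field_simp
    nlinarith
  obtain ⟨C, hC, hdoub⟩ := exists_doubling_estimate n (α := 1 - θ / 2) (by linarith) (by linarith)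
  set ω : ℝ := (volume (ball (0 : EuclideanSpace ℝ (Fin n)) 1)).toReal with hω
  have hω0 : 0 ≤ ω := ENNReal.toReal_nonneg
  have hωe : volume (ball (0 : EuclideanSpace ℝ (Fin n)) 1) = ENNReal.ofReal ω := by
    rw [hω, ENNReal.ofReal_toReal measure_ball_lt_top.ne]
  have lim1 : Filter.Tendsto (fun N : ℝ => C * S * A₀ ^ (1 - θ / 2) * N ^ (-(θ / 2)))
      Filter.atTop (nhds 0) := by
    simpa using (tendsto_rpow_neg_atTop (half_pos hθ0)).const_mul (C * S * A₀ ^ (1 - θ / 2))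
  have lim2 : Filter.Tendsto (fun N : ℝ => ω * A₀ * (3 / c) ^ (n - 1) * N ^ (-(1 / 2 : ℝ)))
      Filter.atTop (nhds 0) := by
    simpa using (tendsto_rpow_neg_atTop (show (0:ℝ) < 1 / 2 by norm_num)).const_mul
      (ω * A₀ * (3 / c) ^ (n - 1))
  filter_upwards [lim1.eventually (gt_mem_nhds (half_pos hm)),
    lim2.eventually (gt_mem_nhds (half_pos hm)), Filter.eventually_ge_atTop 1,
    Filter.eventually_ge_atTop A₀] with N h1 h2 hN1 hNA
  have hN0 : 0 < N := by linarith
  set δ := A₀ / N with hδ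
  have hδ0 : 0 < δ := by positivity
  refine ⟨hδ0, by rw [hδ, div_le_one hN0]; exact hNA, fun P ε ν hP hε hν => ?_⟩
  set l := N ^ θ with hl
  have hl1 : 1 ≤ l := Real.one_le_rpow hN1 hθ0.le
  have hl0 : 0 < l := by linarith
  have : IsFiniteMeasure ν := ⟨hν.trans_lt ENNReal.ofReal_lt_top⟩
  have hβ : 0 < (c * δ / (l + 2)) ^ (n - 1) := by positivity
  obtain ⟨B₁, hB₁m, hB₁v, hB₁⟩ := exists_set_measure_closedBall_lt ν δ
    (β := ENNReal.ofReal ((c * δ / (l + 2)) ^ (n - 1))) (by simpa using hβ) ENNReal.ofReal_ne_top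
  obtain ⟨B₂, hB₂m, hB₂v, hB₂⟩ := hdoub P P.totalDegree ε δ l le_rfl hε hδ0 hl0
  have hmp := EuclideanSpace.volume_preserving_symm_measurableEquiv_toLp (Fin n)
  set π := (MeasurableEquiv.toLp 2 (Fin n → ℝ)).symm with hπ
  have hπx : ∀ x : EuclideanSpace ℝ (Fin n), π x = fun i => x i := fun x => rfl
  refine ⟨B₁ ∪ π ⁻¹' B₂, hB₁m.union (π.measurable hB₂m), ?_, l, hl0.le, fun x hx => ⟨?_, ?_⟩⟩
  · have e1 : volume B₁ ≤ ENNReal.ofReal (m / 2) := by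
      refine hB₁v.trans ?_
      rw [Measure.addHaar_closedBall _ _ hδ0.le, finrank_euclideanSpace_fin, hωe,
        ← ENNReal.ofReal_mul (by positivity)]
      calc _ ≤ ENNReal.ofReal (δ ^ n * ω) * ENNReal.ofReal (N ^ (1 / 4 : ℝ)) /
            ENNReal.ofReal ((c * δ / (l + 2)) ^ (n - 1)) := by gcongr
        _ = ENNReal.ofReal (δ ^ n * ω * N ^ (1 / 4 : ℝ) / (c * δ / (l + 2)) ^ (n - 1)) := by
          rw [← ENNReal.ofReal_mul (by positivity), ← ENNReal.ofReal_div_of_pos hβ]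
        _ ≤ _ := by
          apply ENNReal.ofReal_le_ofReal
          refine le_trans ?_ h2.le
          have hδn : δ ^ n = δ * δ ^ (n - 1) := by
            rw [← pow_succ']; congr 1; omega
          have hle : ((l + 2) / c) ^ (n - 1) ≤ (3 / c) ^ (n - 1) * N ^ (1 / 4 : ℝ) := by
            have : (l + 2) / c ≤ 3 / c * l := by
              rw [div_mul_eq_mul_div]; gcongr; linarith
            refine (pow_le_pow_left₀ (by positivity) this _).trans ?_
            rw [mul_pow]
            gcongr
            rw [hl, ← Real.rpow_natCast, ← Real.rpow_mul hN0.le]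
            apply Real.rpow_le_rpow_of_exponent_le hN1
            rw [Nat.cast_sub (by omega)]; simpa using hθn
          calc δ ^ n * ω * N ^ (1 / 4 : ℝ) / (c * δ / (l + 2)) ^ (n - 1)
              = ω * δ * N ^ (1 / 4 : ℝ) * ((l + 2) / c) ^ (n - 1) := by
                rw [hδn]; simp only [div_pow, mul_pow]; field_simp
            _ ≤ ω * δ * N ^ (1 / 4 : ℝ) * ((3 / c) ^ (n - 1) * N ^ (1 / 4 : ℝ)) := by gcongr
            _ = ω * A₀ * (3 / c) ^ (n - 1) *
                (N ^ (1 / 4 : ℝ) * N ^ (1 / 4 : ℝ) * N ^ (-1 : ℝ)) := by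
                rw [hδ, Real.rpow_neg_one]; ring
            _ = _ := by
                rw [← Real.rpow_add hN0, ← Real.rpow_add hN0]; norm_num
    have e2 : volume (π ⁻¹' B₂ ∩ closedBall 0 5) ≤ ENNReal.ofReal (m / 2) := by
      have hsub : π ⁻¹' B₂ ∩ closedBall 0 5 ⊆
          π ⁻¹' (B₂ ∩ Set.Icc (fun _ => (-5 : ℝ)) (fun _ : Fin n => 5)) := by
        rintro x ⟨hx1, hx2⟩
        refine ⟨hx1, ?_, ?_⟩ <;>
        · intro i
          have h3 := PiLp.norm_apply_le x i
          rw [mem_closedBall_zero_iff] at hx2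
          have := abs_le.1 ((Real.norm_eq_abs _).symm.le.trans (h3.trans hx2))
          first | exact this.1 | exact this.2
      refine (measure_mono hsub).trans ?_
      rw [hmp.measure_preimage (hB₂m.inter measurableSet_Icc).nullMeasurableSet]
      refine hB₂v.trans (ENNReal.ofReal_le_ofReal (le_trans ?_ h1.le))
      calc C * P.totalDegree * δ ^ (1 - θ / 2) / l
          ≤ C * (S * N) * δ ^ (1 - θ / 2) / l := by gcongr
        _ = C * S * A₀ ^ (1 - θ / 2) * (N ^ (1 : ℝ) * N ^ (-(1 - θ / 2)) * N ^ (-θ)) := by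
          rw [hδ, Real.div_rpow hA₀.le hN0.le, Real.rpow_neg hN0.le, Real.rpow_neg hN0.le,
            Real.rpow_one]
          field_simp
          exact hl.symm
        _ = _ := by
          rw [← Real.rpow_add hN0, ← Real.rpow_add hN0]; congr 2; ring
    calc _ ≤ volume (B₁ ∪ (π ⁻¹' B₂ ∩ closedBall 0 5)) := by
          apply measure_mono
          rintro x ⟨hx1 | hx1, hx2⟩
          · exact Or.inl hx1
          · exact Or.inr ⟨hx1, hx2⟩
      _ ≤ ENNReal.ofReal (m / 2) + ENNReal.ofReal (m / 2) :=
          (measure_union_le _ _).trans (add_le_add e1 e2)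
      _ = _ := by
          rw [← ENNReal.ofReal_add (by positivity) (by positivity)]; congr 1; ring
  · exact hB₁ x fun h => hx (Or.inl h)
  · exact hB₂ _ fun h => hx (Or.inr h)

end

section

variable {n : ℕ} {A : Matrix (Fin n) (Fin n) ℝ}

theorem exists_small_parameters {c C₃ C₄ : ℝ} (hc : 0 < c) (hc1 : c ≤ 1) (hC₃ : 0 < C₃)
    (hC₄ : 0 < C₄) : ∃ (k : ℕ) (g : ℝ), 1 ≤ k ∧ 0 < g ∧ g ≤ 1 / 16 ∧ C₃ * 2 ^ (-(k : ℝ)) ≤ g ^ 3 ∧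
      16 * C₄ * g * (4 * k + 9) ≤ c := by
  have lim : Filter.Tendsto (fun k : ℕ => (k : ℝ) ^ 3 * (1 / 2 : ℝ) ^ k) Filter.atTop (nhds 0) :=
    tendsto_pow_const_mul_const_pow_of_abs_lt_one 3 (by rw [abs_of_pos] <;> norm_num)
  set a : ℝ := c / (16 * (C₄ + 1) * 13) with ha
  have ha0 : 0 < a := by positivity
  obtain ⟨k, hk1, hk⟩ := ((lim.eventually_lt_const
    (show (0:ℝ) < a ^ 3 / C₃ by positivity)).and (Filter.eventually_ge_atTop 1)).exists
  have hk0 : (1:ℝ) ≤ k := by exact_mod_cast hk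
  have hk00 : (0:ℝ) < k := by linarith
  have hk13 : (4 * k + 9 : ℝ) ≤ 13 * k := by linarith
  have hak : a / k ≤ a := div_le_self ha0.le hk0
  refine ⟨k, a / k, hk, by positivity, ?_, ?_, ?_⟩
  · refine hak.trans ?_
    rw [ha, div_le_div_iff₀ (by positivity) (by norm_num)]
    nlinarith
  · rw [div_pow, le_div_iff₀ (by positivity), Real.rpow_neg (by norm_num), Real.rpow_natCast]
    rw [lt_div_iff₀ hC₃] at hk1
    rw [one_div, inv_pow] at hk1
    nlinarith
  · calc 16 * C₄ * (a / k) * (4 * k + 9) ≤ 16 * C₄ * (a / k) * (13 * k) := by gcongr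
      _ = 16 * C₄ * 13 * a := by field_simp
      _ ≤ 16 * (C₄ + 1) * 13 * a := by gcongr; linarith
      _ = c := by rw [ha]; field_simp

theorem eval_taylorLine_zero (d : ℕ) (u : EuclideanSpace ℝ (Fin n) → ℝ)
    (v : EuclideanSpace ℝ (Fin n)) : (taylorLine d u v).eval 0 = u 0 := by
  rw [eval_taylorLine, Finset.sum_range_succ']
  simp

set_option maxHeartbeats 1000000 in
theorem exists_lt_hausdorffMeasure_zeros (hn : 2 ≤ n) (hA : A.PosDef) :
    ∃ Q : ℝ, 12 ≤ Q ∧ ∀ c : ℝ, 0 < c → c ≤ 1 → ∀ᶠ N : ℝ in Filter.atTop,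
      ∀ u : EuclideanSpace ℝ (Fin n) → ℝ, Sol A u → u 0 = 1 →
        (∀ y ∈ closedBall (0 : EuclideanSpace ℝ (Fin n)) Q, |u y| ≤ Real.exp N) →
        ∀ v₀ : EuclideanSpace ℝ (Fin n), ‖v₀‖ = 2 →
          (∀ y ∈ closedBall v₀ 1, |u y| ≤ Real.exp (-(c * N))) →
          ENNReal.ofReal (N ^ (1 / 4 : ℝ)) <
            μH[(n : ℝ) - 1] ({y | u y = 0} ∩ closedBall 0 Q) := by
  obtain ⟨Q, hQ, htaylor⟩ := exists_taylor_estimates hn hA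
  obtain ⟨C₁, c₂, hC₁, hc₂, hder⟩ := exists_abs_dd_le_of_doubling hn hA
  obtain ⟨C₃, hC₃, hsub⟩ := exists_volume_sublevel_le
  obtain ⟨C₄, hC₄, hbern⟩ := exists_exp_le_abs_eval
  refine ⟨Q, hQ, fun c hc hc1 => ?_⟩
  obtain ⟨k, g, hk1, hg, hg1, hkg, hgc⟩ := exists_small_parameters hc hc1 hC₃ hC₄
  set s : ℝ := 4 * k + 4 with hs
  have hs4 : 4 ≤ s := by rw [hs]; linarith [(Nat.cast_nonneg k : (0:ℝ) ≤ k)]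
  obtain ⟨σ, hσ⟩ : ∃ σ, σ = g ^ 2 := ⟨_, rfl⟩
  have hσ0 : 0 < σ := by rw [hσ]; positivity
  have hσg : σ ≤ g / 16 := by nlinarith
  have hsqrt : √σ = g := by rw [hσ, Real.sqrt_sq hg.le]
  have hσ1 : σ ≤ 1 := by linarith
  set τ : ℝ := g ^ 3 / 3 with hτ
  have hτ0 : 0 < τ := by positivity
  set ω : ℝ := (volume (closedBall (0 : EuclideanSpace ℝ (Fin n)) (1 / 2))).toReal with hω
  have hωe : ∀ v₀ : EuclideanSpace ℝ (Fin n),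
      volume (closedBall v₀ (1 / 2)) = ENNReal.ofReal ω := fun v₀ => by
    rw [Measure.addHaar_closedBall_center, hω, ENNReal.ofReal_toReal measure_closedBall_lt_top.ne]
  have hω0 : 0 < ω := ENNReal.toReal_pos (measure_closedBall_pos volume _ (by norm_num)).ne'
    measure_closedBall_lt_top.ne
  have hexc := exists_exceptional_set hn (c := c₂) (A₀ := 9 * C₁ / (2 * σ)) (S := s + 5)
    (m := τ ^ (n + 1) * ω / 3) hc₂ (by positivity) (by linarith) (by positivity)
  have hlim : ∀ᶠ N : ℝ in Filter.atTop, 1 / σ ≤ N ∧ 1 / c ≤ N ∧ 1 ≤ N :=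
    (Filter.eventually_ge_atTop _).and ((Filter.eventually_ge_atTop _).and
      (Filter.eventually_ge_atTop _))
  filter_upwards [hexc, hlim] with N hexcN hN u hu hu0 hbd v₀ hv₀ hsmall
  obtain ⟨hNσ, hNc, hN1⟩ := hN
  have hN0 : 0 < N := by linarith
  rw [div_le_iff₀ hσ0] at hNσ
  rw [div_le_iff₀ hc] at hNc
  by_contra hlt
  rw [not_lt] at hlt
  set δ : ℝ := 9 * C₁ / (2 * σ) / N with hδ
  obtain ⟨hδ0, hδ1, hexcN⟩ := hexcN
  -- Taylor polynomial
  set d : ℕ := ⌈(s + 3) * N⌉₊ with hd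
  have hd1 : (s + 3) * N ≤ (d : ℝ) + 1 := (Nat.le_ceil _).trans (by linarith)
  have hd2 : (d : ℝ) + 1 ≤ (s + 5) * N := by
    have := (Nat.ceil_lt_add_one (show 0 ≤ (s + 3) * N by positivity)).le
    rw [← hd] at this
    linarith
  set ε : ℝ := Real.exp (-(s * N)) with hε
  have hε0 : 0 < ε := Real.exp_pos _
  set T : ℝ := Real.exp N * Real.exp (-1) ^ (d + 1) with hT
  have hTe : T ≤ Real.exp (-((s + 2) * N)) := by
    rw [hT, ← Real.exp_nat_mul, ← Real.exp_add]
    apply Real.exp_le_exp.2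
    push_cast
    linarith
  have hexp2 : Real.exp (-(2 * N)) ≤ 1 / 2 := by
    have h1 : 2 ≤ Real.exp (2 * N) := by linarith [Real.add_one_le_exp (2 * N)]
    rw [Real.exp_neg, ← one_div]
    exact one_div_le_one_div_of_le (by norm_num) h1
  have hTε : T ≤ ε / 2 := by
    have : Real.exp (-((s + 2) * N)) = ε * Real.exp (-(2 * N)) := by
      rw [hε, ← Real.exp_add]; ring_nf
    rw [this] at hTe
    linarith [mul_le_mul_of_nonneg_left hexp2 hε0.le]
  have htail := htaylor u hu _ hbd d
  rw [← hT] at htail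
  set P := taylorMv (d + 1) u with hP
  have hPdeg : (P.totalDegree : ℝ) ≤ (s + 5) * N := by
    have : (P.totalDegree : ℝ) ≤ ((d + 1 : ℕ) : ℝ) := by
      exact_mod_cast totalDegree_taylorMv_le (d + 1) u
    push_cast at this
    linarith
  have hPtail : ∀ z : EuclideanSpace ℝ (Fin n), ‖z‖ ≤ 6 →
      |u z - MvPolynomial.eval (fun i => z i) P| ≤ ε / 2 := fun z hz => by
    have h1 := (htail ((1 / 2 : ℝ) • z) (by rw [norm_smul]; norm_num; linarith)).1 2 (by norm_num)
    rw [← eval_taylorMv_smul hu.smooth, smul_smul] at h1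
    norm_num at h1
    exact h1.trans hTε
  -- exceptional set
  obtain ⟨B, hBm, hBv, l, hl, hB⟩ := hexcN P ε
    ((μH[(n : ℝ) - 1]).restrict ({y | u y = 0} ∩ closedBall 0 Q)) hPdeg hε0
    (by rwa [Measure.restrict_apply_univ])
  obtain ⟨v, hv, hline⟩ := exists_line_volume_le (hBm.inter
    (measurableSet_closedBall (x := (0 : EuclideanSpace ℝ (Fin n))) (ε := 5))) hτ0 v₀
  rw [mem_closedBall, dist_eq_norm] at hv
  have hvn : ‖v‖ ≤ 5 / 2 := by
    have := norm_add_le (v - v₀) v₀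
    rw [sub_add_cancel] at this
    linarith
  obtain ⟨ht1, ht2, ht3⟩ := htail v (by linarith)
  set q := taylorLine (d + 1) u v with hq
  have hq0 : q.eval 0 = 1 := by rw [hq, eval_taylorLine_zero, hu0]
  have hqdeg : (q.natDegree : ℝ) ≤ (s + 5) * N := by
    have : (q.natDegree : ℝ) ≤ ((d + 1 : ℕ) : ℝ) := by
      exact_mod_cast natDegree_taylorLine_le (d + 1) u v
    push_cast at this
    linarith
  have hgood : ∀ t ∈ Set.Icc (-1 : ℝ) 2, t • v ∉ B → ε ≤ |q.eval t| →
      |q.derivative.eval t| ≤ σ * ((s + 5) * N) * |q.eval t| := by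
    intro t ht htB hεt
    have ht2' : |t| ≤ 2 := abs_le.2 ⟨by linarith [ht.1], ht.2⟩
    have htv : ‖t • v‖ ≤ 5 := by
      rw [norm_smul, Real.norm_eq_abs]
      exact (mul_le_mul ht2' hvn (norm_nonneg _) (by norm_num)).trans (by norm_num)
    obtain ⟨hν, hdb⟩ := hB _ htB
    rw [Measure.restrict_apply measurableSet_closedBall] at hν
    have hset : closedBall (t • v) δ ∩ ({y | u y = 0} ∩ closedBall 0 Q)
        = {y | u y = 0} ∩ closedBall (t • v) δ := by
      ext y
      simp only [Set.mem_inter_iff, mem_closedBall_zero_iff]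
      constructor
      · rintro ⟨h1, h2, -⟩; exact ⟨h2, h1⟩
      · rintro ⟨h1, h2⟩
        refine ⟨h2, h1, ?_⟩
        rw [mem_closedBall, dist_eq_norm] at h2
        have := norm_add_le (y - t • v) (t • v)
        rw [sub_add_cancel] at this
        linarith
    rw [hset] at hν
    have hPq : MvPolynomial.eval (fun i => (t • v) i) P = q.eval t :=
      eval_taylorMv_smul hu.smooth (d + 1) v t
    have h1 := hder u hu P ε δ l (t • v) hε0 hδ0 hδ1 hl htv hPtail hdb (by rwa [hPq]) hν v
    have h2 := ht1 t ht2'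
    have h3 := ht2 t ht2'
    have h4 : |u (t • v)| ≤ 3 / 2 * |q.eval t| := by
      have := abs_sub_abs_le_abs_sub (u (t • v)) (q.eval t)
      linarith
    have h5 : |q.derivative.eval t| ≤ |dd v u (t • v)| + |q.eval t| / 2 := by
      have := abs_sub_abs_le_abs_sub (q.derivative.eval t) (dd v u (t • v))
      rw [abs_sub_comm] at this
      linarith
    have h6 : C₁ * ‖v‖ / δ ≤ C₁ * 3 / δ := by gcongr; linarith
    have h7 : C₁ * 3 / δ * (3 / 2) = σ * N := by
      rw [hδ]; field_simp; norm_num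
    have h8 : |dd v u (t • v)| ≤ σ * N * |q.eval t| := by
      calc _ ≤ _ := h1
        _ ≤ C₁ * 3 / δ * (3 / 2 * |q.eval t|) := by gcongr
        _ = _ := by rw [← h7]; ring
    have h9 : 0 ≤ |q.eval t| := abs_nonneg _
    have h10 : 0 ≤ (N * σ) * |q.eval t| := by positivity
    have h11 := mul_le_mul_of_nonneg_right hNσ h9
    have h12 : 2 * (N * σ * |q.eval t|) ≤ (s + 5) * (N * σ * |q.eval t|) :=
      mul_le_mul_of_nonneg_right (by linarith) h10
    linarith
  have hsubl : volume {t ∈ Set.Icc (-2 : ℝ) 2 | |q.eval t| < ε} ≤ ENNReal.ofReal (g ^ 3) := by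
    have h1 := hsub q (2 * N) (by linarith) hq0 (fun z hz => (ht3 z hz).trans ?_) (s / 2) ?_
    · rw [show s / 2 * (2 * N) = s * N by ring] at h1
      refine h1.trans (ENNReal.ofReal_le_ofReal (le_trans (le_of_eq ?_) hkg))
      congr 3
      rw [hs]; ring
    · rw [two_mul N, Real.exp_add]
      have : 2 ≤ Real.exp N := by linarith [Real.add_one_le_exp N]
      exact mul_le_mul_of_nonneg_right this (Real.exp_pos N).le
    · have : (1:ℝ) ≤ k := by exact_mod_cast hk1
      rw [hs]; linarith
  have hlineτ : volume {t ∈ Set.Icc (-1 : ℝ) 2 | τ ≤ |t| ∧ t • v ∈ B ∩ closedBall 0 5}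
      ≤ ENNReal.ofReal τ := by
    refine hline.trans ?_
    rw [hωe]
    refine (ENNReal.div_le_div_right (mul_le_mul_right hBv _) _).trans ?_
    rw [show (3 : ENNReal) = ENNReal.ofReal 3 by simp, ← ENNReal.ofReal_mul (by norm_num),
      ← ENNReal.ofReal_mul (by positivity), ← ENNReal.ofReal_div_of_pos hω0]
    apply ENNReal.ofReal_le_ofReal
    apply le_of_eq
    field_simp
    ring
  have hE : volume {t ∈ Set.Icc (-1 : ℝ) 2 | σ * ((s + 5) * N) * |q.eval t| <
      |q.derivative.eval t|} ≤ ENNReal.ofReal (2 * g ^ 3) := by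
    calc
      _ ≤ volume (Set.Icc (-τ) τ ∪
          {t ∈ Set.Icc (-1 : ℝ) 2 | τ ≤ |t| ∧ t • v ∈ B ∩ closedBall 0 5} ∪
          {t ∈ Set.Icc (-2 : ℝ) 2 | |q.eval t| < ε}) := by
        apply measure_mono
        rintro t ⟨ht, htq⟩
        by_cases h1 : |t| ≤ τ
        · exact Or.inl (Or.inl (abs_le.1 h1))
        by_cases h2 : |q.eval t| < ε
        · exact Or.inr ⟨⟨by linarith [ht.1], ht.2⟩, h2⟩
        refine Or.inl (Or.inr ⟨ht, (not_le.1 h1).le, ?_, ?_⟩)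
        · by_contra h3
          exact absurd (hgood t ht h3 (not_lt.1 h2)) (not_le.2 htq)
        · rw [mem_closedBall_zero_iff, norm_smul, Real.norm_eq_abs]
          have : |t| ≤ 2 := abs_le.2 ⟨by linarith [ht.1], ht.2⟩
          exact (mul_le_mul this hvn (norm_nonneg _) (by norm_num)).trans (by norm_num)
      _ ≤ ENNReal.ofReal (τ - -τ) + ENNReal.ofReal τ + ENNReal.ofReal (g ^ 3) := by
        refine (measure_union_le _ _).trans (add_le_add ?_ hsubl)
        refine (measure_union_le _ _).trans (add_le_add ?_ hlineτ)
        rw [Real.volume_Icc]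
      _ = ENNReal.ofReal (2 * g ^ 3) := by
        rw [← ENNReal.ofReal_add (by linarith) hτ0.le,
          ← ENNReal.ofReal_add (by linarith) (by positivity)]
        congr 1; rw [hτ]; ring
  have hsum : √σ + 2 * g ^ 3 / (2 * σ) + σ ≤ 1 / 2 := by
    rw [hsqrt]
    have : 2 * g ^ 3 / (2 * σ) = g := by rw [hσ]; field_simp
    rw [this]; linarith
  obtain ⟨t, ht, hqt⟩ := hbern q ((s + 5) * N) σ (2 * g ^ 3) σ (by positivity) hσ0
    hσ1 (by positivity) hσ0 hq0 hqdeg hE hsum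
  have hκ : √σ + 2 * g ^ 3 / (2 * σ) + σ + √σ ≤ 4 * g := by
    rw [hsqrt]
    have : 2 * g ^ 3 / (2 * σ) = g := by rw [hσ]; field_simp
    rw [this]; linarith
  have h1 : |q.eval t| ≤ 2 * Real.exp (-(c * N)) := by
    have h2 := ht1 t (abs_le.2 ⟨by linarith [ht.1], by linarith [ht.2]⟩)
    have h3 := hsmall (t • v) (by
      rw [mem_closedBall, dist_eq_norm]
      have : t • v - v₀ = t • (v - v₀) + (t - 1) • v₀ := by
        rw [smul_sub, sub_smul, one_smul]; abel
      rw [this]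
      refine (norm_add_le _ _).trans ?_
      rw [norm_smul, norm_smul, hv₀, Real.norm_eq_abs, Real.norm_eq_abs,
        abs_of_nonneg (by linarith [ht.1] : (0:ℝ) ≤ t),
        abs_of_nonpos (by linarith [ht.2] : t - 1 ≤ 0)]
      linarith [ht.1, ht.2, mul_le_mul ht.2 hv (norm_nonneg _) zero_le_one])
    have h4 : Real.exp (-((s + 2) * N)) ≤ Real.exp (-(c * N)) :=
      Real.exp_le_exp.2
        (neg_le_neg (mul_le_mul_of_nonneg_right (by linarith) hN0.le))
    have := abs_sub_abs_le_abs_sub (q.eval t) (u (t • v))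
    rw [abs_sub_comm] at this
    linarith
  have h2 : Real.exp (-(c / 4 * N)) ≤ |q.eval t| := by
    refine le_trans (Real.exp_le_exp.2 ?_) hqt
    have : C₄ * (√σ + 2 * g ^ 3 / (2 * σ) + σ + √σ) * ((s + 5) * N)
        ≤ C₄ * (4 * g) * ((s + 5) * N) := by gcongr
    have h5 : 16 * C₄ * g * (s + 5) ≤ c := by
      rw [hs]; linarith
    have h6 := mul_le_mul_of_nonneg_right h5 hN0.le
    linarith
  have h3 : Real.exp (-(c * N)) * Real.exp (3 / 4 * (c * N)) = Real.exp (-(c / 4 * N)) := by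
    rw [← Real.exp_add]; ring_nf
  have h4 : 2 < Real.exp (3 / 4 * (c * N)) := by
    have h6 : Real.exp (3 / 4) ≤ Real.exp (3 / 4 * (c * N)) :=
      Real.exp_le_exp.2 (by linarith)
    have h7 := Real.quadratic_le_exp_of_nonneg (show (0:ℝ) ≤ 3 / 4 by norm_num)
    norm_num at h7
    linarith
  have h5 := Real.exp_pos (-(c * N))
  linarith [mul_lt_mul_of_pos_left h4 h5]

end

section

variable {n : ℕ} {A : Matrix (Fin n) (Fin n) ℝ} {u : EuclideanSpace ℝ (Fin n) → ℝ}

/-- A solution of polynomial growth along a sequence of radii is a polynomial. -/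
theorem exists_polynomial_of_growth (hn : 2 ≤ n) (hA : A.PosDef) (hu : Sol A u) (k : ℕ) (C : ℝ)
    (h : ∃ᶠ r : ℝ in Filter.atTop, ∀ y ∈ closedBall (0 : EuclideanSpace ℝ (Fin n)) r,
      |u y| ≤ C * r ^ k) :
    ∃ p : MvPolynomial (Fin n) ℝ, ∀ x, u x = MvPolynomial.eval (fun i => x i) p := by
  obtain ⟨C₁, hC₁, hb⟩ := exists_iterate_bound hn hA
  have hzero : ∀ v x, (dd v)^[k + 1] u x = 0 := by
    intro v x
    set D : ℝ := C * (k + 1).factorial * (2 * C₁ * ‖v‖) ^ (k + 1) with hD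
    have hlim : Filter.Tendsto (fun r : ℝ => D * r⁻¹) Filter.atTop (nhds 0) := by
      simpa using tendsto_inv_atTop_zero.const_mul D
    by_contra hne
    have hpos : 0 < |(dd v)^[k + 1] u x| := abs_pos.2 hne
    obtain ⟨r, hr, hr1, hr2⟩ := (h.and_eventually ((hlim.eventually_lt_const hpos).and
      (Filter.eventually_ge_atTop (2 * ‖x‖ + 1)))).exists
    have hx := norm_nonneg x
    have hr0 : 0 < r := by linarith
    have h1 := hb u hu x (r / 2) (by positivity) (C * r ^ k) (fun y hy => hr y (by
      rw [mem_closedBall, dist_eq_norm] at hy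
      rw [mem_closedBall_zero_iff]
      have := norm_add_le (y - x) x
      rw [sub_add_cancel] at this
      linarith)) v (k + 1)
    have h2 : C * r ^ k * (k + 1).factorial * (C₁ * ‖v‖ / (r / 2)) ^ (k + 1) = D * r⁻¹ := by
      rw [hD, div_pow, div_pow]; field_simp; ring
    linarith
  refine ⟨taylorMv k u, fun x => ?_⟩
  have h1 := taylor_bound (T := 1) (B := 0) k (fun j t => (dd x)^[j] u (t • x))
    (fun j t => by
      have := hasDerivAt_line (contDiff_iterate_dd hu.smooth x j) x t
      rwa [← Function.iterate_succ_apply' (dd x)] at this)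
    (fun t _ => by simp only [hzero, abs_zero, le_refl]) 1 (by simp)
  have h2 := eval_taylorMv_smul hu.smooth k x 1
  rw [eval_taylorLine] at h2
  simp only [one_smul, zero_smul, zero_mul, zero_div, Function.iterate_zero, id] at h1 h2
  rw [h2]
  exact sub_eq_zero.1 (abs_nonpos_iff.1 h1)

/-- Maximum of `|u|` on the closed ball of radius `r` about the origin. -/
def maxAbs (u : EuclideanSpace ℝ (Fin n) → ℝ) (r : ℝ) : ℝ :=
  sSup ((fun x => |u x|) '' closedBall 0 r)

theorem exists_abs_eq_maxAbs (hu : Continuous u) {r : ℝ} (hr : 0 ≤ r) :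
    ∃ x : EuclideanSpace ℝ (Fin n), ‖x‖ ≤ r ∧ |u x| = maxAbs u r := by
  obtain ⟨x, hx, hx'⟩ :=
    (isCompact_closedBall (0 : EuclideanSpace ℝ (Fin n)) r).exists_sSup_image_eq
    ⟨0, mem_closedBall_self hr⟩ hu.abs.continuousOn
  exact ⟨x, mem_closedBall_zero_iff.1 hx, hx'.symm⟩

theorem abs_le_maxAbs (hu : Continuous u) {r : ℝ} {x : EuclideanSpace ℝ (Fin n)} (hx : ‖x‖ ≤ r) :
    |u x| ≤ maxAbs u r :=
  le_csSup ((isCompact_closedBall _ _).image hu.abs).bddAbove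
    ⟨x, mem_closedBall_zero_iff.2 hx, rfl⟩

theorem maxAbs_mono (hu : Continuous u) {r s : ℝ} (hr : 0 ≤ r) (h : r ≤ s) :
    maxAbs u r ≤ maxAbs u s := by
  obtain ⟨x, hx, hx'⟩ := exists_abs_eq_maxAbs hu hr
  rw [← hx']
  exact abs_le_maxAbs hu (hx.trans h)

/-- The logarithm of the maximum of a non-polynomial solution has arbitrarily large increments
over geometric intervals. -/
theorem exists_large_increment (hn : 2 ≤ n) (hA : A.PosDef) (hu : Sol A u)
    (hp : ¬ ∃ p : MvPolynomial (Fin n) ℝ, ∀ x, u x = MvPolynomial.eval (fun i => x i) p)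
    {R₁ : ℝ} (hR₁ : 0 < R₁) (hpos : 0 < maxAbs u R₁) (D : ℝ) :
    ∃ R, R₁ < R ∧ R₁ ≤ R - R / 3 ∧
      D < Real.log (maxAbs u R) - Real.log (maxAbs u (R - R / 3)) := by
  by_contra! hcon
  have hc := hu.smooth.continuous
  have hmpos : ∀ r, R₁ ≤ r → 0 < maxAbs u r := fun r hr =>
    hpos.trans_le (maxAbs_mono hc hR₁.le hr)
  have hseq : ∀ j : ℕ, Real.log (maxAbs u ((3 / 2) ^ j * R₁)) ≤ Real.log (maxAbs u R₁) + j * D := by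
    intro j
    induction j with
    | zero => simp
    | succ j ih =>
      have h1 : (1:ℝ) ≤ (3 / 2) ^ j := one_le_pow₀ (by norm_num)
      have h2 := hcon ((3 / 2) ^ (j + 1) * R₁) (by rw [pow_succ]; nlinarith)
        (by rw [pow_succ]; nlinarith)
      rw [show (3 / 2 : ℝ) ^ (j + 1) * R₁ - (3 / 2) ^ (j + 1) * R₁ / 3 = (3 / 2) ^ j * R₁ by
        rw [pow_succ]; ring] at h2
      push_cast
      linarith
  obtain ⟨k, hk⟩ := exists_nat_gt (D / Real.log (3 / 2))
  have hl : 0 < Real.log (3 / 2) := Real.log_pos (by norm_num)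
  rw [div_lt_iff₀ hl] at hk
  refine hp (exists_polynomial_of_growth hn hA hu k (maxAbs u R₁ / R₁ ^ k) ?_)
  have htend : Filter.Tendsto (fun j : ℕ => (3 / 2 : ℝ) ^ j * R₁) Filter.atTop Filter.atTop :=
    (tendsto_pow_atTop_atTop_of_one_lt (by norm_num)).atTop_mul_const hR₁
  refine htend.frequently (Filter.Frequently.of_forall fun j y hy => ?_)
  have h1 : (1:ℝ) ≤ (3 / 2) ^ j := one_le_pow₀ (by norm_num)
  refine (abs_le_maxAbs hc (mem_closedBall_zero_iff.1 hy)).trans ?_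
  have h2 : maxAbs u R₁ / R₁ ^ k * ((3 / 2) ^ j * R₁) ^ k =
      maxAbs u R₁ * ((3 / 2 : ℝ) ^ j) ^ k := by rw [mul_pow]; field_simp
  rw [h2]
  rw [← Real.log_le_log_iff (hmpos _ (by nlinarith)) (by positivity),
    Real.log_mul hpos.ne' (by positivity), Real.log_pow, Real.log_pow]
  refine (hseq j).trans ?_
  have : (j : ℝ) * D ≤ j * (k * Real.log (3 / 2)) := by gcongr
  linarith

/-- A stopping-scale argument for monotone functions. -/
theorem exists_stopping_scale {q m : ℕ} (hq : 1 ≤ q) (hm : 1 ≤ m) {L : ℝ → ℝ} {a R₀ ρ₀ : ℝ}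
    (hL : MonotoneOn L (Set.Ici a)) (hρ₀ : 0 < ρ₀) (ha : a ≤ R₀ - ρ₀)
    (hd : 0 < L R₀ - L (R₀ - ρ₀)) :
    ∃ (j : ℕ) (R : ℝ), R₀ ≤ R ∧ R ≤ R₀ + 2 * q * ρ₀ ∧
      (2 ^ m) ^ j * (L R₀ - L (R₀ - ρ₀)) ≤ L R - L (R - ρ₀ / 2 ^ j) ∧
      L (R + q * (ρ₀ / 2 ^ j)) - L R ≤ (2 * q * 2 ^ m) * (L R - L (R - ρ₀ / 2 ^ j)) := by
  by_contra! hcon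
  have hq0 : (1:ℝ) ≤ q := by exact_mod_cast hq
  set d₀ := L R₀ - L (R₀ - ρ₀) with hd₀
  have main : ∀ j : ℕ, ∃ R, R₀ ≤ R ∧ R ≤ R₀ + 2 * q * ρ₀ * (1 - 1 / 2 ^ j) ∧
      (2 ^ m) ^ j * d₀ ≤ L R - L (R - ρ₀ / 2 ^ j) := by
    intro j
    induction j with
    | zero => exact ⟨R₀, le_rfl, by simp, by simp [hd₀]⟩
    | succ j ih =>
      obtain ⟨R, hR1, hR2, hR3⟩ := ih
      have hj : (0:ℝ) < 2 ^ j := by positivity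
      have hR2' : R ≤ R₀ + 2 * q * ρ₀ := by
        refine hR2.trans ?_
        have : 2 * q * ρ₀ * (1 - 1 / 2 ^ j) ≤ 2 * q * ρ₀ * 1 := by
          gcongr; linarith [one_div_pos.2 hj]
        linarith
      have h1 := hcon j R hR1 hR2' hR3
      set ρ := ρ₀ / 2 ^ j with hρ
      set d := L R - L (R - ρ) with hdd
      have hρ2 : ρ₀ / 2 ^ (j + 1) = ρ / 2 := by rw [hρ, pow_succ]; field_simp
      obtain ⟨i, hi, hi2⟩ : ∃ i ∈ Finset.range (2 * q), 2 ^ m * d <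
          L (R + (i + 1 : ℕ) * (ρ / 2)) - L (R + (i : ℕ) * (ρ / 2)) := by
        by_contra! hle
        have h2 := Finset.sum_le_sum hle
        rw [Finset.sum_range_sub (fun i : ℕ => L (R + i * (ρ / 2)))] at h2
        simp only [Finset.sum_const, Finset.card_range, nsmul_eq_mul, Nat.cast_mul,
          Nat.cast_ofNat, Nat.cast_zero, zero_mul, add_zero] at h2
        rw [show 2 * (q : ℝ) * (ρ / 2) = q * ρ by ring] at h2
        linarith
      rw [Finset.mem_range] at hi
      have hi' : ((i + 1 : ℕ) : ℝ) ≤ 2 * q := by exact_mod_cast hi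
      have hρ0 : 0 < ρ := by positivity
      refine ⟨R + (i + 1 : ℕ) * (ρ / 2), ?_, ?_, ?_⟩
      · have : 0 ≤ ((i + 1 : ℕ) : ℝ) * (ρ / 2) := by positivity
        linarith
      · have h3 : ((i + 1 : ℕ) : ℝ) * (ρ / 2) ≤ 2 * q * (ρ / 2) := by gcongr
        have h4 : 2 * q * ρ₀ * (1 - 1 / 2 ^ (j + 1)) =
            2 * q * ρ₀ * (1 - 1 / 2 ^ j) + 2 * q * (ρ / 2) := by
          rw [hρ, pow_succ]; field_simp; ring
        linarith
      · rw [hρ2, show R + (i + 1 : ℕ) * (ρ / 2) - ρ / 2 = R + (i : ℕ) * (ρ / 2) by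
          push_cast; ring, pow_succ]
        have h5 : (0:ℝ) < 2 ^ m := by positivity
        nlinarith
  have htend : Filter.Tendsto (fun j : ℕ => ((2:ℝ) ^ m) ^ j * d₀) Filter.atTop Filter.atTop :=
    (tendsto_pow_atTop_atTop_of_one_lt (one_lt_pow₀ (by norm_num) (by omega))).atTop_mul_const hd
  obtain ⟨j, hj⟩ := (htend.eventually_gt_atTop (L (R₀ + 2 * q * ρ₀) - L (R₀ - ρ₀))).exists
  obtain ⟨R, hR1, hR2, hR3⟩ := main j
  have hj0 : (0:ℝ) < 2 ^ j := by positivity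
  have hj1 : (1:ℝ) ≤ 2 ^ j := one_le_pow₀ (by norm_num)
  have hρle : ρ₀ / 2 ^ j ≤ ρ₀ := div_le_self hρ₀.le hj1
  have hR4 : R ≤ R₀ + 2 * q * ρ₀ := by
    refine hR2.trans ?_
    have : 2 * q * ρ₀ * (1 - 1 / 2 ^ j) ≤ 2 * q * ρ₀ * 1 := by
      gcongr; linarith [one_div_pos.2 hj0]
    linarith
  have h1 := hL (by simp only [Set.mem_Ici]; linarith) (by simp only [Set.mem_Ici]; linarith) hR4
  have h2 := hL (a := R₀ - ρ₀) (b := R - ρ₀ / 2 ^ j) (by simp only [Set.mem_Ici]; linarith)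
    (by simp only [Set.mem_Ici]; linarith) (by linarith)
  linarith

end

section

variable {n : ℕ} {A : Matrix (Fin n) (Fin n) ℝ} {u : EuclideanSpace ℝ (Fin n) → ℝ}

theorem hausdorffMeasure_zeros_rescale_le (hn : 1 ≤ n) (u : EuclideanSpace ℝ (Fin n) → ℝ)
    {a Q ρ : ℝ} (ha : a ≠ 0) (hρ : 0 < ρ) (x : EuclideanSpace ℝ (Fin n)) :
    μH[(n : ℝ) - 1] ({y | a * u (x + ρ • y) + 0 = 0} ∩ closedBall 0 Q) ≤
      ENNReal.ofReal ((ρ⁻¹) ^ (n - 1)) *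
        μH[(n : ℝ) - 1] ({y | u y = 0} ∩ closedBall 0 (‖x‖ + Q * ρ)) := by
  have hcast : (n : ℝ) - 1 = ((n - 1 : ℕ) : ℝ) := by rw [Nat.cast_sub hn]; simp
  have hlip : LipschitzWith (Real.toNNReal ρ⁻¹)
      fun z : EuclideanSpace ℝ (Fin n) => ρ⁻¹ • (z - x) := by
    refine LipschitzWith.of_dist_le_mul fun z w => ?_
    rw [dist_smul₀, Real.coe_toNNReal _ (inv_pos.2 hρ).le, Real.norm_of_nonneg (inv_pos.2 hρ).le,
      dist_sub_right]
  have h1 := hlip.hausdorffMeasure_image_le (d := (n : ℝ) - 1)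
    (by rw [hcast]; positivity) ({y | u y = 0} ∩ closedBall 0 (‖x‖ + Q * ρ))
  refine (measure_mono ?_).trans (h1.trans (le_of_eq ?_))
  · rintro y ⟨hy1, hy2⟩
    refine ⟨x + ρ • y, ⟨?_, ?_⟩, ?_⟩
    · simpa [ha] using hy1
    · rw [mem_closedBall_zero_iff] at hy2 ⊢
      refine (norm_add_le _ _).trans ?_
      rw [norm_smul, Real.norm_of_nonneg hρ.le, mul_comm]
      gcongr
    · simp [smul_smul, hρ.ne']
  · rw [hcast, ENNReal.rpow_natCast, ENNReal.ofReal_pow (inv_pos.2 hρ).le]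
    rfl

/-- A solution whose nodal volume grows at most like `r ^ (n - 1)` is a polynomial. -/
theorem exists_polynomial_of_hausdorffMeasure_le (hn : 2 ≤ n) (hA : A.PosDef) (hu : Sol A u)
    (hne : ∃ x, u x ≠ 0) {K r₀ : ℝ} (hK : 0 < K)
    (h : ∀ r : ℝ, r₀ < r →
      μH[(n : ℝ) - 1] ({x | u x = 0} ∩ closedBall (0 : EuclideanSpace ℝ (Fin n)) r)
        ≤ ENNReal.ofReal (K * r ^ (n - 1))) :
    ∃ p : MvPolynomial (Fin n) ℝ, ∀ x, u x = MvPolynomial.eval (fun i => x i) p := by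
  by_contra hp
  have hc := hu.smooth.continuous
  obtain ⟨Q, hQ, hcore⟩ := exists_lt_hausdorffMeasure_zeros hn hA
  obtain ⟨q, hq⟩ := exists_nat_ge Q
  have hq12 : (12:ℝ) ≤ q := hQ.trans hq
  have hq1 : 1 ≤ q := by
    have : (1:ℝ) ≤ q := by linarith
    exact_mod_cast this
  set B : ℝ := 2 * q * 2 ^ (4 * n) with hB
  have hB1 : 1 ≤ B := by
    have : (1:ℝ) ≤ 2 ^ (4 * n) := one_le_pow₀ (by norm_num)
    rw [hB]; nlinarith
  have hB0 : 0 < B := by linarith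
  obtain ⟨N₀, hN₀⟩ := Filter.eventually_atTop.1
    (hcore (1 / B) (by positivity) (by rw [div_le_one hB0]; exact hB1))
  obtain ⟨x₀, hx₀⟩ := hne
  set R₁ : ℝ := max (max r₀ ‖x₀‖) 1 with hR₁
  have hR₁r : r₀ ≤ R₁ := (le_max_left _ _).trans (le_max_left _ _)
  have hR₁x : ‖x₀‖ ≤ R₁ := (le_max_right _ _).trans (le_max_left _ _)
  have hR₁1 : 1 ≤ R₁ := le_max_right _ _
  have hR₁0 : 0 < R₁ := by linarith
  have hpos : 0 < maxAbs u R₁ := (abs_pos.2 hx₀).trans_le (abs_le_maxAbs hc hR₁x)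
  have hmpos : ∀ r, R₁ ≤ r → 0 < maxAbs u r := fun r hr =>
    hpos.trans_le (maxAbs_mono hc hR₁0.le hr)
  set K' : ℝ := K * (3 * (1 + q)) ^ (n - 1) with hK'
  have hK'0 : 0 < K' := by positivity
  obtain ⟨R₀, hR₀, hR₀3, hinc⟩ := exists_large_increment hn hA hu hp hR₁0 hpos
    (max (max N₀ (K' ^ 4)) 0)
  have hR₀0 : 0 < R₀ := by linarith
  set L : ℝ → ℝ := fun r => Real.log (maxAbs u r) with hL
  have hLmono : MonotoneOn L (Set.Ici R₁) := fun r hr s _ hrs =>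
    Real.log_le_log (hmpos r hr) (maxAbs_mono hc (hR₁0.le.trans hr) hrs)
  set d₀ : ℝ := L R₀ - L (R₀ - R₀ / 3) with hd₀
  have hd₀0 : 0 < d₀ := (le_max_right _ _).trans_lt hinc
  have hd₀N : N₀ ≤ d₀ := ((le_max_left _ _).trans (le_max_left _ _)).trans hinc.le
  have hd₀K : K' ^ 4 ≤ d₀ := ((le_max_right _ _).trans (le_max_left _ _)).trans hinc.le
  obtain ⟨j, R, hR1, hR2, hR3, hR4⟩ := exists_stopping_scale hq1 (m := 4 * n) (by omega) hLmono
    (ρ₀ := R₀ / 3) (by positivity) hR₀3 hd₀0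
  rw [← hd₀] at hR3
  set ρ : ℝ := R₀ / 3 / 2 ^ j with hρ
  have hj1 : (1:ℝ) ≤ 2 ^ j := one_le_pow₀ (by norm_num)
  have hρ0 : 0 < ρ := by positivity
  have hρ3 : ρ ≤ R₀ / 3 := div_le_self (by positivity) hj1
  set d : ℝ := L R - L (R - ρ) with hd
  have hd₀d : d₀ ≤ d := le_trans (le_mul_of_one_le_left hd₀0.le
    (one_le_pow₀ (one_le_pow₀ (by norm_num)))) hR3
  have hd0 : 0 < d := by linarith
  have hRR₁ : R₁ ≤ R - ρ := by linarith
  have hRpos := hmpos R (by linarith)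
  obtain ⟨x₁, hx₁, hx₁e⟩ := exists_abs_eq_maxAbs hc (r := R) (by linarith)
  have hx₁ρ : R - ρ < ‖x₁‖ := by
    by_contra! hle
    have := Real.log_le_log hRpos (hx₁e ▸ abs_le_maxAbs hc hle)
    linarith
  have hux₁ : u x₁ ≠ 0 := abs_pos.1 (hx₁e ▸ hRpos)
  have hx₁0 : 0 < ‖x₁‖ := by linarith
  have hratio : ∀ r l : ℝ, R₁ ≤ r → L r - L R ≤ l → ∀ y, ‖y‖ ≤ r →
      |(u x₁)⁻¹ * u y + 0| ≤ Real.exp l := by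
    intro r l hr hl y hy
    rw [add_zero, abs_mul, abs_inv, hx₁e, inv_mul_le_iff₀ hRpos]
    refine (abs_le_maxAbs hc hy).trans ?_
    rw [← Real.exp_log (hmpos r hr)]
    rw [← Real.exp_log hRpos]
    rw [← Real.exp_add]
    exact Real.exp_le_exp.2 (by simp only [hL] at hl; linarith)
  have hN : N₀ ≤ B * d := by nlinarith
  have hmain := hN₀ (B * d) hN _ ((hu.affine x₁ ρ).mul_add (u x₁)⁻¹ 0) (by simp [hux₁])
    (fun y hy => hratio (R + q * ρ) (B * d) ?_ hR4 _ ?_) (-(2 / ‖x₁‖) • x₁) ?_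
    (fun y hy => ?_)
  · refine absurd hmain (not_lt.2 ?_)
    refine (hausdorffMeasure_zeros_rescale_le (by omega) u (inv_ne_zero hux₁) hρ0 x₁).trans ?_
    have h1 : ‖x₁‖ + Q * ρ ≤ (1 + q) * R₀ := by
      have h2 : Q * ρ ≤ q * (R₀ / 3) := by gcongr
      linarith
    have h2 := h ((1 + q) * R₀) (by nlinarith)
    refine (mul_le_mul_right ((measure_mono (Set.inter_subset_inter_right _
      (closedBall_subset_closedBall h1))).trans h2) _).trans ?_
    rw [← ENNReal.ofReal_mul (by positivity)]
    apply ENNReal.ofReal_le_ofReal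
    have h3 : ρ⁻¹ ^ (n - 1) * (K * ((1 + q) * R₀) ^ (n - 1)) = K' * (2 ^ j) ^ (n - 1) := by
      have h5 : ρ⁻¹ * ((1 + q) * R₀) = 3 * (1 + q) * 2 ^ j := by rw [hρ]; field_simp
      rw [hK', mul_left_comm, ← mul_pow, h5, mul_pow, mul_assoc]
    rw [h3]
    have h4 : K' * (2 ^ j) ^ (n - 1) ≤ K' * (2 ^ j) ^ n := by
      gcongr
      omega
    refine h4.trans ?_
    rw [one_div, Real.le_rpow_inv_iff_of_pos (by positivity) (by positivity) (by norm_num)]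
    calc (K' * (2 ^ j) ^ n) ^ (4 : ℝ) = (2 ^ (4 * n)) ^ j * K' ^ 4 := by
          rw [show (4:ℝ) = ((4 : ℕ) : ℝ) by norm_num, Real.rpow_natCast, mul_pow, ← pow_mul,
            ← pow_mul, ← pow_mul]
          ring_nf
      _ ≤ (2 ^ (4 * n)) ^ j * d₀ := by gcongr
      _ ≤ d := hR3
      _ ≤ B * d := le_mul_of_one_le_left hd0.le hB1
  · have : 0 ≤ q * ρ := by positivity
    linarith
  · rw [mem_closedBall_zero_iff] at hy
    refine (norm_add_le _ _).trans ?_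
    rw [norm_smul, Real.norm_of_nonneg hρ0.le, mul_comm]
    gcongr
    exact hy.trans hq
  · rw [norm_smul, norm_neg, Real.norm_of_nonneg (by positivity)]
    field_simp
  · refine hratio (R - ρ) _ hRR₁ ?_ _ ?_
    · rw [one_div, inv_mul_cancel_left₀ hB0.ne']; linarith
    · rw [mem_closedBall, dist_eq_norm] at hy
      have e : x₁ + ρ • y = (1 - 2 * ρ / ‖x₁‖) • x₁ + ρ • (y - -(2 / ‖x₁‖) • x₁) := by
        rw [smul_sub, smul_smul, sub_smul, one_smul]
        module
      rw [e]
      refine (norm_add_le _ _).trans ?_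
      have h1 : 0 ≤ 1 - 2 * ρ / ‖x₁‖ := by
        rw [sub_nonneg, div_le_one hx₁0]; linarith
      rw [norm_smul, norm_smul, Real.norm_of_nonneg hρ0.le, Real.norm_of_nonneg h1, sub_mul,
        div_mul_cancel₀ _ hx₁0.ne']
      have := mul_le_mul_of_nonneg_left hy hρ0.le
      linarith

end

section

variable {n m : ℕ}

/-- Polynomial function on Euclidean space. -/
def polyFun (p : MvPolynomial (Fin n) ℝ) (x : EuclideanSpace ℝ (Fin n)) : ℝ :=
  MvPolynomial.eval (fun i => x i) p

theorem hasStrictFDerivAt_polyFun (p : MvPolynomial (Fin n) ℝ) (x : EuclideanSpace ℝ (Fin n)) :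
    HasStrictFDerivAt (polyFun p)
      (∑ i, polyFun (MvPolynomial.pderiv i p) x •
        (EuclideanSpace.proj i : EuclideanSpace ℝ (Fin n) →L[ℝ] ℝ)) x := by
  classical
  induction p using MvPolynomial.induction_on with
  | C a =>
    have : polyFun (MvPolynomial.C a : MvPolynomial (Fin n) ℝ) = fun _ => a := by
      ext; simp [polyFun]
    rw [this]
    refine (hasStrictFDerivAt_const a x).congr_fderiv ?_
    simp [polyFun]
  | add p q hp hq =>
    have : polyFun (p + q) = fun y => polyFun p y + polyFun q y := by ext; simp [polyFun]
    rw [this]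
    refine (hp.add hq).congr_fderiv ?_
    rw [← Finset.sum_add_distrib]
    simp [polyFun, add_smul]
  | mul_X p j hp =>
    have : polyFun (p * MvPolynomial.X j) =
        fun y => polyFun p y * (EuclideanSpace.proj j : EuclideanSpace ℝ (Fin n) →L[ℝ] ℝ) y := by
      ext; simp [polyFun]
    rw [this]
    refine (hp.mul (ContinuousLinearMap.hasStrictFDerivAt _)).congr_fderiv ?_
    simp only [polyFun, MvPolynomial.pderiv_mul, map_add, map_mul, MvPolynomial.eval_X, add_smul,
      Finset.sum_add_distrib, MvPolynomial.pderiv_X, Finset.smul_sum, smul_smul]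
    rw [add_comm]
    congr 1
    · refine Finset.sum_congr rfl fun i _ => ?_
      simp [mul_comm]
    · rw [Finset.sum_eq_single j]
      · simp
      · intro i _ hij
        simp [Pi.single_eq_of_ne' hij]
      · simp

theorem continuous_polyFun (p : MvPolynomial (Fin n) ℝ) : Continuous (polyFun p) :=
  continuous_iff_continuousAt.2 fun x => (hasStrictFDerivAt_polyFun p x).continuousAt

theorem totalDegree_pderiv_lt {p : MvPolynomial (Fin n) ℝ} {i : Fin n}
    (h : MvPolynomial.pderiv i p ≠ 0) :
    (MvPolynomial.pderiv i p).totalDegree < p.totalDegree := by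
  have key : ∀ s ∈ (MvPolynomial.pderiv i p).support, (s.sum fun _ e => e) + 1 ≤ p.totalDegree := by
    intro s hs
    rw [MvPolynomial.mem_support_iff, MvPolynomial.coeff_pderiv] at hs
    have h1 : s + Finsupp.single i 1 ∈ p.support :=
      MvPolynomial.mem_support_iff.2 (left_ne_zero_of_mul hs)
    have h2 := MvPolynomial.le_totalDegree h1
    rw [Finsupp.sum_add_index' (fun _ => rfl) (fun _ _ _ => rfl),
      Finsupp.sum_single_index rfl] at h2
    exact h2
  obtain ⟨s, hs⟩ := MvPolynomial.support_nonempty.2 h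
  have h0 := key s hs
  refine (Finset.sup_lt_iff (by rw [Nat.bot_eq_zero]; omega)).2 fun s hs => ?_
  have := key s hs
  omega

/-- Forget the `i`-th coordinate. -/
def dropCoord (i : Fin (m + 1)) (x : EuclideanSpace ℝ (Fin (m + 1))) : Fin m → ℝ :=
  fun j => x (i.succAbove j)

theorem continuous_dropCoord (i : Fin (m + 1)) : Continuous (dropCoord i) := by
  unfold dropCoord; fun_prop

/-- The part of the nodal set where the `i`-th partial derivative dominates. -/
def regularPart (p : MvPolynomial (Fin n) ℝ) (i : Fin n) : Set (EuclideanSpace ℝ (Fin n)) :=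
  {x | polyFun p x = 0 ∧ polyFun (MvPolynomial.pderiv i p) x ≠ 0 ∧
    ∀ j, |polyFun (MvPolynomial.pderiv j p) x| ≤ |polyFun (MvPolynomial.pderiv i p) x|}

theorem measurableSet_regularPart (p : MvPolynomial (Fin n) ℝ) (i : Fin n) :
    MeasurableSet (regularPart p i) := by
  have h : ∀ q : MvPolynomial (Fin n) ℝ, Measurable (polyFun q) :=
    fun q => (continuous_polyFun q).measurable
  have : regularPart p i = {x | polyFun p x = 0} ∩ ({x | polyFun (MvPolynomial.pderiv i p) x = 0}ᶜ ∩
      ⋂ j, {x | |polyFun (MvPolynomial.pderiv j p) x| ≤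
        |polyFun (MvPolynomial.pderiv i p) x|}) := by
    ext x; simp [regularPart]
  rw [this]
  refine (measurableSet_eq_fun (h _) measurable_const).inter
    ((measurableSet_eq_fun (h _) measurable_const).compl.inter (MeasurableSet.iInter fun j => ?_))
  exact measurableSet_le (continuous_abs.measurable.comp (h _))
    (continuous_abs.measurable.comp (h _))

theorem norm_le_sum_abs (x : EuclideanSpace ℝ (Fin n)) : ‖x‖ ≤ ∑ i, |x i| := by
  rw [EuclideanSpace.norm_eq]
  refine Real.sqrt_le_iff.2 ⟨Finset.sum_nonneg fun _ _ => abs_nonneg _, ?_⟩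
  simp only [Real.norm_eq_abs]
  exact Finset.sum_sq_le_sq_sum_of_nonneg fun _ _ => abs_nonneg _

theorem exists_dist_le_dropCoord {p : MvPolynomial (Fin (m + 1)) ℝ} {i : Fin (m + 1)}
    {x : EuclideanSpace ℝ (Fin (m + 1))} (hx : x ∈ regularPart p i) :
    ∃ δ, 0 < δ ∧ ∀ y ∈ ball x δ, ∀ z ∈ ball x δ, polyFun p y = 0 → polyFun p z = 0 →
      dist y z ≤ 4 * m * dist (dropCoord i y) (dropCoord i z) := by
  obtain ⟨-, hx1, hx2⟩ := hx
  set a := |polyFun (MvPolynomial.pderiv i p) x| with ha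
  have ha0 : 0 < a := abs_pos.2 hx1
  have h1 := (hasStrictFDerivAt_polyFun p x).isLittleO.def (half_pos ha0)
  rw [nhds_prod_eq] at h1
  obtain ⟨V, hV, hV'⟩ := Filter.eventually_prod_self_iff'.1 h1
  obtain ⟨δ, hδ, hδV⟩ := Metric.mem_nhds_iff.1 hV
  refine ⟨δ, hδ, fun y hy z hz hy0 hz0 => ?_⟩
  have h2 := hV' y (hδV hy) z (hδV hz)
  set w := y - z with hw
  set T := ∑ j : Fin m, |w (i.succAbove j)| with hT
  have hwn : ‖w‖ ≤ |w i| + T := by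
    refine (norm_le_sum_abs w).trans (le_of_eq ?_)
    rw [Fin.sum_univ_succAbove _ i]
  rw [hy0, hz0, sub_self, zero_sub, norm_neg, Real.norm_eq_abs] at h2
  have h3 : (∑ i, polyFun (MvPolynomial.pderiv i p) x •
      (EuclideanSpace.proj i : EuclideanSpace ℝ (Fin (m + 1)) →L[ℝ] ℝ)) w =
      polyFun (MvPolynomial.pderiv i p) x * w i + ∑ j : Fin m,
        polyFun (MvPolynomial.pderiv (i.succAbove j) p) x * w (i.succAbove j) := by
    rw [sum_apply, Fin.sum_univ_succAbove _ i]
    simp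
  rw [h3] at h2
  have h4 : |∑ j : Fin m, polyFun (MvPolynomial.pderiv (i.succAbove j) p) x *
      w (i.succAbove j)| ≤ a * T := by
    rw [hT, Finset.mul_sum]
    refine (Finset.abs_sum_le_sum_abs _ _).trans (Finset.sum_le_sum fun j _ => ?_)
    rw [abs_mul]
    exact mul_le_mul_of_nonneg_right (hx2 _) (abs_nonneg _)
  have h5 : a * |w i| ≤ a / 2 * ‖w‖ + a * T := by
    rw [ha, ← abs_mul]
    have := abs_sub_abs_le_abs_sub (polyFun (MvPolynomial.pderiv i p) x * w i)
      (-∑ j : Fin m, polyFun (MvPolynomial.pderiv (i.succAbove j) p) x * w (i.succAbove j))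
    rw [sub_neg_eq_add, abs_neg] at this
    rw [← ha]
    linarith
  have h6 : |w i| ≤ 3 * T := by
    have : a * |w i| ≤ a / 2 * (|w i| + T) + a * T := by
      refine h5.trans ?_
      gcongr
    have : a * |w i| ≤ a * (3 * T) := by linarith
    exact le_of_mul_le_mul_left this ha0
  have h7 : T ≤ m * dist (dropCoord i y) (dropCoord i z) := by
    calc T ≤ ∑ _j : Fin m, dist (dropCoord i y) (dropCoord i z) := by
          refine Finset.sum_le_sum fun j _ => ?_
          have := dist_le_pi_dist (dropCoord i y) (dropCoord i z) j
          simpa [dropCoord, Real.dist_eq, hw] using this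
      _ = _ := by simp
  rw [dist_eq_norm, ← hw]
  linarith

end

section

variable {n m : ℕ}

/-- A line parallel to a coordinate axis carries few points of the regular part. -/
theorem card_le_of_dropCoord_eq {ι : Type*} {p : MvPolynomial (Fin (m + 1)) ℝ} {i : Fin (m + 1)}
    (F : Finset ι) (z : ι → EuclideanSpace ℝ (Fin (m + 1))) (hz : ∀ k ∈ F, z k ∈ regularPart p i)
    (hinj : ∀ k ∈ F, ∀ l ∈ F, z k = z l → k = l) {w : Fin m → ℝ}
    (hw : ∀ k ∈ F, dropCoord i (z k) = w) : F.card ≤ p.totalDegree := by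
  classical
  rcases F.eq_empty_or_nonempty with rfl | ⟨k₀, hk₀⟩
  · simp
  set g : Fin (m + 1) → Polynomial ℝ := i.insertNth Polynomial.X (fun j => Polynomial.C (w j))
    with hg
  set q : Polynomial ℝ := MvPolynomial.aeval g p with hq
  have hline : ∀ t : ℝ, q.eval t =
      polyFun p (z k₀ + (t - z k₀ i) • EuclideanSpace.single i (1 : ℝ)) := by
    intro t
    rw [hq, polyFun, ← Polynomial.coe_aeval_eq_eval]
    change (Polynomial.aeval t) (MvPolynomial.aeval g p) = _
    rw [← AlgHom.comp_apply, MvPolynomial.comp_aeval, ← MvPolynomial.coe_aeval_eq_eval]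
    change _ = MvPolynomial.aeval _ p
    congr 2
    funext j
    rcases Fin.eq_self_or_eq_succAbove i j with rfl | ⟨j, rfl⟩
    · simp [hg]
    · simp [hg, ← hw k₀ hk₀, dropCoord]
  have hpt : ∀ k ∈ F, z k = z k₀ + (z k i - z k₀ i) • EuclideanSpace.single i (1 : ℝ) := by
    intro k hk
    ext j
    rcases Fin.eq_self_or_eq_succAbove i j with rfl | ⟨j, rfl⟩
    · simp
    · have := congrFun ((hw k hk).trans (hw k₀ hk₀).symm) j
      simpa [dropCoord] using this
  have hq0 : q ≠ 0 := by
    intro h0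
    have h1 : HasDerivAt (fun t : ℝ => z k₀ + (t - z k₀ i) • EuclideanSpace.single i (1 : ℝ))
        (EuclideanSpace.single i (1 : ℝ)) (z k₀ i) := by
      simpa using (((hasDerivAt_id (z k₀ i)).sub_const (z k₀ i)).smul_const
        (EuclideanSpace.single i (1 : ℝ))).const_add (z k₀)
    have h2 := (hasStrictFDerivAt_polyFun p (z k₀)).hasFDerivAt
    have h3 := HasFDerivAt.comp_hasDerivAt_of_eq (z k₀ i) h2 h1 (by simp)
    have h5 : (polyFun p ∘ fun t : ℝ => z k₀ + (t - z k₀ i) • EuclideanSpace.single i (1 : ℝ))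
        = fun _ => 0 := by
      funext t
      simp only [Function.comp_apply, ← hline, h0, Polynomial.eval_zero]
    rw [h5] at h3
    have h4 := h3.unique (hasDerivAt_const (z k₀ i) (0 : ℝ))
    refine (hz k₀ hk₀).2.1 ?_
    rw [sum_apply] at h4
    simpa [Pi.single_apply] using h4
  have hdeg : q.natDegree ≤ p.totalDegree := by
    refine (MvPolynomial.aeval_natDegree_le p le_rfl g (n := 1) fun j => ?_).trans (by simp)
    rcases Fin.eq_self_or_eq_succAbove i j with rfl | ⟨j, rfl⟩
    · simp [hg]
    · simp [hg]
  calc F.card ≤ q.roots.toFinset.card := by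
        refine Finset.card_le_card_of_injOn (fun k => z k i) (fun k hk => ?_) fun k hk l hl h => ?_
        · rw [Finset.mem_coe, Multiset.mem_toFinset, Polynomial.mem_roots hq0, Polynomial.IsRoot,
            hline, ← hpt k hk]
          exact (hz k hk).1
        · refine hinj k hk l hl ?_
          rw [hpt k hk, hpt l hl]
          simp only at h
          rw [h]
    _ ≤ q.natDegree := (Multiset.toFinset_card_le _).trans (Polynomial.card_roots' q)
    _ ≤ p.totalDegree := hdeg

theorem hausdorffMeasure_le_volume_dropCoord {i : Fin (m + 1)}
    {S : Set (EuclideanSpace ℝ (Fin (m + 1)))}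
    (hS : ∀ y ∈ S, ∀ z ∈ S, dist y z ≤ 4 * m * dist (dropCoord i y) (dropCoord i z)) :
    μH[(m : ℝ)] S ≤ ENNReal.ofReal ((4 * m) ^ m) * volume (dropCoord i '' S) := by
  have hinj : Set.InjOn (dropCoord i) S := fun y hy z hz h => by
    have := hS y hy z hz
    rw [h, dist_self, mul_zero] at this
    exact dist_le_zero.1 this
  have hlip : LipschitzOnWith (4 * m) (Function.invFunOn (dropCoord i) S) (dropCoord i '' S) := by
    refine LipschitzOnWith.of_dist_le_mul ?_
    rintro _ ⟨y, hy, rfl⟩ _ ⟨z, hz, rfl⟩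
    rw [hinj.leftInvOn_invFunOn hy, hinj.leftInvOn_invFunOn hz]
    simpa using hS y hy z hz
  have h1 := hlip.hausdorffMeasure_image_le (d := (m : ℝ)) (by positivity)
  rw [hinj.leftInvOn_invFunOn.image_image] at h1
  refine h1.trans (le_of_eq ?_)
  have h2 : (μH[(m : ℝ)] : Measure (Fin m → ℝ)) = volume := by
    simpa using hausdorffMeasure_pi_real (ι := Fin m)
  rw [h2, ENNReal.rpow_natCast, ENNReal.ofReal_pow (by positivity)]
  congr 2
  rw [ENNReal.ofReal_mul (by norm_num)]
  simp

theorem hausdorffMeasure_regularPart_le (p : MvPolynomial (Fin (m + 1)) ℝ) (i : Fin (m + 1))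
    {r : ℝ} (hr : 0 ≤ r) : μH[(m : ℝ)] (regularPart p i ∩ closedBall 0 r) ≤
      ENNReal.ofReal ((4 * m) ^ m * p.totalDegree * (2 * r) ^ m) := by
  rcases (regularPart p i).eq_empty_or_nonempty with he | hne
  · simp [he]
  choose! δ hδ hδd using fun x (hx : x ∈ regularPart p i) => exists_dist_le_dropCoord hx
  obtain ⟨s, hs, hsc, hcov⟩ := TopologicalSpace.countable_cover_nhdsWithin
    (f := fun x => ball x (δ x)) (s := regularPart p i)
    fun x hx => mem_nhdsWithin_of_mem_nhds (ball_mem_nhds x (hδ x hx))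
  have hsne : s.Nonempty := by
    by_contra h
    rw [Set.not_nonempty_iff_eq_empty] at h
    obtain ⟨x, hx⟩ := hne
    simpa [h] using hcov hx
  obtain ⟨x, hx⟩ := hsc.exists_eq_range hsne
  have hxmem : ∀ k, x k ∈ regularPart p i := fun k => hs (hx ▸ Set.mem_range_self k)
  set U : ℕ → Set (EuclideanSpace ℝ (Fin (m + 1))) := fun k => ball (x k) (δ (x k)) with hU
  set S : ℕ → Set (EuclideanSpace ℝ (Fin (m + 1))) :=
    fun k => (regularPart p i ∩ closedBall 0 r) ∩ disjointed U k with hSdef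
  have hSm : ∀ k, MeasurableSet (S k) := fun k =>
    ((measurableSet_regularPart p i).inter measurableSet_closedBall).inter
      (MeasurableSet.disjointed (fun k => measurableSet_ball) k)
  have hSdist : ∀ k, ∀ y ∈ S k, ∀ z ∈ S k,
      dist y z ≤ 4 * m * dist (dropCoord i y) (dropCoord i z) := fun k y hy z hz =>
    hδd (x k) (hxmem k) y (disjointed_le U k hy.2) z (disjointed_le U k hz.2) hy.1.1.1 hz.1.1.1
  have hSinj : ∀ k, Set.InjOn (dropCoord i) (S k) := fun k y hy z hz h => by
    have := hSdist k y hy z hz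
    rw [h, dist_self, mul_zero] at this
    exact dist_le_zero.1 this
  have hπm : ∀ k, MeasurableSet (dropCoord i '' S k) := fun k =>
    (hSm k).image_of_continuousOn_injOn (continuous_dropCoord i).continuousOn (hSinj k)
  have hunion : regularPart p i ∩ closedBall 0 r ⊆ ⋃ k, S k := by
    rintro y hy
    have : y ∈ ⋃ k, disjointed U k := by
      rw [iUnion_disjointed]
      have := hcov hy.1
      rw [hx, Set.biUnion_range] at this
      exact this
    rw [Set.mem_iUnion] at this ⊢
    obtain ⟨k, hk⟩ := this
    exact ⟨k, hy, hk⟩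
  have hcount : ∀ w, ∑' k, (dropCoord i '' S k).indicator (1 : (Fin m → ℝ) → ENNReal) w ≤
      (Set.Icc (fun _ => -r) (fun _ : Fin m => r)).indicator
        (fun _ => (p.totalDegree : ENNReal)) w := by
    classical
    intro w
    by_cases hw : w ∈ Set.Icc (fun _ => -r) (fun _ : Fin m => r)
    · rw [Set.indicator_of_mem hw, ENNReal.tsum_eq_iSup_sum]
      refine iSup_le fun F => ?_
      set G := F.filter fun k => w ∈ dropCoord i '' S k with hG
      have h1 : ∑ k ∈ F, (dropCoord i '' S k).indicator (1 : (Fin m → ℝ) → ENNReal) w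
          = G.card := by
        simp only [Set.indicator_apply, Pi.one_apply]
        rw [Finset.sum_boole]
      rw [h1]
      choose! z hz using fun k (hk : k ∈ G) => (Finset.mem_filter.1 hk).2
      have := card_le_of_dropCoord_eq (p := p) (i := i) G z (fun k hk => (hz k hk).1.1.1)
        (fun k hk l hl h => by
          by_contra hne
          have hd := disjoint_disjointed U hne
          exact Set.disjoint_left.1 hd (hz k hk).1.2 (h ▸ (hz l hl).1.2))
        (fun k hk => (hz k hk).2)
      exact_mod_cast this
    · rw [Set.indicator_of_notMem hw, nonpos_iff_eq_zero, ENNReal.tsum_eq_zero]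
      intro k
      rw [Set.indicator_of_notMem]
      rintro ⟨y, hy, rfl⟩
      have hy2 := mem_closedBall_zero_iff.1 hy.1.2
      refine hw ⟨fun j => ?_, fun j => ?_⟩ <;>
      · have := abs_le.1 ((Real.norm_eq_abs _).symm.le.trans
          ((PiLp.norm_apply_le y (i.succAbove j)).trans hy2))
        first | exact this.1 | exact this.2
  calc μH[(m : ℝ)] (regularPart p i ∩ closedBall 0 r) ≤ ∑' k, μH[(m : ℝ)] (S k) :=
        (measure_mono hunion).trans (measure_iUnion_le _)
    _ ≤ ∑' k, ENNReal.ofReal ((4 * m) ^ m) * volume (dropCoord i '' S k) :=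
        ENNReal.tsum_le_tsum fun k => hausdorffMeasure_le_volume_dropCoord (hSdist k)
    _ = ENNReal.ofReal ((4 * m) ^ m) *
          ∫⁻ w, ∑' k, (dropCoord i '' S k).indicator (1 : (Fin m → ℝ) → ENNReal) w := by
        rw [ENNReal.tsum_mul_left, lintegral_tsum fun k =>
          (measurable_one.indicator (hπm k)).aemeasurable]
        simp_rw [lintegral_indicator_one (hπm _)]
    _ ≤ ENNReal.ofReal ((4 * m) ^ m) * (p.totalDegree * ENNReal.ofReal ((2 * r) ^ m)) := by
        gcongr
        refine (lintegral_mono hcount).trans (le_of_eq ?_)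
        rw [lintegral_indicator_const measurableSet_Icc, Real.volume_Icc_pi]
        simp only [sub_neg_eq_add, ← two_mul, Finset.prod_const, Finset.card_univ,
          Fintype.card_fin]
        rw [ENNReal.ofReal_pow (by positivity)]
    _ = _ := by
        rw [← ENNReal.ofReal_natCast, ← ENNReal.ofReal_mul (by positivity),
          ← ENNReal.ofReal_mul (by positivity), mul_assoc]

theorem exists_hausdorffMeasure_zeros_polyFun_le (d : ℕ) (p : MvPolynomial (Fin (m + 1)) ℝ)
    (hd : p.totalDegree ≤ d) (hp : p ≠ 0) : ∃ K : ℝ, 0 < K ∧ ∀ r : ℝ, 0 ≤ r →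
      μH[(m : ℝ)] ({x | polyFun p x = 0} ∩ closedBall 0 r) ≤ ENNReal.ofReal (K * r ^ m) := by
  induction d using Nat.strong_induction_on generalizing p with
  | _ d ih =>
    by_cases hex : ∃ j, MvPolynomial.pderiv j p ≠ 0
    · obtain ⟨j, hj⟩ := hex
      obtain ⟨K, hK, hKr⟩ := ih _ ((totalDegree_pderiv_lt hj).trans_le hd) _ le_rfl hj
      refine ⟨K + (m + 1) * ((4 * m) ^ m * p.totalDegree * 2 ^ m), by positivity, fun r hr => ?_⟩
      calc _ ≤ μH[(m : ℝ)] (({x | polyFun (MvPolynomial.pderiv j p) x = 0} ∩ closedBall 0 r) ∪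
            ⋃ i, (regularPart p i ∩ closedBall 0 r)) := by
            apply measure_mono
            rintro x ⟨hx, hxr⟩
            by_cases hxj : polyFun (MvPolynomial.pderiv j p) x = 0
            · exact Or.inl ⟨hxj, hxr⟩
            obtain ⟨i, -, hi⟩ := Finset.exists_max_image Finset.univ
              (fun i => |polyFun (MvPolynomial.pderiv i p) x|) Finset.univ_nonempty
            refine Or.inr (Set.mem_iUnion.2 ⟨i, ⟨hx, ?_, fun k => hi k (Finset.mem_univ k)⟩, hxr⟩)
            exact abs_pos.1 ((abs_pos.2 hxj).trans_le (hi j (Finset.mem_univ j)))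
        _ ≤ ENNReal.ofReal (K * r ^ m) + ∑ _i : Fin (m + 1),
            ENNReal.ofReal ((4 * m) ^ m * p.totalDegree * (2 * r) ^ m) := by
            refine (measure_union_le _ _).trans (add_le_add (hKr r hr) ?_)
            refine (measure_iUnion_fintype_le _ _).trans (Finset.sum_le_sum fun i _ => ?_)
            exact hausdorffMeasure_regularPart_le p i hr
        _ = _ := by
            rw [← ENNReal.ofReal_sum_of_nonneg fun _ _ => by positivity,
              ← ENNReal.ofReal_add (by positivity) (by positivity)]
            congr 1
            simp only [Finset.sum_const, Finset.card_univ, Fintype.card_fin, nsmul_eq_mul]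
            push_cast
            ring
    · push Not at hex
      have hconst : ∀ x, polyFun p x = polyFun p 0 := fun x => by
        refine is_const_of_fderiv_eq_zero (𝕜 := ℝ)
          (fun y => (hasStrictFDerivAt_polyFun p y).differentiableAt) (fun y => ?_) x 0
        rw [(hasStrictFDerivAt_polyFun p y).hasFDerivAt.fderiv]
        simp [hex, polyFun]
      have h0 : polyFun p 0 ≠ 0 := fun h0 => hp <| MvPolynomial.funext fun x => by
        have := hconst (WithLp.toLp 2 x)
        rw [h0] at this
        simpa [polyFun] using this
      refine ⟨1, one_pos, fun r _ => ?_⟩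
      simp [hconst, h0]

end

end NodalLiouville

/-- Theorem 1.12 of the paper (a Liouville-type theorem): for a constant-coefficient
uniformly elliptic equation on `ℝⁿ`, the nodal volume grows like `r^{n-1}` if and only if
the solution is a polynomial. -/
theorem stmt_7 (n : ℕ) (hn : 2 ≤ n) (A : Matrix (Fin n) (Fin n) ℝ) (hA : A.PosDef)
    (u : EuclideanSpace ℝ (Fin n) → ℝ) (hu : ContDiff ℝ (⊤ : ℕ∞) u)
    (hsol : ∀ x : EuclideanSpace ℝ (Fin n), ∑ i, ∑ j, A i j * pd i (pd j u) x = 0)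
    (hne : ∃ x, u x ≠ 0) :
    (∃ (K r₀ : ℝ), 0 < K ∧ 0 < r₀ ∧ ∀ r : ℝ, r₀ < r →
        μH[(n : ℝ) - 1] ({x | u x = 0} ∩ closedBall (0 : EuclideanSpace ℝ (Fin n)) r)
          ≤ ENNReal.ofReal (K * r ^ (n - 1)))
      ↔ ∃ p : MvPolynomial (Fin n) ℝ,
          ∀ x : EuclideanSpace ℝ (Fin n), u x = MvPolynomial.eval (fun i => x i) p := by
  constructor
  · rintro ⟨K, r₀, hK, -, h⟩
    exact NodalLiouville.exists_polynomial_of_hausdorffMeasure_le hn hA ⟨hu, hsol⟩ hne hK h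
  · rintro ⟨p, hp⟩
    obtain ⟨m, rfl⟩ : ∃ m, n = m + 1 := ⟨n - 1, by omega⟩
    have hp0 : p ≠ 0 := by
      rintro rfl
      obtain ⟨x, hx⟩ := hne
      exact hx (by simp [hp])
    obtain ⟨K, hK, h⟩ :=
      NodalLiouville.exists_hausdorffMeasure_zeros_polyFun_le p.totalDegree p le_rfl hp0
    obtain rfl : u = NodalLiouville.polyFun p := funext hp
    refine ⟨K, 1, hK, one_pos, fun r hr => ?_⟩
    rw [Nat.cast_add_one, add_sub_cancel_right, Nat.add_sub_cancel]
    exact h r (by linarith)
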